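/- Define ε3(n) := −4√6 if n ≡ 0 (mod 3) and ε3(n) := 2√6 if n ≡ 1 or 2 (mod 3). Then A(1/3;n) ∼ ε3(n)·cosh(π√(8n−1)/12)/(3√(8n−1)) as n → ∞; that is, the quotient A(1/3;n)·3√(8n−1)/(ε3(n)·cosh(π√(8n−1)/12)) tends to 1 as n → ∞. (Here A(1/3;n) = N2(0,3,n) − N2(1,3,n).) -/

import Mathlib

open scoped Classical

/-- The M2-rank of a partition: ⌈ℓ/2⌉ − s, where ℓ is the largest part
(0 for the empty partition) and s is the number of parts. -/
def m2Rank {n : ℕ} (P : n.Partition) : ℤ :=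
  (((P.parts.sup + 1) / 2 : ℕ) : ℤ) - (Multiset.card P.parts : ℤ)

/-- A partition has no repeated odd parts. -/
def NoRepeatedOddParts {n : ℕ} (P : n.Partition) : Prop :=
  ∀ j : ℕ, Odd j → P.parts.count j ≤ 1

/-- `N2 r m n` is the number of partitions of `n` without repeated odd parts whose
M2-rank is congruent to `r` modulo `m`. -/
noncomputable def N2 (r : ℤ) (m n : ℕ) : ℕ :=
  Nat.card {P : n.Partition // NoRepeatedOddParts P ∧ m2Rank P ≡ r [ZMOD (m : ℤ)]}

/-- `Acoef a c n = Σ_{r=0}^{c−1} N2(r,c,n)·e^{2πiar/c}`, the coefficient of `q^n`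
in the M2-rank generating function `R2(e^{2πia/c};q)`. -/
noncomputable def Acoef (a : ℤ) (c n : ℕ) : ℂ :=
  ∑ r ∈ Finset.range c,
    (N2 (r : ℤ) c n : ℂ) * Complex.exp (2 * Real.pi * Complex.I * (a : ℂ) * (r : ℂ) / (c : ℂ))

namespace M2

lemma summable_zpow_quad (r : ℝ) (h0 : 0 < r) (h1 : r < 1) (a b : ℤ) (ha : 0 < a) :
    Summable (fun k : ℤ => r ^ (a * k ^ 2 + b * k)) := by
  have hl : Real.log r < 0 := Real.log_neg h0 h1
  have ha' : (0 : ℝ) < a := by exact_mod_cast ha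
  have hT : 0 < -(a : ℝ) * Real.log r / Real.pi := by
    apply div_pos _ Real.pi_pos
    nlinarith
  have := summable_pow_mul_jacobiTheta₂_term_bound (|(b : ℝ)| * (-Real.log r) / (2 * Real.pi)) hT 0
  refine Summable.of_nonneg_of_le (fun k => (zpow_pos h0 _).le) (fun k => ?_) this
  rw [pow_zero, one_mul, ← Real.rpow_intCast, Real.rpow_def_of_pos h0]
  apply Real.exp_le_exp.mpr
  push_cast
  have hpi : Real.pi ≠ 0 := Real.pi_ne_zero
  have h2 : -Real.pi * (-(a : ℝ) * Real.log r / Real.pi * (k : ℝ) ^ 2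
      - 2 * (|(b : ℝ)| * (-Real.log r) / (2 * Real.pi)) * |(k : ℝ)|)
      = Real.log r * (a * k ^ 2 - |(b : ℝ)| * |(k : ℝ)|) := by
    field_simp
    ring
  have h3 : Real.log r * ((a : ℝ) * k ^ 2 + b * k) ≤ Real.log r * (a * k ^ 2 - |(b : ℝ)| * |(k : ℝ)|) := by
    apply mul_le_mul_of_nonpos_left _ hl.le
    have := neg_abs_le ((b : ℝ) * k)
    rw [abs_mul] at this
    linarith
  calc _ ≤ _ := h3
    _ = _ := by rw [← h2]

/-- rescaling a circle integral about 0 -/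
lemma circleIntegral_scale (F : ℂ → ℂ) (c : ℂ) (R : ℝ) :
    (∮ z in C(0, ‖c‖ * R), F z) = c * ∮ z in C(0, R), F (c * z) := by
  set β := Complex.arg c
  have hcm : ∀ θ : ℝ, circleMap 0 (‖c‖ * R) (θ + β) = c * circleMap 0 R θ := by
    intro θ
    have hcc : c = ‖c‖ * Complex.exp (β * Complex.I) := (Complex.norm_mul_exp_arg_mul_I c).symm
    simp only [circleMap, zero_add]
    conv_rhs => rw [hcc]
    push_cast
    rw [add_mul, Complex.exp_add]
    ring
  have hper : Function.Periodic (fun θ : ℝ => deriv (circleMap 0 (‖c‖ * R)) θ • F (circleMap 0 (‖c‖ * R) θ)) (2 * Real.pi) := by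
    intro θ
    simp only [deriv_circleMap]
    rw [periodic_circleMap]
  unfold circleIntegral
  have h1 := hper.intervalIntegral_add_eq 0 β
  rw [zero_add] at h1
  rw [h1]
  have h2 := intervalIntegral.integral_comp_add_right (a := 0) (b := 2 * Real.pi)
    (fun θ : ℝ => deriv (circleMap 0 (‖c‖ * R)) θ • F (circleMap 0 (‖c‖ * R) θ)) β
  rw [zero_add, add_comm (2 * Real.pi) β] at h2
  rw [← h2, ← intervalIntegral.integral_const_mul]
  apply intervalIntegral.integral_congr
  intro θ _
  simp only [deriv_circleMap, hcm, smul_eq_mul]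
  ring

/-- A continuous function on the unit circle with vanishing Laurent coefficients is zero. -/
lemma eq_zero_of_coeff_zero (F : ℂ → ℂ) (hF : ∀ z : ℂ, ‖z‖ = 1 → ContinuousAt F z)
    (h : ∀ n : ℤ, (∮ z in C(0, 1), F z * z ^ (-n - 1)) = 0) : ∀ z : ℂ, ‖z‖ = 1 → F z = 0 := by
  have : Fact (0 < 2 * Real.pi) := ⟨by positivity⟩
  let f : C(AddCircle (2 * Real.pi), ℂ) :=
    ⟨fun x => F ((AddCircle.toCircle x : Circle) : ℂ), by
      rw [continuous_iff_continuousAt]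
      intro x
      have h1 := hF ((AddCircle.toCircle x : Circle) : ℂ) (Circle.norm_coe _)
      have h2 : Continuous (fun x : AddCircle (2 * Real.pi) => ((AddCircle.toCircle x : Circle) : ℂ)) :=
        by
          have := AddCircle.continuous_toCircle (T := 2 * Real.pi)
          fun_prop
      exact ContinuousAt.comp (f := fun x : AddCircle (2 * Real.pi) => ((AddCircle.toCircle x : Circle) : ℂ)) h1 h2.continuousAt⟩
  have hz : ∀ n : ℤ, fourierCoeff (⇑f) n = 0 := by
    intro n
    rw [fourierCoeff_eq_intervalIntegral _ n 0]
    have h1 := h n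
    unfold circleIntegral at h1
    have h2 : (∫ θ in (0:ℝ)..2 * Real.pi, deriv (circleMap 0 1) θ • (F (circleMap 0 1 θ) * circleMap 0 1 θ ^ (-n - 1)))
        = ∫ θ in (0:ℝ)..2 * Real.pi, Complex.I * ((fourier (-n)) (θ : AddCircle (2 * Real.pi)) • f (θ : AddCircle (2 * Real.pi))) := by
      apply intervalIntegral.integral_congr
      intro θ _
      have e1 : ((AddCircle.toCircle (θ : AddCircle (2 * Real.pi)) : Circle) : ℂ) = circleMap 0 1 θ := by
        rw [AddCircle.toCircle_apply_mk]
        simp [circleMap]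
      have e2 : (fourier (-n)) (θ : AddCircle (2 * Real.pi)) = circleMap 0 1 θ ^ (-n) := by
        rw [fourier_apply, AddCircle.toCircle_zsmul, Circle.coe_zpow, e1]
      have hne : circleMap 0 1 θ ≠ 0 := circleMap_ne_center one_ne_zero
      simp only [deriv_circleMap, smul_eq_mul, e2]
      change _ = Complex.I * (_ * F _)
      rw [e1, zpow_sub_one₀ hne]
      field_simp
    rw [h2, intervalIntegral.integral_const_mul] at h1
    have h3 := (mul_eq_zero.mp h1).resolve_left Complex.I_ne_zero
    rw [zero_add, h3, smul_zero]
  have hsum : Summable (fourierCoeff ⇑f) := by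
    have : fourierCoeff ⇑f = fun _ => 0 := funext hz
    rw [this]; exact summable_zero
  have h4 := hasSum_fourier_series_of_summable hsum
  have h5 : f = 0 := by
    refine h4.unique ?_
    simp only [hz, zero_smul]
    exact hasSum_zero
  intro z hz1
  have h6 : F ((AddCircle.toCircle ((Complex.arg z : ℝ) : AddCircle (2 * Real.pi)) : Circle) : ℂ) = 0 := by
    have := congrArg (fun g : C(AddCircle (2 * Real.pi), ℂ) => g ((Complex.arg z : ℝ) : AddCircle (2 * Real.pi))) h5
    simpa [f] using this
  rw [AddCircle.toCircle_apply_mk] at h6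
  have h7 : ((Circle.exp (2 * Real.pi / (2 * Real.pi) * Complex.arg z) : Circle) : ℂ) = z := by
    have hcc : z = ‖z‖ * Complex.exp (Complex.arg z * Complex.I) := (Complex.norm_mul_exp_arg_mul_I z).symm
    rw [div_self (by positivity), one_mul, Circle.coe_exp]
    rw [hz1] at hcc
    simpa using hcc.symm
  rw [h7] at h6
  exact h6


lemma uniqueness (q : ℂ) (hq0 : q ≠ 0) (hq1 : ‖q‖ < 1) (E : ℂ → ℂ)
    (hE : ∀ z : ℂ, ‖q‖ ≤ ‖z‖ → ‖z‖ ≤ ‖q‖⁻¹ → DifferentiableAt ℂ E z)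
    (hFE : ∀ z : ℂ, ‖z‖ = ‖q‖⁻¹ → (1 - z) * E (z * q ^ 2) + q * z ^ 2 * (1 - z * q ^ 2) * E z = 0)
    (th : ℂ) (hth : HasSum (fun n : ℤ => (-1 : ℂ) ^ n * q ^ (2 * n ^ 2 + n)) th) (hth0 : th ≠ 0) :
    ∀ z : ℂ, ‖z‖ = 1 → E z = 0 := by
  have hr0 : 0 < ‖q‖ := norm_pos_iff.mpr hq0
  set r := ‖q‖ with hr
  have hρ1 : 1 < r⁻¹ := (one_lt_inv₀ hr0).mpr hq1
  -- Laurent coefficients of E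
  set D : ℂ → ℂ := fun z => E z / (1 - z) with hD
  set dp : ℤ → ℂ := fun n => ∮ z in C(0, r⁻¹), D z * z ^ (-n - 1) with hdp
  set dm : ℤ → ℂ := fun n => ∮ z in C(0, r), D z * z ^ (-n - 1) with hdm
  set a : ℝ → ℤ → ℂ := fun R n => ∮ z in C(0, R), E z * z ^ (-n - 1) with haa
  have hEc : ∀ R : ℝ, r ≤ R → R ≤ r⁻¹ → ∀ z ∈ Metric.sphere (0:ℂ) R, ContinuousAt E z := by
    intro R h1 h2 z hz
    rw [mem_sphere_zero_iff_norm] at hz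
    exact (hE z (by rw [hz]; exact h1) (by rw [hz]; exact h2)).continuousAt
  have hzne : ∀ R : ℝ, 0 < R → ∀ z ∈ Metric.sphere (0:ℂ) R, z ≠ 0 := by
    intro R h1 z hz h0
    rw [mem_sphere_zero_iff_norm, h0, norm_zero] at hz
    exact h1.ne hz
  have h1ne : ∀ R : ℝ, R ≠ 1 → ∀ z ∈ Metric.sphere (0:ℂ) R, (1 - z) ≠ 0 := by
    intro R h1 z hz h0
    rw [mem_sphere_zero_iff_norm] at hz
    apply h1
    rw [← hz, ← sub_eq_zero.mp h0, norm_one]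
  have hDc : ∀ R : ℝ, r ≤ R → R ≤ r⁻¹ → R ≠ 1 → ∀ n : ℤ, ContinuousOn (fun z => D z * z ^ n) (Metric.sphere (0:ℂ) R) := by
    intro R h1 h2 h3 n z hz
    apply ContinuousAt.continuousWithinAt
    have := hEc R h1 h2 z hz
    have hz0 := hzne R (by linarith) z hz
    have hz1 := h1ne R h3 z hz
    exact (this.div (by fun_prop) hz1).mul (continuousAt_zpow₀ _ _ (Or.inl hz0))
  have hstep : ∀ R : ℝ, r ≤ R → R ≤ r⁻¹ → R ≠ 1 → ∀ n : ℤ,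
      (∮ z in C(0, R), D z * z ^ (-n - 1)) - (∮ z in C(0, R), D z * z ^ (-(n-1) - 1)) = a R n := by
    intro R h1 h2 h3 n
    have hR : 0 ≤ R := by linarith
    rw [← circleIntegral.integral_sub]
    · apply circleIntegral.integral_congr hR
      intro z hz
      have hz0 := hzne R (by linarith) z hz
      have hz1 := h1ne R h3 z hz
      have : z ^ (-(n-1) - 1) = z ^ (-n - 1) * z := by
        rw [← zpow_add_one₀ hz0]; congr 1; ring
      simp only [hD, this]
      field_simp
    · exact (hDc R h1 h2 h3 _).circleIntegrable hR
    · exact (hDc R h1 h2 h3 _).circleIntegrable hR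
  have hrad : ∀ R R' : ℝ, r ≤ R → R ≤ R' → R' ≤ r⁻¹ → ∀ n, a R' n = a R n := by
    intro R R' h1 h2 h3 n
    have key : ∀ z : ℂ, R ≤ ‖z‖ → ‖z‖ ≤ R' → DifferentiableAt ℂ (fun z => E z * z ^ (-n - 1)) z := by
      intro z hz1 hz2
      have hz0 : z ≠ 0 := by
        rw [← norm_pos_iff]; linarith
      exact (hE z (by linarith) (by linarith)).mul (differentiableAt_zpow.mpr (Or.inl hz0))
    apply Complex.circleIntegral_eq_of_differentiable_on_annulus_off_countable (by linarith) h2 Set.countable_empty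
    · intro z hz
      simp only [Set.mem_sdiff, Metric.mem_closedBall, Metric.mem_ball, dist_zero_right, not_lt] at hz
      exact (key z hz.2 hz.1).continuousAt.continuousWithinAt
    · intro z hz
      simp only [Set.mem_sdiff, Metric.mem_closedBall, Metric.mem_ball, dist_zero_right, not_le] at hz
      exact key z hz.1.2.le hz.1.1.le
  have hrlt : r < r⁻¹ := by linarith
  have hc : ∃ c : ℂ, ∀ n, dp n - dm n = c := by
    refine ⟨dp 0 - dm 0, fun n => ?_⟩
    have hs : ∀ n, dp n - dm n = dp (n-1) - dm (n-1) := by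
      intro n
      have e1 := hstep r⁻¹ hrlt.le le_rfl hρ1.ne' n
      have e2 := hstep r le_rfl hrlt.le hq1.ne n
      have e3 := hrad r r⁻¹ le_rfl hrlt.le le_rfl n
      simp only [hdp, hdm]
      linear_combination e1 - e2 + e3
    induction n using Int.induction_on with
    | zero => rfl
    | succ i ih => rw [hs]; simpa using ih
    | pred i ih => rw [← hs]; simpa using ih
  obtain ⟨c, hc⟩ := hc
  have hdm2 : ∀ n, dm n = -q ^ (1 - 2 * n) * dp (n - 2) := by
    intro n
    have hsc := circleIntegral_scale (fun z => D z * z ^ (-n - 1)) (q ^ 2) r⁻¹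
    have e : ‖q ^ 2‖ * r⁻¹ = r := by rw [norm_pow, ← hr]; field_simp
    rw [e] at hsc
    simp only [hdm, hdp]
    rw [hsc, ← smul_eq_mul (a := q ^ 2), ← circleIntegral.integral_smul, ← smul_eq_mul (a := -q ^ (1 - 2 * n)), ← circleIntegral.integral_smul]
    apply circleIntegral.integral_congr (by positivity)
    intro z hz
    have hz0 := hzne _ (by positivity) z hz
    have hz1 := h1ne _ hρ1.ne' z hz
    have hzn : ‖z‖ = r⁻¹ := mem_sphere_zero_iff_norm.mp hz
    have hz2 : 1 - z * q ^ 2 ≠ 0 := by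
      apply h1ne r hq1.ne
      rw [mem_sphere_zero_iff_norm, norm_mul, hzn, mul_comm, e]
    have hfe := hFE z hzn
    have hE' : E (z * q ^ 2) = - (q * z ^ 2 * (1 - z * q ^ 2) * E z) / (1 - z) := by
      field_simp
      linear_combination hfe
    simp only [hD, smul_eq_mul]
    rw [mul_comm (q ^ 2) z, hE', mul_zpow]
    have p1 : (q ^ 2) ^ (-n - 1) = q ^ (1 - 2 * n) * q⁻¹ ^ 3 := by
      rw [← zpow_natCast q 2, ← zpow_mul, ← zpow_natCast q⁻¹ 3, inv_zpow', ← zpow_add₀ hq0]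
      congr 1; push_cast; ring
    have p2 : z ^ (-(n - 2) - 1) = z ^ (-n - 1) * z ^ 2 := by
      rw [← zpow_natCast z 2, ← zpow_add₀ hz0]
      congr 1; push_cast; ring
    rw [p1, p2]
    have hz2' : 1 - q ^ 2 * z ≠ 0 := by rwa [mul_comm]
    field_simp
  have hrec : ∀ n, dp n = q ^ (2 * n + 3) * (c - dp (n + 2)) := by
    intro n
    have e1 := hdm2 (n + 2)
    have e2 := hc (n + 2)
    have : n + 2 - 2 = n := by ring
    rw [this] at e1
    have e3 : q ^ (2 * n + 3) * q ^ (1 - 2 * (n + 2)) = 1 := by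
      rw [← zpow_add₀ hq0]
      have : 2 * n + 3 + (1 - 2 * (n + 2)) = 0 := by ring
      rw [this, zpow_zero]
    linear_combination (-dp n) * e3 + q ^ (2 * n + 3) * e1 + q ^ (2 * n + 3) * e2
  have hbd : ∃ B : ℝ, ∀ n, ‖dp n‖ ≤ B * r ^ n := by
    have hcpt : IsCompact (Metric.sphere (0:ℂ) r⁻¹) := isCompact_sphere _ _
    obtain ⟨B, hB⟩ := hcpt.exists_bound_of_continuousOn (hDc r⁻¹ hrlt.le le_rfl hρ1.ne' 0)
    refine ⟨2 * Real.pi * B, fun n => ?_⟩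
    have := circleIntegral.norm_integral_le_of_norm_le_const (f := fun z => D z * z ^ (-n - 1)) (c := 0) (R := r⁻¹) (C := B * (r⁻¹) ^ (-n - 1)) (by positivity)
      (by
        intro z hz
        have h1 := hB z hz
        rw [zpow_zero, mul_one] at h1
        rw [norm_mul, norm_zpow, mem_sphere_zero_iff_norm.mp hz]
        gcongr)
    refine this.trans (le_of_eq ?_)
    rw [inv_zpow', show -(-n - 1) = n + 1 by ring, zpow_add_one₀ hr0.ne']
    field_simp
  obtain ⟨B, hB⟩ := hbd
  -- weighted sequences
  have key : ∀ (e : ℤ) (b : ℤ), (2 * e = b - 1) →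
      (Summable (fun k : ℤ => (-1 : ℂ) ^ k * q ^ (2 * k ^ 2 + b * k) * dp (2 * k + e))) ∧
      ∀ k : ℤ, (-1 : ℂ) ^ (k+1) * q ^ (2 * (k+1) ^ 2 + b * (k+1)) * dp (2 * (k+1) + e)
        - (-1 : ℂ) ^ k * q ^ (2 * k ^ 2 + b * k) * dp (2 * k + e) = c * ((-1 : ℂ) ^ (k+1) * q ^ (2 * (k+1) ^ 2 + b * (k+1))) := by
    intro e b heb
    constructor
    · have hs := (summable_zpow_quad r hr0 hq1 2 (b + 2) (by norm_num)).mul_left (B * r ^ e)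
      refine Summable.of_norm_bounded hs ?_
      intro k
      rw [norm_mul, norm_mul, norm_zpow, norm_zpow, norm_neg, norm_one, one_zpow, one_mul, ← hr]
      calc r ^ (2 * k ^ 2 + b * k) * ‖dp (2 * k + e)‖ ≤ r ^ (2 * k ^ 2 + b * k) * (B * r ^ (2 * k + e)) := by
            gcongr; exact hB _
        _ = B * r ^ e * r ^ (2 * k ^ 2 + (b + 2) * k) := by
            have : 2 * k ^ 2 + (b + 2) * k = (2 * k ^ 2 + b * k) + 2 * k := by ring
            rw [this, zpow_add₀ hr0.ne' (2 * k ^ 2 + b * k) (2 * k), zpow_add₀ hr0.ne' (2 * k) e]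
            generalize r ^ (2 * k ^ 2 + b * k) = A1
            generalize r ^ (2 * k) = A2
            generalize r ^ e = A3
            ring
    · intro k
      have e1 := hrec (2 * k + e)
      have e2 : (2 : ℤ) * (k+1) ^ 2 + b * (k+1) = (2 * k ^ 2 + b * k) + (2 * (2 * k + e) + 3) := by
        linear_combination -heb
      have e3 : 2 * k + e + 2 = 2 * (k + 1) + e := by ring
      rw [e3] at e1
      rw [e2, zpow_add₀ hq0 (2 * k ^ 2 + b * k), zpow_add_one₀ (by norm_num : (-1 : ℂ) ≠ 0)]
      linear_combination (-(-1 : ℂ) ^ k * q ^ (2 * k ^ 2 + b * k)) * e1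
  have hshift : ∀ {f : ℤ → ℂ}, (∑' k, f (k + 1)) = ∑' k, f k := by
    intro f
    exact (Equiv.addRight (1:ℤ)).tsum_eq f
  have hc0 : c = 0 := by
    obtain ⟨hs, hk⟩ := key 0 1 (by norm_num)
    have hs' := (Equiv.addRight (1:ℤ)).summable_iff.mpr hs
    have h1 := hs'.tsum_sub hs
    have h2 : (∑' k : ℤ, c * ((-1 : ℂ) ^ (k+1) * q ^ (2 * (k+1) ^ 2 + 1 * (k+1)))) = 0 := by
      rw [← tsum_congr hk]
      refine h1.trans ?_
      exact sub_eq_zero.mpr ((Equiv.addRight (1:ℤ)).tsum_eq (fun k : ℤ => (-1 : ℂ) ^ k * q ^ (2 * k ^ 2 + 1 * k) * dp (2 * k + 0)))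
    rw [hshift (f := fun k => c * ((-1 : ℂ) ^ k * q ^ (2 * k ^ 2 + 1 * k))), tsum_mul_left] at h2
    simp only [one_mul] at h2
    rw [hth.tsum_eq] at h2
    exact (mul_eq_zero.mp h2).resolve_right hth0
  have hzero : ∀ (e : ℤ) (b : ℤ), (2 * e = b - 1) → ∀ k : ℤ, dp (2 * k + e) = 0 := by
    intro e b heb
    obtain ⟨hs, hk⟩ := key e b heb
    set x := (fun k : ℤ => (-1 : ℂ) ^ k * q ^ (2 * k ^ 2 + b * k) * dp (2 * k + e)) with hx
    have hconst : ∀ k, x k = x 0 := by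
      have hst : ∀ k, x (k + 1) = x k := by
        intro k
        have := hk k
        rw [hc0, zero_mul] at this
        exact sub_eq_zero.mp this
      intro k
      induction k using Int.induction_on with
      | zero => rfl
      | succ i ih => rw [hst, ih]
      | pred i ih => rw [← hst]; simpa using ih
    have hx0 : x 0 = 0 := by
      have : x = fun _ => x 0 := funext hconst
      rw [this] at hs
      have := hs.tendsto_cofinite_zero
      simpa using (tendsto_const_nhds_iff.mp this)
    intro k
    have := hconst k
    rw [hx0] at this
    have h2 : (-1 : ℂ) ^ k * q ^ (2 * k ^ 2 + b * k) ≠ 0 :=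
      mul_ne_zero (zpow_ne_zero _ (by norm_num)) (zpow_ne_zero _ hq0)
    exact (mul_eq_zero.mp this).resolve_left h2
  have hdp0 : ∀ n, dp n = 0 := by
    intro n
    rcases Int.even_or_odd' n with ⟨k, hk | hk⟩
    · rw [hk]; simpa using hzero 0 1 (by norm_num) k
    · rw [hk]; exact hzero 1 3 (by norm_num) k
  have ha1 : ∀ n, a 1 n = 0 := by
    intro n
    rw [← hrad 1 r⁻¹ hq1.le hρ1.le le_rfl n, ← hstep r⁻¹ hrlt.le le_rfl hρ1.ne' n]
    have e1 := hdp0 n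
    have e2 := hdp0 (n-1)
    simp only [hdp] at e1 e2
    rw [e1, e2, sub_zero]
  exact eq_zero_of_coeff_zero E (fun z hz => (hE z (by rw [hz]; exact hq1.le) (by rw [hz]; exact hρ1.le)).continuousAt) ha1

end M2

namespace M2
open Filter Topology

noncomputable def thS (q : ℂ) : ℂ := ∑' n : ℤ, (-1 : ℂ) ^ n * q ^ (2 * n ^ 2 + n)

noncomputable def Lt (q z : ℂ) (n : ℤ) : ℂ :=
  if n = 0 then 0 else (-1 : ℂ) ^ n * q ^ (2 * n ^ 2 + n) / (1 - z * q ^ (2 * n))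

noncomputable def Lf (q z : ℂ) : ℂ := 1 + (1 - z) * ∑' n : ℤ, Lt q z n

noncomputable def Tt (q z : ℂ) (n : ℕ) : ℂ :=
  q ^ (n ^ 2) * ∏ j ∈ Finset.range n,
    (1 + q ^ (2 * j + 1)) / ((1 - z * q ^ (2 * j + 2)) * (1 - q ^ (2 * j + 2) * z⁻¹))

noncomputable def Rb (q z : ℂ) : ℂ := ∑' n, Tt q z n

noncomputable def Gp (q y : ℂ) (m : ℕ) : ℂ :=
  ∏ j ∈ Finset.range m, (1 + y * q ^ (2 * j + 1)) / (1 - y * q ^ (2 * j + 2))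

noncomputable def Sa (q z : ℂ) : ℂ := ∑' m, (z * q ^ 2) ^ m * Gp q z⁻¹ m

noncomputable def Ra (q z : ℂ) : ℂ := 1 - z⁻¹ + (q + z⁻¹) * Sa q z

/-- annulus -/
def Ann (b : ℝ) : Set ℂ := {z | b < ‖z‖ ∧ ‖z‖ < b⁻¹}

lemma isOpen_Ann (b : ℝ) : IsOpen (Ann b) := by
  apply IsOpen.inter
  · exact isOpen_lt continuous_const continuous_norm
  · exact isOpen_lt continuous_norm continuous_const

lemma thS_hasSum (q : ℂ) (hq0 : q ≠ 0) (hq1 : ‖q‖ < 1) :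
    HasSum (fun n : ℤ => (-1 : ℂ) ^ n * q ^ (2 * n ^ 2 + n)) (thS q) := by
  apply Summable.hasSum
  have hs := summable_zpow_quad ‖q‖ (norm_pos_iff.mpr hq0) hq1 2 1 (by norm_num)
  refine Summable.of_norm_bounded hs ?_
  intro n
  rw [norm_mul, norm_zpow, norm_zpow, norm_neg, norm_one, one_zpow, one_mul, one_mul]

lemma Ann_bd (q : ℂ) (hq1 : ‖q‖ < 1) (b : ℝ) (hb0 : 0 < b) (hb : ‖q‖ ^ 2 < b)
    (z : ℂ) (hz : z ∈ Ann b) (j : ℕ) :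
    z ≠ 0 ∧ ‖z * q ^ (2 * j + 2)‖ ≤ ‖q‖ ^ 2 / b ∧ ‖q ^ (2 * j + 2) * z⁻¹‖ ≤ ‖q‖ ^ 2 / b ∧
    1 - ‖q‖ ^ 2 / b ≤ ‖1 - z * q ^ (2 * j + 2)‖ ∧ 1 - ‖q‖ ^ 2 / b ≤ ‖1 - q ^ (2 * j + 2) * z⁻¹‖ := by
  have hz0 : z ≠ 0 := norm_pos_iff.mp (hb0.trans hz.1)
  have hp : ‖q ^ (2 * j + 2)‖ ≤ ‖q‖ ^ 2 := by
    rw [norm_pow]; exact pow_le_pow_of_le_one (norm_nonneg _) hq1.le (by omega)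
  have h1 : ‖z * q ^ (2 * j + 2)‖ ≤ ‖q‖ ^ 2 / b := by
    rw [norm_mul, mul_comm, div_eq_mul_inv]
    exact mul_le_mul hp hz.2.le (norm_nonneg _) (by positivity)
  have h2 : ‖q ^ (2 * j + 2) * z⁻¹‖ ≤ ‖q‖ ^ 2 / b := by
    rw [norm_mul, div_eq_mul_inv, norm_inv]
    exact mul_le_mul hp (inv_anti₀ hb0 hz.1.le) (by positivity) (by positivity)
  refine ⟨hz0, h1, h2, ?_, ?_⟩
  · have := norm_sub_norm_le (1:ℂ) (z * q ^ (2 * j + 2))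
    rw [norm_one] at this; linarith
  · have := norm_sub_norm_le (1:ℂ) (q ^ (2 * j + 2) * z⁻¹)
    rw [norm_one] at this; linarith

lemma del_pos (q : ℂ) (b : ℝ) (hb0 : 0 < b) (hb : ‖q‖ ^ 2 < b) : 0 < 1 - ‖q‖ ^ 2 / b := by
  rw [sub_pos, div_lt_one hb0]; exact hb

lemma summable_sq_pow (r M : ℝ) (h0 : 0 ≤ r) (h1 : r < 1) (hM : 0 < M) : Summable (fun n : ℕ => r ^ (n ^ 2) * M ^ n) := by
  rcases h0.eq_or_lt with h0 | h0
  · apply summable_of_ne_finset_zero (s := {0})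
    intro n hn
    rw [← h0, zero_pow, zero_mul]
    simpa using hn
  apply summable_of_ratio_test_tendsto_lt_one (l := 0) (by norm_num)
  · filter_upwards with n; positivity
  · have : (fun n : ℕ => ‖r ^ ((n+1) ^ 2) * M ^ (n+1)‖ / ‖r ^ (n ^ 2) * M ^ n‖) = fun n => (r ^ 2) ^ n * (r * M) := by
      funext n
      rw [Real.norm_of_nonneg (by positivity), Real.norm_of_nonneg (by positivity)]
      rw [div_eq_iff (by positivity)]
      ring
    rw [this]
    have := (tendsto_pow_atTop_nhds_zero_of_lt_one (by positivity : 0 ≤ r ^ 2) (by nlinarith)).mul_const (r * M)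
    simpa using this

lemma Tt_bound (q : ℂ) (hq1 : ‖q‖ < 1) (b : ℝ) (hb0 : 0 < b) (hb : ‖q‖ ^ 2 < b)
    (z : ℂ) (hz : z ∈ Ann b) (n : ℕ) :
    ‖Tt q z n‖ ≤ ‖q‖ ^ (n ^ 2) * (2 / (1 - ‖q‖ ^ 2 / b) ^ 2) ^ n := by
  have hd := del_pos q b hb0 hb
  unfold Tt
  rw [norm_mul, norm_pow, norm_prod]
  gcongr
  calc _ ≤ ∏ j ∈ Finset.range n, (2 / (1 - ‖q‖ ^ 2 / b) ^ 2) := by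
        apply Finset.prod_le_prod
        · intros; positivity
        · intro j _
          obtain ⟨_, _, _, h4, h5⟩ := Ann_bd q hq1 b hb0 hb z hz j
          rw [norm_div, norm_mul, pow_two]
          gcongr
          · refine (norm_add_le _ _).trans ?_
            rw [norm_one, norm_pow]
            have := pow_le_one₀ (n := 2 * j + 1) (norm_nonneg q) hq1.le
            linarith
    _ = _ := by rw [Finset.prod_const, Finset.card_range]

lemma Tt_summable (q : ℂ) (hq1 : ‖q‖ < 1) (b : ℝ) (hb0 : 0 < b) (hb : ‖q‖ ^ 2 < b)
    (z : ℂ) (hz : z ∈ Ann b) : Summable (Tt q z) := by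
  have hd := del_pos q b hb0 hb
  exact Summable.of_norm_bounded (summable_sq_pow ‖q‖ _ (norm_nonneg _) hq1 (by positivity))
    (Tt_bound q hq1 b hb0 hb z hz)

lemma ne_of_del {x : ℂ} {d : ℝ} (hd : 0 < d) (h : d ≤ ‖x‖) : x ≠ 0 := by
  rw [← norm_pos_iff]; linarith

lemma Rb_diff (q : ℂ) (hq1 : ‖q‖ < 1) (b : ℝ) (hb0 : 0 < b) (hb : ‖q‖ ^ 2 < b) :
    DifferentiableOn ℂ (Rb q) (Ann b) := by
  have hd := del_pos q b hb0 hb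
  unfold Rb
  apply Complex.differentiableOn_tsum_of_summable_norm
    (summable_sq_pow ‖q‖ (2 / (1 - ‖q‖ ^ 2 / b) ^ 2) (norm_nonneg _) hq1 (by positivity)) _ (isOpen_Ann b)
  · intro i w hw; exact Tt_bound q hq1 b hb0 hb w hw i
  · intro n
    unfold Tt
    apply DifferentiableOn.const_mul
    apply DifferentiableOn.fun_finsetProd
    intro j _
    intro z hz
    obtain ⟨h1, _, _, h4, h5⟩ := Ann_bd q hq1 b hb0 hb z hz j
    apply DifferentiableAt.differentiableWithinAt
    apply DifferentiableAt.div
    · fun_prop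
    · have := differentiableAt_inv (𝕜 := ℂ) h1
      fun_prop
    · exact mul_ne_zero (ne_of_del hd h4) (ne_of_del hd h5)

noncomputable def gb (r b : ℝ) (m : ℕ) : ℝ :=
  ∏ j ∈ Finset.range m, (1 + r ^ (2 * j + 1) / b) / (1 - r ^ (2 * j + 2) / b)

lemma gb_den (r b : ℝ) (h0 : 0 ≤ r) (h1 : r < 1) (hb0 : 0 < b) (hb : r ^ 2 < b) (j : ℕ) :
    0 < 1 - r ^ (2 * j + 2) / b := by
  rw [sub_pos, div_lt_one hb0]
  exact (pow_le_pow_of_le_one h0 h1.le (by omega)).trans_lt hb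

lemma gb_pos (r b : ℝ) (h0 : 0 ≤ r) (h1 : r < 1) (hb0 : 0 < b) (hb : r ^ 2 < b) (m : ℕ) :
    0 < gb r b m := by
  apply Finset.prod_pos
  intro j _
  have := gb_den r b h0 h1 hb0 hb j
  positivity

lemma gb_summable (r b : ℝ) (h0 : 0 < r) (h1 : r < 1) (hb0 : 0 < b) (hb : r ^ 2 < b) :
    Summable (fun m => (r ^ 2 / b) ^ m * gb r b m) := by
  have hg := gb_pos r b h0.le h1 hb0 hb
  apply summable_of_ratio_test_tendsto_lt_one (l := r ^ 2 / b) (by rwa [div_lt_one hb0])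
  · filter_upwards with n
    have := hg n
    positivity
  · have : (fun m => ‖(r ^ 2 / b) ^ (m+1) * gb r b (m+1)‖ / ‖(r ^ 2 / b) ^ m * gb r b m‖)
      = fun m => (r ^ 2 / b) * ((1 + (r * (r ^ 2) ^ m) / b) / (1 - (r ^ 2 * (r ^ 2) ^ m) / b)) := by
      funext m
      have h1 := hg m
      have h2 := hg (m+1)
      rw [Real.norm_of_nonneg (by positivity), Real.norm_of_nonneg (by positivity), div_eq_iff (by positivity)]
      unfold gb
      rw [Finset.prod_range_succ]
      ring
    rw [this]
    have ht := (tendsto_pow_atTop_nhds_zero_of_lt_one (by positivity : 0 ≤ r ^ 2) (by nlinarith))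
    have a1 : Tendsto (fun m : ℕ => 1 + (r * (r ^ 2) ^ m) / b) atTop (𝓝 (1 + (r * 0) / b)) :=
      ((ht.const_mul r).div_const b).const_add 1
    have a2 : Tendsto (fun m : ℕ => 1 - (r ^ 2 * (r ^ 2) ^ m) / b) atTop (𝓝 (1 - (r ^ 2 * 0) / b)) :=
      ((ht.const_mul _).div_const b).const_sub 1
    have := (a1.div a2 (by simp)).const_mul (r ^ 2 / b)
    simpa using this

lemma Gp_bound (q : ℂ) (hq1 : ‖q‖ < 1) (b : ℝ) (hb0 : 0 < b) (hb : ‖q‖ ^ 2 < b)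
    (y : ℂ) (hy : ‖y‖ ≤ b⁻¹) (m : ℕ) : ‖Gp q y m‖ ≤ gb ‖q‖ b m := by
  unfold Gp gb
  rw [norm_prod]
  apply Finset.prod_le_prod
  · intros; positivity
  · intro j _
    have hden := gb_den ‖q‖ b (norm_nonneg _) hq1 hb0 hb j
    rw [norm_div]
    have e : ∀ k, ‖y * q ^ k‖ ≤ ‖q‖ ^ k / b := by
      intro k
      rw [norm_mul, norm_pow, mul_comm, div_eq_mul_inv]
      gcongr
    gcongr
    · refine (norm_add_le _ _).trans ?_
      rw [norm_one]
      linarith [e (2*j+1)]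
    · have := norm_sub_norm_le (1:ℂ) (y * q ^ (2 * j + 2))
      rw [norm_one] at this
      linarith [e (2*j+2)]

lemma Sat_bound (q : ℂ) (hq1 : ‖q‖ < 1) (b : ℝ) (hb0 : 0 < b) (hb : ‖q‖ ^ 2 < b)
    (z : ℂ) (hz : z ∈ Ann b) (m : ℕ) :
    ‖(z * q ^ 2) ^ m * Gp q z⁻¹ m‖ ≤ (‖q‖ ^ 2 / b) ^ m * gb ‖q‖ b m := by
  obtain ⟨h1, h2, _⟩ := Ann_bd q hq1 b hb0 hb z hz 0
  rw [norm_mul, norm_pow]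
  have hA : ‖z * q ^ 2‖ ≤ ‖q‖ ^ 2 / b := by simpa using h2
  have hB : ‖Gp q z⁻¹ m‖ ≤ gb ‖q‖ b m := by
    apply Gp_bound q hq1 b hb0 hb
    rw [norm_inv]
    exact inv_anti₀ hb0 hz.1.le
  gcongr

lemma Sat_summable (q : ℂ) (hq0 : q ≠ 0) (hq1 : ‖q‖ < 1) (b : ℝ) (hb0 : 0 < b) (hb : ‖q‖ ^ 2 < b)
    (z : ℂ) (hz : z ∈ Ann b) : Summable (fun m => (z * q ^ 2) ^ m * Gp q z⁻¹ m) :=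
  Summable.of_norm_bounded (gb_summable ‖q‖ b (norm_pos_iff.mpr hq0) hq1 hb0 hb) (Sat_bound q hq1 b hb0 hb z hz)

lemma Ra_diff (q : ℂ) (hq0 : q ≠ 0) (hq1 : ‖q‖ < 1) (b : ℝ) (hb0 : 0 < b) (hb : ‖q‖ ^ 2 < b) :
    DifferentiableOn ℂ (Ra q) (Ann b) := by
  have hd := del_pos q b hb0 hb
  have hinv : DifferentiableOn ℂ (fun z : ℂ => z⁻¹) (Ann b) := by
    intro z hz
    obtain ⟨h1, _⟩ := Ann_bd q hq1 b hb0 hb z hz 0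
    exact (differentiableAt_inv h1).differentiableWithinAt
  have hS : DifferentiableOn ℂ (Sa q) (Ann b) := by
    unfold Sa
    apply Complex.differentiableOn_tsum_of_summable_norm
      (gb_summable ‖q‖ b (norm_pos_iff.mpr hq0) hq1 hb0 hb) _ (isOpen_Ann b)
    · intro i w hw; exact Sat_bound q hq1 b hb0 hb w hw i
    · intro n
      unfold Gp
      apply DifferentiableOn.mul
      · fun_prop
      apply DifferentiableOn.fun_finsetProd
      intro j _
      apply DifferentiableOn.div
      · fun_prop
      · fun_prop
      · intro z hz
        obtain ⟨h1, _, _, h4, h5⟩ := Ann_bd q hq1 b hb0 hb z hz j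
        rw [mul_comm]
        exact (ne_of_del hd h5)
  unfold Ra
  exact (hinv.const_sub 1).add ((hinv.const_add q).mul hS)

lemma Lt_den (q : ℂ) (hq0 : q ≠ 0) (hq1 : ‖q‖ < 1) (b : ℝ) (hb0 : 0 < b) (hb1 : b < 1) (hb : ‖q‖ ^ 2 < b)
    (z : ℂ) (hz : z ∈ Ann b) (n : ℤ) (hn : n ≠ 0) :
    b * (1 - ‖q‖ ^ 2 / b) ≤ ‖1 - z * q ^ (2 * n)‖ := by
  have hd := del_pos q b hb0 hb
  rcases lt_or_gt_of_ne hn with h | h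
  · obtain ⟨k, rfl⟩ : ∃ k : ℕ, n = -(k + 1 : ℤ) := ⟨(-n - 1).toNat, by omega⟩
    obtain ⟨h1, _, _, h4, h5⟩ := Ann_bd q hq1 b hb0 hb z hz k
    have hq' : q ^ (2 * k + 2) ≠ 0 := pow_ne_zero _ hq0
    have e : q ^ (2 * -(k + 1 : ℤ)) = (q ^ (2 * k + 2))⁻¹ := by
      rw [← zpow_natCast, ← zpow_neg]; congr 1
    have e2 : 1 - z * q ^ (2 * -(k + 1 : ℤ)) = -(z * (q ^ (2 * k + 2))⁻¹ * (1 - q ^ (2 * k + 2) * z⁻¹)) := by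
      rw [e]; field_simp; ring
    rw [e2, norm_neg, norm_mul, norm_mul, norm_inv, norm_pow]
    have h6 : 1 ≤ (‖q‖ ^ (2 * k + 2))⁻¹ :=
      (one_le_inv₀ (by positivity)).mpr (pow_le_one₀ (norm_nonneg _) hq1.le)
    have := hz.1
    calc b * (1 - ‖q‖ ^ 2 / b) = b * 1 * (1 - ‖q‖ ^ 2 / b) := by ring
      _ ≤ _ := by gcongr
  · obtain ⟨k, rfl⟩ : ∃ k : ℕ, n = (k + 1 : ℤ) := ⟨(n - 1).toNat, by omega⟩
    obtain ⟨h1, _, _, h4, h5⟩ := Ann_bd q hq1 b hb0 hb z hz k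
    have e : q ^ (2 * (k + 1 : ℤ)) = q ^ (2 * k + 2) := by
      rw [← zpow_natCast]; congr 1
    rw [e]
    nlinarith

lemma Lt_bound (q : ℂ) (hq0 : q ≠ 0) (hq1 : ‖q‖ < 1) (b : ℝ) (hb0 : 0 < b) (hb1 : b < 1) (hb : ‖q‖ ^ 2 < b)
    (z : ℂ) (hz : z ∈ Ann b) (n : ℤ) :
    ‖Lt q z n‖ ≤ ‖q‖ ^ (2 * n ^ 2 + 1 * n) / (b * (1 - ‖q‖ ^ 2 / b)) := by
  have hd := del_pos q b hb0 hb
  unfold Lt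
  split_ifs with hn
  · rw [norm_zero]; positivity
  · rw [norm_div, norm_mul, norm_zpow, norm_zpow, norm_neg, norm_one, one_zpow, one_mul, one_mul]
    have := Lt_den q hq0 hq1 b hb0 hb1 hb z hz n hn
    gcongr

lemma Lt_summable (q : ℂ) (hq0 : q ≠ 0) (hq1 : ‖q‖ < 1) (b : ℝ) (hb0 : 0 < b) (hb1 : b < 1) (hb : ‖q‖ ^ 2 < b)
    (z : ℂ) (hz : z ∈ Ann b) : Summable (Lt q z) :=
  Summable.of_norm_bounded ((summable_zpow_quad ‖q‖ (norm_pos_iff.mpr hq0) hq1 2 1 (by norm_num)).div_const _)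
    (Lt_bound q hq0 hq1 b hb0 hb1 hb z hz)

lemma Lf_diff (q : ℂ) (hq0 : q ≠ 0) (hq1 : ‖q‖ < 1) (b : ℝ) (hb0 : 0 < b) (hb1 : b < 1) (hb : ‖q‖ ^ 2 < b) :
    DifferentiableOn ℂ (Lf q) (Ann b) := by
  have hd := del_pos q b hb0 hb
  have : DifferentiableOn ℂ (fun z => ∑' n : ℤ, Lt q z n) (Ann b) := by
    apply Complex.differentiableOn_tsum_of_summable_norm
      ((summable_zpow_quad ‖q‖ (norm_pos_iff.mpr hq0) hq1 2 1 (by norm_num)).div_const (b * (1 - ‖q‖ ^ 2 / b))) _ (isOpen_Ann b)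
    · intro i w hw; exact Lt_bound q hq0 hq1 b hb0 hb1 hb w hw i
    · intro n
      unfold Lt
      split_ifs with hn
      · fun_prop
      · apply DifferentiableOn.div
        · fun_prop
        · fun_prop
        · intro z hz
          exact ne_of_del (by positivity) (Lt_den q hq0 hq1 b hb0 hb1 hb z hz n hn)
  unfold Lf
  fun_prop
end M2

namespace M2
open Filter Topology

/-- FE for L -/
lemma Lf_FE (q : ℂ) (hq0 : q ≠ 0) (hq1 : ‖q‖ < 1) (b : ℝ) (hb0 : 0 < b) (hb1 : b < 1) (hb : ‖q‖ ^ 2 < b)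
    (hbq : b < ‖q‖) (z : ℂ) (hz : ‖z‖ = ‖q‖⁻¹) :
    (1 - z) * Lf q (z * q ^ 2) + q * z ^ 2 * (1 - z * q ^ 2) * Lf q z
      = thS q * ((1 - q * z) * (1 - z) * (1 - z * q ^ 2)) := by
  have hr0 : 0 < ‖q‖ := norm_pos_iff.mpr hq0
  have hinv : ‖q‖⁻¹ < b⁻¹ := by gcongr
  have hone : 1 < ‖q‖⁻¹ := (one_lt_inv₀ hr0).mpr hq1
  have hz1 : z ∈ Ann b := ⟨by linarith, by rw [hz]; exact hinv⟩
  have hn2 : ‖z * q ^ 2‖ = ‖q‖ := by rw [norm_mul, hz, norm_pow]; field_simp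
  have hz2 : z * q ^ 2 ∈ Ann b := ⟨by rw [hn2]; exact hbq, by rw [hn2]; linarith⟩
  have hden : ∀ n : ℤ, 1 - z * q ^ (2 * n) ≠ 0 := by
    intro n h
    have h1 : ‖z * q ^ (2 * n)‖ = 1 := by
      rw [← sub_eq_zero.mp h, norm_one]
    rw [norm_mul, hz, norm_zpow, ← zpow_neg_one, ← zpow_add₀ hr0.ne'] at h1
    rcases lt_or_gt_of_ne (show -1 + 2 * n ≠ 0 by omega) with h | h
    · have := one_lt_zpow_of_neg₀ hr0 hq1 h
      linarith
    · have := zpow_lt_one₀ hr0 hq1 h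
      linarith
  set l : ℂ → ℤ → ℂ := fun w n => (-1 : ℂ) ^ n * q ^ (2 * n ^ 2 + n) / (1 - w * q ^ (2 * n)) with hl
  -- relation of L and l
  have hrel : ∀ w, w ∈ Ann b → 1 - w ≠ 0 → Summable (l w) ∧ Lf q w = (1 - w) * ∑' n, l w n := by
    intro w hw h1
    have hs := Lt_summable q hq0 hq1 b hb0 hb1 hb w hw
    have hl' : l w = fun n => Lt q w n + (if n = 0 then (1 - w)⁻¹ else 0) := by
      funext n
      simp only [hl, Lt]
      split_ifs with h
      · subst h; simp
      · simp
    have hs1 : HasSum (fun n : ℤ => if n = 0 then (1 - w)⁻¹ else 0) (1 - w)⁻¹ := hasSum_ite_eq 0 _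
    have := hs.hasSum.add hs1
    rw [← hl'] at this
    refine ⟨this.summable, ?_⟩
    rw [this.tsum_eq, Lf]
    field_simp
    ring
  have h0 : 1 - z ≠ 0 := by simpa using hden 0
  have h0' : 1 - z * q ^ 2 ≠ 0 := by simpa using hden 1
  obtain ⟨s1, r1⟩ := hrel z hz1 h0
  obtain ⟨s2, r2⟩ := hrel _ hz2 h0'
  have hth := thS_hasSum q hq0 hq1
  have hA : HasSum (fun n : ℤ => (-1 : ℂ) ^ n * q ^ (2 * n ^ 2 - 3 * n)) (-q⁻¹ * thS q) := by
    rw [← (Equiv.addRight (1:ℤ)).hasSum_iff]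
    suffices e : ((fun n : ℤ => (-1 : ℂ) ^ n * q ^ (2 * n ^ 2 - 3 * n)) ∘ (Equiv.addRight (1:ℤ))) =
        fun n : ℤ => -q⁻¹ * ((-1 : ℂ) ^ n * q ^ (2 * n ^ 2 + n)) by
      rw [e]; exact hth.mul_left (-q⁻¹)
    funext n
    simp only [Function.comp, Equiv.coe_addRight]
    rw [zpow_add_one₀ (by norm_num), show 2 * (n + 1) ^ 2 - 3 * (n + 1) = (2 * n ^ 2 + n) + (-1) by ring,
      zpow_add₀ hq0, zpow_neg_one]
    ring
  have hB : HasSum (fun n : ℤ => (-1 : ℂ) ^ n * q ^ (2 * n ^ 2 - n)) (thS q) := by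
    rw [← (Equiv.neg ℤ).hasSum_iff]
    convert hth using 1
    funext n
    simp only [Function.comp, Equiv.neg_apply]
    rw [zpow_neg, ← inv_zpow, inv_neg, inv_one]
    congr 2; ring
  have hC : HasSum (fun n : ℤ => -l (z * q ^ 2) (n - 1) * 1) (-(∑' n, l (z * q ^ 2) n)) := by
    simp only [mul_one]
    exact ((Equiv.subRight (1:ℤ)).hasSum_iff.mpr s2.hasSum).neg
  have hD : HasSum (fun n : ℤ => l (z * q ^ 2) (n - 1) + q * z ^ 2 * l z n) ((∑' n, l (z * q ^ 2) n) + q * z ^ 2 * ∑' n, l z n) :=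
    ((Equiv.subRight (1:ℤ)).hasSum_iff.mpr s2.hasSum).add (s1.hasSum.mul_left _)
  have hE := (hA.mul_left (-q)).add (hB.mul_left (-(z * q)))
  have hEq : (fun n : ℤ => l (z * q ^ 2) (n - 1) + q * z ^ 2 * l z n) =
    fun n : ℤ => -q * ((-1 : ℂ) ^ n * q ^ (2 * n ^ 2 - 3 * n)) + -(z * q) * ((-1 : ℂ) ^ n * q ^ (2 * n ^ 2 - n)) := by
    funext n
    have d := hden n
    simp only [hl]
    have e1 : z * q ^ 2 * q ^ (2 * (n - 1)) = z * q ^ (2 * n) := by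
      rw [mul_assoc, ← zpow_natCast q 2, ← zpow_add₀ hq0]; congr 2; push_cast; ring
    have e2 : q ^ (2 * (n-1) ^ 2 + (n-1)) = q ^ (2 * n ^ 2 - 3 * n) * q := by
      rw [← zpow_add_one₀ hq0]; congr 1; ring
    have e3 : q ^ (2 * n ^ 2 + n) = q ^ (2 * n ^ 2 - 3 * n) * (q ^ (2 * n)) ^ 2 := by
      rw [← zpow_natCast (q ^ (2 * n)) 2, ← zpow_mul, ← zpow_add₀ hq0]; congr 1; push_cast; ring
    have e4 : q ^ (2 * n ^ 2 - n) = q ^ (2 * n ^ 2 - 3 * n) * q ^ (2 * n) := by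
      rw [← zpow_add₀ hq0]; congr 1; ring
    rw [e1, e2, e3, e4, zpow_sub_one₀ (by norm_num)]
    generalize q ^ (2 * n ^ 2 - 3 * n) = X at *
    generalize q ^ (2 * n) = Y at *
    field_simp
    ring
  rw [hEq] at hD
  have := hD.unique hE
  rw [r1, r2]
  have h5 : (∑' n, l (z * q ^ 2) n) + q * z ^ 2 * ∑' n, l z n = thS q * (1 - q * z) := by
    rw [this]; field_simp; ring
  linear_combination (1 - z) * (1 - z * q ^ 2) * h5

/-- FE for Rb -/
lemma Rb_FE (q : ℂ) (hq0 : q ≠ 0) (hq1 : ‖q‖ < 1) (b : ℝ) (hb0 : 0 < b) (hb : ‖q‖ ^ 2 < b)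
    (hbq : b < ‖q‖) (z : ℂ) (hz : ‖z‖ = ‖q‖⁻¹) :
    (1 - z) * Rb q (z * q ^ 2) + q * z ^ 2 * (1 - z * q ^ 2) * Rb q z
      = (1 - q * z) * (1 - z) * (1 - z * q ^ 2) := by
  have hr0 : 0 < ‖q‖ := norm_pos_iff.mpr hq0
  have hinv : ‖q‖⁻¹ < b⁻¹ := by gcongr
  have hone : 1 < ‖q‖⁻¹ := (one_lt_inv₀ hr0).mpr hq1
  have hz1 : z ∈ Ann b := ⟨by linarith, by rw [hz]; exact hinv⟩
  have hn2 : ‖z * q ^ 2‖ = ‖q‖ := by rw [norm_mul, hz, norm_pow]; field_simp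
  have hz2 : z * q ^ 2 ∈ Ann b := ⟨by rw [hn2]; exact hbq, by rw [hn2]; linarith⟩
  have hd := del_pos q b hb0 hb
  have hz0 : z ≠ 0 := norm_pos_iff.mp (by rw [hz]; positivity)
  have s1 := Tt_summable q hq1 b hb0 hb z hz1
  have s2 := Tt_summable q hq1 b hb0 hb _ hz2
  have hd1 : ∀ j : ℕ, 1 - z * q ^ (2 * j + 2) ≠ 0 := fun j => ne_of_del hd (Ann_bd q hq1 b hb0 hb z hz1 j).2.2.2.1
  have hd2 : ∀ j : ℕ, 1 - q ^ (2 * j + 2) * z⁻¹ ≠ 0 := fun j => ne_of_del hd (Ann_bd q hq1 b hb0 hb z hz1 j).2.2.2.2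
  have hd2' : ∀ j : ℕ, z - q ^ (2 * j + 2) ≠ 0 := fun j h => by
    apply hd2 j
    have : q ^ (2 * j + 2) = z := (sub_eq_zero.mp h).symm
    rw [this, mul_inv_cancel₀ hz0, sub_self]
  have h1z : 1 - z ≠ 0 := by
    intro h
    rw [← sub_eq_zero.mp h, norm_one] at hz
    linarith
  have h1z' : z - 1 ≠ 0 := by
    intro h; apply h1z; linear_combination -h
  have h2z : 1 - z * q ^ 2 ≠ 0 := hd1 0
  have hrat : ∀ n : ℕ, Tt q (z * q ^ 2) n * ((1 - z * q ^ (2 * n + 2)) * (z - 1)) = Tt q z n * ((1 - z * q ^ 2) * (z - q ^ (2 * n))) := by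
    intro n
    induction n with
    | zero => simp [Tt]
    | succ n ih =>
      have hst : ∀ w : ℂ, Tt q w (n+1) = Tt q w n * (q ^ (2 * n + 1) * ((1 + q ^ (2 * n + 1)) / ((1 - w * q ^ (2 * n + 2)) * (1 - q ^ (2 * n + 2) * w⁻¹)))) := by
        intro w
        unfold Tt
        rw [Finset.prod_range_succ, show (n+1)^2 = n^2 + (2*n+1) by ring, pow_add]
        ring
      rw [hst, hst]
      have a1 := hd1 n
      have a2 := hd2' n
      have a3 := hd1 (n+1)
      have a4 : z - q ^ (2 * n) ≠ 0 := by
        rcases n with _ | n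
        · simpa using h1z'
        · simpa [mul_add] using hd2' n
      have e1 : 1 - z * q ^ 2 * q ^ (2 * n + 2) = 1 - z * q ^ (2 * (n+1) + 2) := by ring
      have e2 : 1 - q ^ (2 * n + 2) * (z * q ^ 2)⁻¹ = (z - q ^ (2 * n)) / z := by
        rw [mul_inv]; field_simp; ring
      have e3 : 1 - q ^ (2 * n + 2) * z⁻¹ = (z - q ^ (2 * n + 2)) / z := by
        field_simp
      have e4 : 2 * (n + 1) = 2 * n + 2 := by ring
      rw [e1, e2, e3]
      have ih' : Tt q (z * q ^ 2) n = Tt q z n * ((1 - z * q ^ 2) * (z - q ^ (2 * n))) / ((1 - z * q ^ (2 * n + 2)) * (z - 1)) := by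
        rw [eq_div_iff (mul_ne_zero a1 h1z')]; exact ih
      rw [ih']
      rw [e4] at a3 ⊢
      generalize Tt q z n = T
      generalize q ^ (2 * n + 1) = X
      generalize q ^ (2 * n + 2 + 2) = X4 at *
      generalize q ^ (2 * n + 2) = X2 at *
      generalize q ^ (2 * n) = X0 at *
      field_simp
  set C : ℕ → ℂ := fun n => z * (1 - q * z) * (1 - q ^ (2 * n) * z⁻¹) * (Tt q z n / (1 - z)) with hC
  have htel : ∀ n, Tt q (z * q ^ 2) n / (1 - z * q ^ 2) + q * z ^ 2 * (Tt q z n / (1 - z)) = C (n+1) - C n := by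
    intro n
    have a1 := hd1 n
    have a2 := hd2' n
    have ih' : Tt q (z * q ^ 2) n = Tt q z n * ((1 - z * q ^ 2) * (z - q ^ (2 * n))) / ((1 - z * q ^ (2 * n + 2)) * (z - 1)) := by
      rw [eq_div_iff (mul_ne_zero a1 h1z')]; exact hrat n
    have hst : Tt q z (n+1) = Tt q z n * (q ^ (2 * n + 1) * ((1 + q ^ (2 * n + 1)) / ((1 - z * q ^ (2 * n + 2)) * (1 - q ^ (2 * n + 2) * z⁻¹)))) := by
      unfold Tt
      rw [Finset.prod_range_succ, show (n+1)^2 = n^2 + (2*n+1) by ring, pow_add]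
      ring
    have e3 : ∀ X : ℂ, 1 - X * z⁻¹ = (z - X) / z := by
      intro X; field_simp
    have e4 : 2 * (n + 1) = 2 * n + 2 := by ring
    have e5 : 1 - z = -(z - 1) := by ring
    simp only [hC]
    rw [ih', hst, e4, e3, e3, e5]
    have p1 : q ^ (2 * n + 2) = q ^ (2 * n) * q ^ 2 := by ring
    have p2 : q ^ (2 * n + 1) = q ^ (2 * n) * q := by ring
    rw [p2]
    clear ih' hst
    generalize Tt q z n = T
    generalize q ^ (2 * n + 2) = X2 at *
    generalize q ^ (2 * n) = X0 at *
    field_simp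
    subst p1
    ring
  have hlim : Tendsto C atTop (𝓝 0) := by
    have t1 : Tendsto (fun n => Tt q z n / (1 - z)) atTop (𝓝 (0 / (1 - z))) := s1.tendsto_atTop_zero.div_const _
    have t2 : Tendsto (fun n : ℕ => q ^ (2 * n)) atTop (𝓝 0) := by
      simp_rw [pow_mul]
      apply tendsto_pow_atTop_nhds_zero_of_norm_lt_one
      rw [norm_pow]; nlinarith
    have := (((t2.mul_const z⁻¹).const_sub 1).const_mul (z * (1 - q * z))).mul t1
    simpa using this
  have hsum : HasSum (fun n => C (n+1) - C n) (Rb q (z * q ^ 2) / (1 - z * q ^ 2) + q * z ^ 2 * (Rb q z / (1 - z))) := by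
    rw [← funext htel]
    exact (s2.hasSum.div_const _).add ((s1.hasSum.div_const _).mul_left _)
  have h2 := hsum.tendsto_sum_nat
  simp_rw [Finset.sum_range_sub] at h2
  have h3 := tendsto_nhds_unique h2 (hlim.sub_const (C 0))
  have hC0 : C 0 = -(1 - q * z) := by
    simp [hC, Tt]
    field_simp
    ring
  rw [hC0] at h3
  field_simp at h3
  linear_combination h3

/-- FE for Ra -/
lemma Ra_FE (q : ℂ) (hq0 : q ≠ 0) (hq1 : ‖q‖ < 1) (b : ℝ) (hb0 : 0 < b) (hb : ‖q‖ ^ 2 < b)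
    (hbq : b < ‖q‖) (z : ℂ) (hz : ‖z‖ = ‖q‖⁻¹) :
    (1 - z) * Ra q (z * q ^ 2) + q * z ^ 2 * (1 - z * q ^ 2) * Ra q z
      = (1 - q * z) * (1 - z) * (1 - z * q ^ 2) := by
  have hr0 : 0 < ‖q‖ := norm_pos_iff.mpr hq0
  have hinv : ‖q‖⁻¹ < b⁻¹ := by gcongr
  have hone : 1 < ‖q‖⁻¹ := (one_lt_inv₀ hr0).mpr hq1
  have hz1 : z ∈ Ann b := ⟨by linarith, by rw [hz]; exact hinv⟩
  have hn2 : ‖z * q ^ 2‖ = ‖q‖ := by rw [norm_mul, hz, norm_pow]; field_simp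
  have hz2 : z * q ^ 2 ∈ Ann b := ⟨by rw [hn2]; exact hbq, by rw [hn2]; linarith⟩
  have hd := del_pos q b hb0 hb
  have hz0 : z ≠ 0 := norm_pos_iff.mp (by rw [hz]; positivity)
  have hd2 : ∀ j : ℕ, 1 - q ^ (2 * j + 2) * z⁻¹ ≠ 0 := fun j => ne_of_del hd (Ann_bd q hq1 b hb0 hb z hz1 j).2.2.2.2
  have h1z : 1 - z ≠ 0 := by
    intro h
    rw [← sub_eq_zero.mp h, norm_one] at hz
    linarith
  have h1z' : z - 1 ≠ 0 := by
    intro h; apply h1z; linear_combination -h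
  set y := z⁻¹ with hy
  have hzy : z * y = 1 := mul_inv_cancel₀ hz0
  have s1 := Sat_summable q hq0 hq1 b hb0 hb z hz1
  have sV : Summable (fun m => (z * q ^ 4) ^ m * Gp q y m) := by
    refine Summable.of_norm_bounded s1.norm ?_
    intro m
    rw [norm_mul, norm_mul, norm_pow, norm_pow]
    have : ‖z * q ^ 4‖ ≤ ‖z * q ^ 2‖ := by
      rw [norm_mul, norm_mul, norm_pow, norm_pow]
      gcongr ‖z‖ * ?_
      exact pow_le_pow_of_le_one hr0.le hq1.le (by norm_num)
    gcongr
  set V := ∑' m, (z * q ^ 4) ^ m * Gp q y m with hV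
  have hG : ∀ m, Gp q y (m+1) * (1 - y * q ^ (2 * m + 2)) = Gp q y m * (1 + y * q ^ (2 * m + 1)) := by
    intro m
    unfold Gp
    rw [Finset.prod_range_succ]
    have := hd2 m
    rw [mul_comm _ y] at this
    field_simp
  have hS1 : Sa q z = 1 + ∑' m, (z * q ^ 2) ^ (m+1) * Gp q y (m+1) := by
    unfold Sa
    rw [s1.tsum_eq_zero_add]; simp [Gp, hy]
  have hV1 : V = 1 + ∑' m, (z * q ^ 4) ^ (m+1) * Gp q y (m+1) := by
    rw [hV, sV.tsum_eq_zero_add]; simp [Gp]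
  have hrel : V * (y + q ^ 3) = Sa q z * (1 - z * q ^ 2) + y - 1 := by
    have e1 : ∑' m, ((z * q ^ 2) ^ (m+1) * Gp q y (m+1) - y * ((z * q ^ 4) ^ (m+1) * Gp q y (m+1)))
       = ∑' m, (z * q ^ 2 * ((z * q ^ 2) ^ m * Gp q y m) + q ^ 3 * ((z * q ^ 4) ^ m * Gp q y m)) := by
      apply tsum_congr
      intro m
      have h := hG m
      have e2 : (z * q ^ 4) ^ (m+1) = (z * q ^ 2) ^ (m + 1) * q ^ (2 * m + 2) := by
        rw [show z * q ^ 4 = (z * q ^ 2) * q ^ 2 by ring, mul_pow]; ring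
      have e3 : (z * q ^ 4) ^ m = (z * q ^ 2) ^ m * q ^ (2 * m) := by
        rw [show z * q ^ 4 = (z * q ^ 2) * q ^ 2 by ring, mul_pow]; ring
      rw [e2, e3]
      linear_combination ((z * q ^ 2) ^ (m+1)) * h + (z * q ^ 2) ^ m * Gp q y m * q ^ (2 * m + 3) * hzy
    have s1' := (summable_nat_add_iff 1).mpr s1
    have sV' := (summable_nat_add_iff 1).mpr sV
    rw [Summable.tsum_sub s1' (sV'.mul_left y), Summable.tsum_add (s1.mul_left _) (sV.mul_left _), tsum_mul_left, tsum_mul_left, tsum_mul_left, ← hV] at e1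
    have e4 : ∑' m, ((z * q ^ 2) ^ m * Gp q y m) = Sa q z := rfl
    rw [e4] at e1
    linear_combination (-1 : ℂ) * e1 - hS1 + y * hV1
  have hSq : Sa q (z * q ^ 2) = 1 + (1 + y / q) / (1 - y) * (z * q ^ 4) * V := by
    have s2 := Sat_summable q hq0 hq1 b hb0 hb _ hz2
    unfold Sa
    rw [s2.tsum_eq_zero_add]
    have e : ∀ m, (z * q ^ 2 * q ^ 2) ^ (m+1) * Gp q (z * q ^ 2)⁻¹ (m+1) = (1 + y / q) / (1 - y) * (z * q ^ 4) * ((z * q ^ 4) ^ m * Gp q y m) := by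
      intro m
      have : Gp q (z * q ^ 2)⁻¹ (m+1) = (1 + y / q) / (1 - y) * Gp q y m := by
        unfold Gp
        rw [Finset.prod_range_succ', mul_comm]
        have f1 : ∀ k, (z * q ^ 2)⁻¹ * q ^ (k + 2) = y * q ^ k := by
          intro k; rw [mul_inv, ← hy]; field_simp; ring
        congr 1
        · have f2 : (z * q ^ 2)⁻¹ * q ^ (2 * 0 + 1) = y / q := by
            rw [mul_inv, ← hy]; field_simp; norm_num
          rw [f2, f1]; simp
        · apply Finset.prod_congr rfl
          intro j _
          rw [show 2 * (j + 1) + 1 = (2 * j + 1) + 2 by ring, show 2 * (j + 1) + 2 = (2 * j + 2) + 2 by ring, f1, f1]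
      rw [this]
      ring
    rw [tsum_congr e, tsum_mul_left]
    simp [Gp, hV]
  have hyq : (z * q ^ 2)⁻¹ = y / q ^ 2 := by rw [mul_inv, ← hy]; rfl
  have hKz : (1 - z) * ((1 + y / q) / (1 - y)) = - z * (1 + y / q) := by
    rw [hy]
    have : 1 - z⁻¹ ≠ 0 := by
      intro h; apply h1z'
      field_simp at h
      simpa using h
    field_simp
    ring
  unfold Ra
  rw [← hy, hyq, hSq]
  have g1 : (1 - z) * (1 + (1 + y / q) / (1 - y) * (z * q ^ 4) * V) = (1 - z) - z * (1 + y / q) * (z * q ^ 4) * V := by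
    linear_combination (z * q ^ 4 * V) * hKz
  have g2 : (1 - z) * (1 - y / q ^ 2 + (q + y / q ^ 2) * (1 + (1 + y / q) / (1 - y) * (z * q ^ 4) * V)) =
     (1 - z) * (1 - y / q ^ 2) + (q + y / q ^ 2) * ((1 - z) - z * (1 + y / q) * (z * q ^ 4) * V) := by
    linear_combination (q + y / q ^ 2) * g1
  rw [g2]
  have g3 : (q + y / q ^ 2) * (z * (1 + y / q) * (z * q ^ 4) * V) = z * (1 + z * q) * q * (V * (y + q ^ 3)) := by
    have : y = z⁻¹ := hy
    rw [this]
    field_simp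
    ring
  have g5 : (1 - z) * (1 - y / q ^ 2) + (q + y / q ^ 2) * (1 - z) - z * (1 + z * q) * q * (Sa q z * (1 - z * q ^ 2) + y - 1)
      + q * z ^ 2 * (1 - z * q ^ 2) * (1 - y + (q + y) * Sa q z) = (1 - q * z) * (1 - z) * (1 - z * q ^ 2) := by
    have : y = z⁻¹ := hy
    rw [this]
    field_simp
    ring
  linear_combination -g3 - z * (1 + z * q) * q * hrel + g5
end M2

namespace M2
open Filter Topology

noncomputable def Pn (x : ℂ) (n : ℕ) : ℂ := ∏ j ∈ Finset.range n, (1 - x ^ (2 * j + 2)) / (1 - x ^ (2 * j + 1))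

lemma one_sub_pow_ne (x : ℂ) (hx : ‖x‖ < 1) (k : ℕ) (hk : k ≠ 0) : 1 - x ^ k ≠ 0 := by
  intro h
  have : ‖x ^ k‖ = 1 := by rw [← sub_eq_zero.mp h, norm_one]
  rw [norm_pow] at this
  have h2 := pow_lt_one₀ (norm_nonneg x) hx hk
  linarith

lemma Pn_ne (x : ℂ) (hx : ‖x‖ < 1) (n : ℕ) : Pn x n ≠ 0 := by
  unfold Pn
  rw [Finset.prod_ne_zero_iff]
  intro j _
  exact div_ne_zero (one_sub_pow_ne x hx _ (by omega)) (one_sub_pow_ne x hx _ (by omega))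

lemma Pn_succ (x : ℂ) (n : ℕ) : Pn x (n+1) = Pn x n * ((1 - x ^ (2 * n + 2)) / (1 - x ^ (2 * n + 1))) := by
  unfold Pn
  rw [Finset.prod_range_succ]

lemma shanks (x : ℂ) (hx : ‖x‖ < 1) (n : ℕ) :
    ∑ i ∈ Finset.range n, (x ^ (i * (2 * i + 1)) + x ^ ((i + 1) * (2 * i + 1)))
      = ∑ s ∈ Finset.range n, Pn x n / Pn x s * x ^ (s * (2 * n + 1)) := by
  induction n with
  | zero => simp
  | succ n ih =>
    rw [Finset.sum_range_succ, ih, Finset.sum_range_succ (fun s => Pn x (n+1) / Pn x s * x ^ (s * (2 * (n+1) + 1)))]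
    set D : ℕ → ℂ := fun s => (Pn x n / Pn x s) * x ^ (s * (2 * n + 1)) * (1 - x ^ (2 * s)) / (1 - x ^ (2 * n + 1)) with hD
    have hn1 : 1 - x ^ (2 * n + 1) ≠ 0 := one_sub_pow_ne x hx _ (by omega)
    have hd : ∀ s, Pn x (n+1) / Pn x s * x ^ (s * (2 * (n+1) + 1)) = Pn x n / Pn x s * x ^ (s * (2 * n + 1)) + (D (s+1) - D s) := by
      intro s
      simp only [hD]
      rw [Pn_succ x n, Pn_succ x s]
      have h1 := Pn_ne x hx s
      have h2 : 1 - x ^ (2 * s + 1) ≠ 0 := one_sub_pow_ne x hx _ (by omega)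
      have h3 : 1 - x ^ (2 * s + 2) ≠ 0 := one_sub_pow_ne x hx _ (by omega)
      have e1 : x ^ (s * (2 * (n+1) + 1)) = x ^ (s * (2 * n + 1)) * x ^ (2 * s) := by
        rw [← pow_add]; congr 1; ring
      have e2 : x ^ ((s+1) * (2 * n + 1)) = x ^ (s * (2 * n + 1)) * x ^ (2 * n + 1) := by
        rw [← pow_add]; congr 1; ring
      have e3 : x ^ (2 * n + 2) = x ^ (2 * n + 1) * x := by rw [← pow_succ]
      have e4 : x ^ (2 * s + 1) = x ^ (2 * s) * x := by rw [← pow_succ]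
      have e5 : 2 * (s + 1) = 2 * s + 2 := by ring
      rw [e1, e2, e3, e5]
      rw [e4] at h2 ⊢
      generalize x ^ (s * (2 * n + 1)) = A at *
      generalize x ^ (2 * n + 1) = B at *
      generalize x ^ (2 * s) = C at *
      generalize x ^ (2 * s + 2) = F at *
      field_simp
      ring
    rw [Finset.sum_congr rfl (fun s _ => hd s), Finset.sum_add_distrib, Finset.sum_range_sub, add_assoc]
    congr 1
    simp only [hD]
    rw [Pn_succ x n]
    have h1 := Pn_ne x hx n
    have e1 : x ^ (n * (2 * (n+1) + 1)) = x ^ (n * (2 * n + 1)) * x ^ (2 * n) := by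
      rw [← pow_add]; congr 1; ring
    have e2 : x ^ ((n+1) * (2 * n + 1)) = x ^ (n * (2 * n + 1)) * (x ^ (2 * n) * x) := by
      rw [← pow_succ, ← pow_add]; congr 1; ring
    have e3 : x ^ (2 * n + 2) = x ^ (2 * n) * x ^ 2 := by rw [← pow_add]
    have e4 : x ^ (2 * n + 1) = x ^ (2 * n) * x := by rw [← pow_succ]
    rw [e1, e2, e3]
    rw [e4] at hn1 ⊢
    generalize x ^ (n * (2 * n + 1)) = A at *
    generalize x ^ (2 * n) = C at *
    field_simp
    ring

lemma Pn_ratio_bound (x : ℂ) (hx0 : x ≠ 0) (hx : ‖x‖ < 1) (s n : ℕ) (h : s ≤ n) :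
    ‖Pn x n / Pn x s‖ ≤ gb ‖x‖ ‖x‖ n := by
  have hr0 : 0 < ‖x‖ := norm_pos_iff.mpr hx0
  have hb : ‖x‖ ^ 2 < ‖x‖ := by nlinarith
  induction n, h using Nat.le_induction with
  | base =>
    rw [div_self (Pn_ne x hx s), norm_one]
    unfold gb
    apply Finset.one_le_prod
    intro j _
    have := gb_den ‖x‖ ‖x‖ hr0.le hx hr0 hb j
    rw [one_le_div this]
    have : 0 ≤ ‖x‖ ^ (2 * j + 1) / ‖x‖ := by positivity
    have : 0 ≤ ‖x‖ ^ (2 * j + 2) / ‖x‖ := by positivity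
    linarith
  | succ n hn ih =>
    have e : Pn x (n+1) / Pn x s = Pn x n / Pn x s * ((1 - x ^ (2 * n + 2)) / (1 - x ^ (2 * n + 1))) := by
      rw [Pn_succ]; ring
    have e2 : gb ‖x‖ ‖x‖ (n+1) = gb ‖x‖ ‖x‖ n * ((1 + ‖x‖ ^ (2 * n + 1) / ‖x‖) / (1 - ‖x‖ ^ (2 * n + 2) / ‖x‖)) := by
      unfold gb; rw [Finset.prod_range_succ]
    rw [e, e2, norm_mul, norm_div (1 - x ^ (2 * n + 2))]
    have hd := gb_den ‖x‖ ‖x‖ hr0.le hx hr0 hb n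
    have hg := gb_pos ‖x‖ ‖x‖ hr0.le hx hr0 hb n
    have f1 : ‖x‖ ^ (2 * n + 1) / ‖x‖ = ‖x‖ ^ (2 * n) := by rw [pow_succ]; field_simp
    have f2 : ‖x‖ ^ (2 * n + 2) / ‖x‖ = ‖x‖ ^ (2 * n + 1) := by rw [pow_succ _ (2 * n + 1)]; field_simp
    rw [f2] at hd
    rw [f1, f2]
    have g1 : ‖1 - x ^ (2 * n + 2)‖ ≤ 1 + ‖x‖ ^ (2 * n) := by
      refine (norm_sub_le _ _).trans ?_
      rw [norm_one, norm_pow]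
      have := pow_le_pow_of_le_one hr0.le hx.le (show 2 * n ≤ 2 * n + 2 by omega)
      linarith
    have g2 : 1 - ‖x‖ ^ (2 * n + 1) ≤ ‖1 - x ^ (2 * n + 1)‖ := by
      have := norm_sub_norm_le (1:ℂ) (x ^ (2 * n + 1))
      rwa [norm_one, norm_pow] at this
    gcongr

lemma Pn_tendsto_thS (q : ℂ) (hq0 : q ≠ 0) (hq1 : ‖q‖ < 1) : Tendsto (Pn (-q)) atTop (𝓝 (thS q)) := by
  set x := -q with hx
  have hx0 : x ≠ 0 := neg_ne_zero.mpr hq0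
  have hx1 : ‖x‖ < 1 := by rwa [hx, norm_neg]
  have hr0 : 0 < ‖x‖ := norm_pos_iff.mpr hx0
  have hb : ‖x‖ ^ 2 < ‖x‖ := by nlinarith
  have hA : Tendsto (fun n => ∑ i ∈ Finset.range n, (x ^ (i * (2 * i + 1)) + x ^ ((i + 1) * (2 * i + 1)))) atTop (𝓝 (thS q)) := by
    have h := (thS_hasSum q hq0 hq1).nat_add_neg_add_one.tendsto_sum_nat
    refine h.congr ?_
    intro n
    apply Finset.sum_congr rfl
    intro i _
    have e1 : q ^ (2 * (i:ℤ) ^ 2 + i) = q ^ (i * (2 * i + 1)) := by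
      rw [← zpow_natCast]; congr 1; push_cast; ring
    have e2 : q ^ (2 * (-((i:ℤ) + 1)) ^ 2 + (-((i:ℤ) + 1))) = q ^ ((i + 1) * (2 * i + 1)) := by
      rw [← zpow_natCast]; congr 1; push_cast; ring
    rw [e1, e2, hx, neg_pow q (i * (2 * i + 1)), neg_pow q ((i + 1) * (2 * i + 1))]
    have e3 : (-1 : ℂ) ^ (i * (2 * i + 1)) = (-1) ^ i := by
      rw [mul_comm, pow_mul, Odd.neg_one_pow ⟨i, rfl⟩]
    have e4 : (-1 : ℂ) ^ ((i + 1) * (2 * i + 1)) = (-1) ^ (i + 1) := by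
      rw [mul_comm, pow_mul, Odd.neg_one_pow ⟨i, rfl⟩]
    have e5 : (-1 : ℂ) ^ (-((i:ℤ) + 1)) = (-1) ^ (i + 1) := by
      rw [zpow_neg, ← inv_zpow, inv_neg, inv_one, ← zpow_natCast]; simp
    rw [e3, e4, e5, zpow_natCast]
  have hdiff : Tendsto (fun n => ∑ i ∈ Finset.range n, (x ^ (i * (2 * i + 1)) + x ^ ((i + 1) * (2 * i + 1))) - Pn x n) atTop (𝓝 0) := by
    have hz := (gb_summable ‖x‖ ‖x‖ hr0 hx1 hr0 hb).tendsto_atTop_zero.mul_const ((1 - ‖x‖)⁻¹)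
    rw [zero_mul] at hz
    refine squeeze_zero_norm' ?_ hz
    filter_upwards [eventually_ge_atTop 1] with n hn
    rw [shanks x hx1]
    obtain ⟨m, rfl⟩ : ∃ m, n = m + 1 := ⟨n - 1, by omega⟩
    rw [Finset.sum_range_succ']
    have : Pn x (m+1) / Pn x 0 * x ^ (0 * (2 * (m+1) + 1)) = Pn x (m+1) := by simp [Pn]
    rw [this, add_sub_cancel_right]
    have hg := gb_pos ‖x‖ ‖x‖ hr0.le hx1 hr0 hb (m+1)
    have hrr : ‖x‖ ^ 2 / ‖x‖ = ‖x‖ := by field_simp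
    rw [hrr]
    calc _ ≤ ∑ s ∈ Finset.range m, ‖x‖ ^ (m+1) * gb ‖x‖ ‖x‖ (m+1) * ‖x‖ ^ s := by
          apply norm_sum_le_of_le
          intro s hs
          rw [norm_mul, norm_pow]
          have h1 := Pn_ratio_bound x hx0 hx1 (s+1) (m+1) (by have := Finset.mem_range.mp hs; omega)
          have h2 : ‖x‖ ^ ((s + 1) * (2 * (m + 1) + 1)) ≤ ‖x‖ ^ ((m + 1) + s) :=
            pow_le_pow_of_le_one hr0.le hx1.le (by nlinarith)
          rw [pow_add] at h2
          calc _ ≤ gb ‖x‖ ‖x‖ (m+1) * (‖x‖ ^ (m+1) * ‖x‖ ^ s) := by gcongr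
            _ = _ := by ring
      _ = ‖x‖ ^ (m+1) * gb ‖x‖ ‖x‖ (m+1) * ∑ s ∈ Finset.range m, ‖x‖ ^ s := by rw [Finset.mul_sum]
      _ ≤ _ := by
          gcongr
          rw [← tsum_geometric_of_lt_one hr0.le hx1]
          exact (summable_geometric_of_lt_one hr0.le hx1).sum_le_tsum _ (fun i _ => by positivity)
  have := hA.sub hdiff
  simpa using this

noncomputable def Lamt (q : ℂ) (k : ℕ) : ℂ := -((-q) ^ k / (1 + (-q) ^ k) / k)
noncomputable def Lam (q : ℂ) : ℂ := ∑' k : ℕ, Lamt q k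

lemma one_add_pow_bound (x : ℂ) (hx : ‖x‖ < 1) (k : ℕ) (hk : k ≠ 0) : 1 - ‖x‖ ≤ ‖1 + x ^ k‖ := by
  have h := norm_sub_norm_le (1:ℂ) (-x ^ k)
  rw [norm_one, norm_neg, norm_pow, sub_neg_eq_add] at h
  have := pow_le_of_le_one (norm_nonneg x) hx.le hk
  linarith

lemma Pn_inv_exp (x : ℂ) (hx : ‖x‖ < 1) (n : ℕ) :
    HasSum (fun k : ℕ => -(x ^ k * (1 - x ^ (2 * n * k)) / (1 + x ^ k) / k))
      (∑ j ∈ Finset.range n, (Complex.log (1 - x ^ (2 * j + 1)) - Complex.log (1 - x ^ (2 * j + 2)))) ∧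
    Complex.exp (∑ j ∈ Finset.range n, (Complex.log (1 - x ^ (2 * j + 1)) - Complex.log (1 - x ^ (2 * j + 2)))) = (Pn x n)⁻¹ := by
  constructor
  · have hj : ∀ j ∈ Finset.range n, HasSum (fun k : ℕ => -((x ^ (2 * j + 1)) ^ k / k) - -((x ^ (2 * j + 2)) ^ k / k))
        (Complex.log (1 - x ^ (2 * j + 1)) - Complex.log (1 - x ^ (2 * j + 2))) := by
      intro j _
      have a : ∀ m, m ≠ 0 → ‖x ^ m‖ < 1 := fun m hm => by rw [norm_pow]; exact pow_lt_one₀ (norm_nonneg _) hx hm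
      have h1 := (Complex.hasSum_taylorSeries_neg_log (a (2 * j + 1) (by omega))).neg
      have h2 := (Complex.hasSum_taylorSeries_neg_log (a (2 * j + 2) (by omega))).neg
      rw [neg_neg] at h1 h2
      exact h1.sub h2
    have h := hasSum_sum hj
    have e : (fun k : ℕ => -(x ^ k * (1 - x ^ (2 * n * k)) / (1 + x ^ k) / k)) = fun k : ℕ => ∑ j ∈ Finset.range n, (-((x ^ (2 * j + 1)) ^ k / k) - -((x ^ (2 * j + 2)) ^ k / k)) := by
      funext k
      rcases Nat.eq_zero_or_pos k with rfl | hk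
      · simp
      have h1 := one_sub_pow_ne x hx k hk.ne'
      have h2 : 1 + x ^ k ≠ 0 := ne_of_del (sub_pos.mpr hx) (one_add_pow_bound x hx k hk.ne')
      have hk' : (k : ℂ) ≠ 0 := by exact_mod_cast hk.ne'
      have e1 : ∀ j ∈ Finset.range n, (-((x ^ (2 * j + 1)) ^ k / k) - -((x ^ (2 * j + 2)) ^ k / k)) = (-(x ^ k * (1 - x ^ k) / k)) * ((x ^ k) ^ 2) ^ j := by
        intro j _
        rw [← pow_mul, ← pow_mul, ← pow_mul, ← pow_mul]
        have f1 : x ^ ((2 * j + 1) * k) = x ^ (k * 2 * j) * x ^ k := by rw [← pow_add]; congr 1; ring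
        have f2 : x ^ ((2 * j + 2) * k) = x ^ (k * 2 * j) * x ^ k * x ^ k := by rw [← pow_add, ← pow_add]; congr 1; ring
        rw [f1, f2]; ring
      have hne : (x ^ k) ^ 2 ≠ 1 := by
        intro h; have := mul_ne_zero h1 h2; apply this; linear_combination -h
      rw [Finset.sum_congr rfl e1, ← Finset.mul_sum, geom_sum_eq hne]
      have e3 : ((x ^ k) ^ 2) ^ n = x ^ (2 * n * k) := by rw [← pow_mul, ← pow_mul]; congr 1; ring
      rw [e3]
      have e4 : (x ^ k) ^ 2 - 1 = -((1 - x ^ k) * (1 + x ^ k)) := by ring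
      rw [e4]
      field_simp
      ring
    rw [e]; exact h
  · rw [Complex.exp_sum]
    unfold Pn
    rw [← Finset.prod_inv_distrib]
    apply Finset.prod_congr rfl
    intro j _
    rw [Complex.exp_sub, Complex.exp_log (one_sub_pow_ne x hx _ (by omega)), Complex.exp_log (one_sub_pow_ne x hx _ (by omega)), inv_div]

lemma thS_exp (q : ℂ) (hq0 : q ≠ 0) (hq1 : ‖q‖ < 1) : thS q * Complex.exp (Lam q) = 1 := by
  set x := -q with hx
  have hx1 : ‖x‖ < 1 := by rwa [hx, norm_neg]
  have h1 := Pn_tendsto_thS q hq0 hq1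
  have h2 : Tendsto (fun n => ∑' k : ℕ, -(x ^ k * (1 - x ^ (2 * n * k)) / (1 + x ^ k) / k)) atTop (𝓝 (Lam q)) := by
    unfold Lam
    apply tendsto_tsum_of_dominated_convergence (bound := fun k => ‖x‖ ^ k * 2 / (1 - ‖x‖))
    · exact ((summable_geometric_of_lt_one (norm_nonneg _) hx1).mul_right 2).div_const _
    · intro k
      unfold Lamt
      rcases Nat.eq_zero_or_pos k with rfl | hk
      · simp
      have : Tendsto (fun n => x ^ (2 * n * k)) atTop (𝓝 0) := by
        have e : (fun n => x ^ (2 * n * k)) = fun n => (x ^ (2 * k)) ^ n := by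
          funext n; rw [← pow_mul]; congr 1; ring
        rw [e]
        apply tendsto_pow_atTop_nhds_zero_of_norm_lt_one
        rw [norm_pow]; exact pow_lt_one₀ (norm_nonneg _) hx1 (by omega)
      have := ((((this.const_sub 1).const_mul (x ^ k)).div_const (1 + x ^ k)).div_const (k:ℂ)).neg
      simpa using this
    · filter_upwards with n k
      rcases Nat.eq_zero_or_pos k with rfl | hk
      · have : 0 < 1 - ‖x‖ := by linarith
        simp; positivity
      have hb := one_add_pow_bound x hx1 k hk.ne'
      have hp : 0 < 1 - ‖x‖ := by linarith
      rw [norm_neg, norm_div, norm_div, norm_mul, norm_pow, Complex.norm_natCast]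
      have h3 : ‖1 - x ^ (2 * n * k)‖ ≤ 2 := by
        refine (norm_sub_le _ _).trans ?_
        rw [norm_one, norm_pow]
        have := pow_le_one₀ (n := 2 * n * k) (norm_nonneg x) hx1.le
        linarith
      have hk1 : (1:ℝ) ≤ k := by exact_mod_cast hk
      calc _ ≤ ‖x‖ ^ k * ‖1 - x ^ (2 * n * k)‖ / ‖1 + x ^ k‖ := div_le_self (by positivity) hk1
        _ ≤ _ := by gcongr
  have h3 : Tendsto (fun n => (Pn x n)⁻¹) atTop (𝓝 (Complex.exp (Lam q))) := by
    refine ((Complex.continuous_exp.tendsto _).comp h2).congr ?_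
    intro n
    obtain ⟨a, b⟩ := Pn_inv_exp x hx1 n
    simp only [Function.comp]
    rw [a.tsum_eq, b]
  have h4 := h1.mul h3
  refine tendsto_nhds_unique h4 ?_
  refine tendsto_const_nhds.congr ?_
  intro n
  exact (mul_inv_cancel₀ (Pn_ne x hx1 n)).symm

theorem main_id (q : ℂ) (hq0 : q ≠ 0) (hq1 : ‖q‖ < 1) (z : ℂ) (hz : ‖z‖ = 1) :
    Rb q z = Lf q z * Complex.exp (Lam q) ∧ Ra q z = Lf q z * Complex.exp (Lam q) := by
  have hr0 : 0 < ‖q‖ := norm_pos_iff.mpr hq0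
  obtain ⟨b, hb, hbq⟩ := exists_between (show ‖q‖ ^ 2 < ‖q‖ by nlinarith)
  have hb0 : 0 < b := lt_trans (by positivity) hb
  have hb1 : b < 1 := hbq.trans hq1
  have hth := thS_hasSum q hq0 hq1
  have hte := thS_exp q hq0 hq1
  have hth0 : thS q ≠ 0 := left_ne_zero_of_mul_eq_one hte
  have hmem : ∀ w : ℂ, ‖q‖ ≤ ‖w‖ → ‖w‖ ≤ ‖q‖⁻¹ → w ∈ Ann b := by
    intro w h1 h2
    refine ⟨by linarith, h2.trans_lt ?_⟩
    gcongr
  have hgen : ∀ R : ℂ → ℂ, DifferentiableOn ℂ R (Ann b) → (∀ w : ℂ, ‖w‖ = ‖q‖⁻¹ → (1 - w) * R (w * q ^ 2) + q * w ^ 2 * (1 - w * q ^ 2) * R w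
      = (1 - q * w) * (1 - w) * (1 - w * q ^ 2)) → R z = Lf q z * Complex.exp (Lam q) := by
    intro R hR hFE
    have := uniqueness q hq0 hq1 (fun w => Lf q w - thS q * R w) ?_ ?_ (thS q) hth hth0 z hz
    · have h1 : Lf q z = thS q * R z := sub_eq_zero.mp this
      rw [h1]; linear_combination -R z * hte
    · intro w h1 h2
      have hd : DifferentiableOn ℂ (fun w => Lf q w - thS q * R w) (Ann b) :=
        (Lf_diff q hq0 hq1 b hb0 hb1 hb).sub (hR.const_mul _)
      exact hd.differentiableAt ((isOpen_Ann b).mem_nhds (hmem w h1 h2))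
    · intro w hw
      have h1 := Lf_FE q hq0 hq1 b hb0 hb1 hb hbq w hw
      have h2 := hFE w hw
      linear_combination h1 - thS q * h2
  exact ⟨hgen _ (Rb_diff q hq1 b hb0 hb) (Rb_FE q hq0 hq1 b hb0 hb hbq),
    hgen _ (Ra_diff q hq0 hq1 b hb0 hb) (Ra_FE q hq0 hq1 b hb0 hb hbq)⟩
end M2

namespace M2
open Filter Topology

noncomputable def om : ℂ := Complex.exp (2 * Real.pi * Complex.I / 3)
def Sec : Set ℂ := {t | 0 < t.re ∧ |t.im| ≤ t.re}

lemma om_eq : om = -1/2 + (Real.sqrt 3 / 2 : ℝ) * Complex.I := by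
  unfold om
  have : (2 * Real.pi * Complex.I / 3 : ℂ) = ((Real.pi - Real.pi / 3 : ℝ) : ℂ) * Complex.I := by push_cast; ring
  rw [this, Complex.exp_mul_I, ← Complex.ofReal_cos, ← Complex.ofReal_sin, Real.cos_pi_sub, Real.sin_pi_sub, Real.cos_pi_div_three, Real.sin_pi_div_three]
  push_cast; ring

lemma om_cube : om ^ 3 = 1 := by
  unfold om
  rw [← Complex.exp_nat_mul]
  rw [show ((3:ℕ) : ℂ) * (2 * Real.pi * Complex.I / 3) = 2 * Real.pi * Complex.I by push_cast; ring]
  exact Complex.exp_two_pi_mul_I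

lemma om_norm : ‖om‖ = 1 := by
  unfold om
  rw [show (2 * Real.pi * Complex.I / 3 : ℂ) = ((2 * Real.pi / 3 : ℝ) : ℂ) * Complex.I by push_cast; ring]
  exact Complex.norm_exp_ofReal_mul_I _

lemma om_ne : om ≠ 0 := by rw [← norm_pos_iff, om_norm]; norm_num

lemma om_sq : om ^ 2 = -1/2 - (Real.sqrt 3 / 2 : ℝ) * Complex.I := by
  rw [om_eq]
  have h : ((Real.sqrt 3 : ℝ) : ℂ) ^ 2 = 3 := by
    rw [← Complex.ofReal_pow, Real.sq_sqrt (by norm_num)]; norm_num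
  push_cast
  linear_combination (Complex.I ^ 2 / 4) * h + (3/4 : ℂ) * Complex.I_sq

lemma om_sum : 1 + om + om ^ 2 = 0 := by rw [om_sq, om_eq]; ring

lemma om_zpow_mod (n k : ℤ) (h : n % 3 = k) : om ^ n = om ^ k := by
  have : n = 3 * (n / 3) + k := by omega
  rw [this, zpow_add₀ om_ne, zpow_mul]
  have : om ^ (3:ℤ) = 1 := by exact_mod_cast om_cube
  rw [this, one_zpow, one_mul]

lemma norm_one_sub_exp (w : ℂ) (hw : 0 ≤ w.re) : ‖1 - Complex.exp (-w)‖ ≤ ‖w‖ := by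
  have hc : Convex ℝ {z : ℂ | z.re ≤ 0} := convex_halfSpace_re_le 0
  have := hc.norm_image_sub_le_of_norm_hasDerivWithin_le (𝕜 := ℂ) (f := Complex.exp) (f' := Complex.exp) (C := 1) (x := -w) (y := 0)
    (fun x _ => (Complex.hasDerivAt_exp x).hasDerivWithinAt)
    (fun x hx => by rw [Complex.norm_exp]; exact Real.exp_le_one_iff.mpr hx) (by simpa using hw) (by simp)
  simpa using this

lemma sec_norm (t : ℂ) (ht : t ∈ Sec) : ‖t‖ ≤ 2 * t.re := by
  have := Complex.norm_le_abs_re_add_abs_im t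
  rw [abs_of_pos ht.1] at this
  linarith [ht.2]

lemma x_exp_le (x : ℝ) : x * Real.exp (-x) ≤ 1 := by
  rw [Real.exp_neg]
  have h := Real.add_one_le_exp x
  have h2 := Real.exp_pos x
  rw [mul_inv_le_iff₀ h2]; linarith

noncomputable def kk (t : ℂ) (n : ℕ) : ℂ :=
  t * Complex.exp (-t * (2 * n ^ 2 + n)) / (1 - Complex.exp (-(2 * n * t)))

lemma kk_den (t : ℂ) (n : ℕ) :
    1 - Real.exp (-(2 * n * t.re)) ≤ ‖1 - Complex.exp (-(2 * n * t))‖ := by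
  have h := norm_sub_norm_le (1:ℂ) (Complex.exp (-(2 * n * t)))
  rw [norm_one, Complex.norm_exp] at h
  have e : (-(2 * (n:ℂ) * t)).re = -(2 * n * t.re) := by simp
  rwa [e] at h

lemma kk_diff (t : ℂ) (ht : t ∈ Sec) (n : ℕ) (hn : 1 ≤ n) : ‖kk t n - kk t (n+3)‖ ≤ 189 / (n:ℝ) ^ 2 := by
  have hs : 0 < t.re := ht.1
  set s := t.re with hsdef
  have htn := sec_norm t ht
  have hn1 : (1:ℝ) ≤ n := by exact_mod_cast hn
  set x := 2 * n * s with hx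
  have hx0 : 0 < x := by positivity
  set v := Complex.exp (-(2 * n * t)) with hv
  set w := Complex.exp (-(6 * t)) with hw
  set E := Complex.exp (-t * (2 * n ^ 2 + n)) with hE
  set E' := Complex.exp (-(t * (12 * n + 21))) with hE'
  have hvw : Complex.exp (-(2 * ((n+3 : ℕ) : ℂ) * t)) = v * w := by
    rw [hv, hw, ← Complex.exp_add]; congr 1; push_cast; ring
  have hEE : Complex.exp (-t * (2 * ((n+3 : ℕ) : ℂ) ^ 2 + ((n+3 : ℕ) : ℂ))) = E * E' := by
    rw [hE, hE', ← Complex.exp_add]; congr 1; push_cast; ring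
  have d1 : 1 - Real.exp (-x) ≤ ‖1 - v‖ := kk_den t n
  have d2 : 1 - Real.exp (-x) ≤ ‖1 - v * w‖ := by
    have h := kk_den t (n+3)
    rw [hvw] at h
    refine le_trans ?_ h
    have : Real.exp (-(2 * ((n+3 : ℕ) : ℝ) * t.re)) ≤ Real.exp (-x) := by
      apply Real.exp_le_exp.mpr
      rw [hx]; push_cast; nlinarith
    linarith
  have hex : Real.exp (-x) < 1 := by rw [Real.exp_lt_one_iff]; linarith
  have hdp : 0 < 1 - Real.exp (-x) := by linarith
  have n1 : 1 - v ≠ 0 := ne_of_del hdp d1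
  have n2 : 1 - v * w ≠ 0 := ne_of_del hdp d2
  have hdec : kk t n - kk t (n+3) = t * E * (v * (1 - w) / ((1 - v) * (1 - v * w))) + t * E * (1 - E') / (1 - v * w) := by
    have h1 : kk t n = t * E / (1 - v) := rfl
    have h2 : kk t (n+3) = t * (E * E') / (1 - v * w) := by unfold kk; rw [hvw, hEE]
    rw [h1, h2]
    field_simp
    ring
  have nv : ‖v‖ = Real.exp (-x) := by
    rw [hv, Complex.norm_exp]; congr 1; simp [hx, hsdef]
  have nE : ‖E‖ ≤ Real.exp (-(2 * s * n ^ 2)) := by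
    rw [hE, Complex.norm_exp]
    apply Real.exp_le_exp.mpr
    have : (-t * (2 * (n:ℂ) ^ 2 + n)).re = -s * (2 * n ^ 2 + n) := by
      rw [show (2 * (n:ℂ) ^ 2 + n) = ((2 * n ^ 2 + n : ℝ) : ℂ) by push_cast; ring, Complex.re_mul_ofReal]; simp [hsdef]
    rw [this]; nlinarith
  have nE1 : ‖E‖ ≤ 1 := nE.trans (Real.exp_le_one_iff.mpr (by have : 0 ≤ 2 * s * (n:ℝ)^2 := by positivity
                                                              linarith))
  have nw : ‖1 - w‖ ≤ 6 * ‖t‖ := by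
    have := norm_one_sub_exp (6 * t) (by simp; linarith)
    rw [norm_mul] at this
    simpa using this
  have nE' : ‖1 - E'‖ ≤ ‖t‖ * (12 * n + 21) := by
    have h := norm_one_sub_exp (t * (12 * n + 21)) (by
      rw [show (12 * (n:ℂ) + 21) = ((12 * n + 21 : ℝ) : ℂ) by push_cast; ring, Complex.re_mul_ofReal]; positivity)
    rw [norm_mul] at h
    rw [show (12 * (n:ℂ) + 21) = ((12 * n + 21 : ℝ) : ℂ) by push_cast; ring, Complex.norm_real, Real.norm_of_nonneg (by positivity)] at h
    rw [hE', show (12 * (n:ℂ) + 21) = ((12 * n + 21 : ℝ) : ℂ) by push_cast; ring]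
    exact h
  -- first piece
  have hA : ‖t * E * (v * (1 - w) / ((1 - v) * (1 - v * w)))‖ ≤ 24 / (n:ℝ)^2 := by
    rw [norm_mul, norm_mul, norm_div, norm_mul, norm_mul, nv]
    have hy : x / 2 * Real.exp (-(x/2)) ≤ 1 - Real.exp (-x) := by
      have e : Real.exp (-x) = Real.exp (-(x/2)) * Real.exp (-(x/2)) := by rw [← Real.exp_add]; ring_nf
      have h1 := Real.add_one_le_exp (x/2)
      have h2 : Real.exp (x/2) * Real.exp (-(x/2)) = 1 := by rw [← Real.exp_add]; simp
      have h3 := Real.exp_pos (-(x/2))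
      have h4 : Real.exp (-(x/2)) < 1 := by rw [Real.exp_lt_one_iff]; linarith
      rw [e]; nlinarith
    have hsq : x ^ 2 / 4 * Real.exp (-x) ≤ (1 - Real.exp (-x)) * (1 - Real.exp (-x)) := by
      have e : Real.exp (-x) = Real.exp (-(x/2)) * Real.exp (-(x/2)) := by rw [← Real.exp_add]; ring_nf
      calc x ^ 2 / 4 * Real.exp (-x) = (x / 2 * Real.exp (-(x/2))) * (x / 2 * Real.exp (-(x/2))) := by rw [e]; ring
        _ ≤ _ := by gcongr
    calc ‖t‖ * ‖E‖ * (Real.exp (-x) * ‖1 - w‖ / (‖1 - v‖ * ‖1 - v * w‖))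
        ≤ (2 * s) * 1 * (Real.exp (-x) * (6 * (2 * s)) / ((1 - Real.exp (-x)) * (1 - Real.exp (-x)))) := by
          gcongr
          linarith
      _ ≤ (2 * s) * 1 * (Real.exp (-x) * (6 * (2 * s)) / (x ^ 2 / 4 * Real.exp (-x))) := by
          gcongr
      _ = 24 / (n:ℝ)^2 := by
          rw [hx]
          have := Real.exp_pos (-(2 * n * s))
          field_simp
          norm_num
  have hB : ‖t * E * (1 - E') / (1 - v * w)‖ ≤ 165 / (n:ℝ)^2 := by
    rw [norm_div, norm_mul, norm_mul]
    have h1 : x / (1 + x) ≤ 1 - Real.exp (-x) := by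
      have h2 := Real.add_one_le_exp x
      have h3 : Real.exp (-x) ≤ (1 + x)⁻¹ := by
        rw [Real.exp_neg]; apply inv_anti₀ (by positivity); linarith
      have : x / (1 + x) = 1 - (1 + x)⁻¹ := by field_simp; ring
      linarith
    calc ‖t‖ * ‖E‖ * ‖1 - E'‖ / ‖1 - v * w‖ ≤ (2 * s) * Real.exp (-(2 * s * n ^ 2)) * ((2 * s) * (33 * n)) / (x / (1 + x)) := by
          have : ‖1 - E'‖ ≤ (2 * s) * (33 * n) := nE'.trans (by gcongr; linarith)
          gcongr
          linarith
      _ = 66 * (s * Real.exp (-(2 * s * n ^ 2))) + 132 * (n * (s ^ 2 * Real.exp (-(2 * s * n ^ 2)))) := by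
          rw [hx]; field_simp; ring
      _ ≤ 66 * (1 / (2 * n ^ 2)) + 132 * (n * (1 / n ^ 4)) := by
          have f1 := x_exp_le (2 * s * n ^ 2)
          have f2 := x_exp_le (s * n ^ 2)
          have g1 : s * Real.exp (-(2 * s * n ^ 2)) ≤ 1 / (2 * n ^ 2) := by
            rw [le_div_iff₀ (by positivity)]; linarith
          have g2 : s ^ 2 * Real.exp (-(2 * s * n ^ 2)) ≤ 1 / n ^ 4 := by
            rw [le_div_iff₀ (by positivity)]
            have e : Real.exp (-(2 * s * n ^ 2)) = Real.exp (-(s * n ^ 2)) * Real.exp (-(s * n ^ 2)) := by rw [← Real.exp_add]; ring_nf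
            rw [e]
            have : 0 ≤ s * n ^ 2 * Real.exp (-(s * n ^ 2)) := by positivity
            nlinarith
          gcongr
      _ ≤ 165 / (n:ℝ)^2 := by
          have : (n:ℝ) * (1 / n ^ 4) ≤ 1 / n ^ 2 := by
            rw [mul_one_div, div_le_div_iff₀ (by positivity) (by positivity)]
            have : (n:ℝ)^3 ≤ n ^ 4 := pow_le_pow_right₀ hn1 (by norm_num)
            nlinarith
          have e : 66 * (1 / (2 * (n:ℝ) ^ 2)) = 33 * (1 / n ^ 2) := by field_simp; norm_num
          rw [e]
          calc _ ≤ 33 * (1 / (n:ℝ) ^ 2) + 132 * (1 / n ^ 2) := by gcongr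
            _ = _ := by ring
  rw [hdec]
  refine (norm_add_le _ _).trans ?_
  calc _ ≤ 24 / (n:ℝ)^2 + 165 / (n:ℝ)^2 := add_le_add hA hB
    _ = _ := by ring

lemma kk_tendsto (n : ℕ) (hn : 1 ≤ n) : Tendsto (fun t => kk t n) (𝓝[Sec] 0) (𝓝 (1 / (2 * n))) := by
  have hn0 : (n:ℂ) ≠ 0 := by exact_mod_cast (by omega : n ≠ 0)
  have h1 : Tendsto (fun t : ℂ => (1 - Complex.exp (-(2 * n * t))) / t) (𝓝[≠] 0) (𝓝 (2 * n)) := by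
    have hd : HasDerivAt (fun t : ℂ => 1 - Complex.exp (-(2 * n * t))) (2 * n) 0 := by
      have h1 : HasDerivAt (fun t : ℂ => -(2 * n * t)) (-(2 * n)) 0 := by
        have h0 := (hasDerivAt_id (0:ℂ)).const_mul (-(2 * (n:ℂ)))
        rw [mul_one] at h0
        exact h0.congr_of_eventuallyEq (Filter.Eventually.of_forall fun t => by simp)
      have := h1.cexp.const_sub 1
      simpa using this
    have := hd.tendsto_slope
    refine this.congr' ?_
    filter_upwards with t
    simp [slope_def_field]
  have hle : 𝓝[Sec] (0:ℂ) ≤ 𝓝[≠] 0 := by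
    apply nhdsWithin_mono
    intro t ht h
    have h' : t = 0 := h
    have := ht.1
    rw [h'] at this; simp at this
  have h2 := h1.mono_left hle
  have h3 : Tendsto (fun t : ℂ => Complex.exp (-t * (2 * n ^ 2 + n))) (𝓝[Sec] 0) (𝓝 1) := by
    have : Continuous (fun t : ℂ => Complex.exp (-t * (2 * n ^ 2 + n))) := by fun_prop
    have := (this.tendsto 0).mono_left (nhdsWithin_le_nhds (s := Sec))
    simpa using this
  have h4 := h3.div h2 (by simp [hn0])
  refine h4.congr ?_
  intro t
  simp only [Pi.div_apply]
  unfold kk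
  rw [div_div_eq_mul_div]; ring

lemma den_lower (η : ℂ) (hη : η = om ∨ η = om ^ 2) (x y : ℝ) (hx : |y| ≤ x) :
    1 / 3 ≤ ‖1 - η * Complex.exp (-(x + y * Complex.I))‖ := by
  have hηn : ‖η‖ = 1 := by rcases hη with rfl | rfl <;> simp [om_norm]
  have hre : (-((x:ℂ) + y * Complex.I)).re = -x := by simp
  rcases le_or_gt x (1/2) with h | h
  · have hk : (η * Complex.exp (-(x + y * Complex.I))).re ≤ 0 := by
      have e : Complex.exp (-(x + y * Complex.I)) = (Real.exp (-x) : ℂ) * (((Real.cos y : ℝ) : ℂ) - (Real.sin y : ℝ) * Complex.I) := by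
        rw [neg_add, Complex.exp_add, show -((y:ℂ) * Complex.I) = ((-y : ℝ) : ℂ) * Complex.I by push_cast; ring, Complex.exp_mul_I]
        rw [← Complex.ofReal_cos, ← Complex.ofReal_sin]; simp [sub_eq_add_neg]
      have hs3 : Real.sqrt 3 < 7/4 := by
        rw [Real.sqrt_lt' (by norm_num)]; norm_num
      have hs0 : 0 ≤ Real.sqrt 3 := Real.sqrt_nonneg _
      have hy : |y| ≤ 1/2 := hx.trans h
      have hsin : |Real.sin y| ≤ 1/2 := (Real.abs_sin_le_abs).trans hy
      have hcos : 7/8 ≤ Real.cos y := by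
        have := Real.one_sub_sq_div_two_le_cos (x := y)
        have h2 : y ^ 2 ≤ 1/4 := by rw [← sq_abs]; nlinarith [abs_nonneg y]
        linarith
      have hk : Real.sqrt 3 * |Real.sin y| ≤ Real.cos y := by nlinarith [abs_nonneg (Real.sin y)]
      have h1 : Real.sqrt 3 * Real.sin y ≤ Real.cos y := by nlinarith [le_abs_self (Real.sin y)]
      have h2 : -(Real.sqrt 3 * Real.sin y) ≤ Real.cos y := by nlinarith [neg_abs_le (Real.sin y)]
      have hep := Real.exp_pos (-x)
      rw [e]
      rcases hη with rfl | rfl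
      · rw [om_eq]
        have : ((-1/2 + (Real.sqrt 3 / 2 : ℝ) * Complex.I) * ((Real.exp (-x) : ℂ) * (((Real.cos y : ℝ) : ℂ) - (Real.sin y : ℝ) * Complex.I))).re = Real.exp (-x) * ((- Real.cos y + Real.sqrt 3 * Real.sin y) / 2) := by
          rw [show ((-1/2 + (Real.sqrt 3 / 2 : ℝ) * Complex.I) * ((Real.exp (-x) : ℂ) * (((Real.cos y : ℝ) : ℂ) - (Real.sin y : ℝ) * Complex.I))) =
           ((Real.exp (-x) * ((- Real.cos y + Real.sqrt 3 * Real.sin y) / 2) : ℝ) : ℂ) + ((Real.exp (-x) * ((Real.sqrt 3 * Real.cos y + Real.sin y) / 2) : ℝ) : ℂ) * Complex.I by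
            push_cast; linear_combination (-(Real.sqrt 3 : ℂ) / 2 * Complex.exp (-x) * Complex.sin y) * Complex.I_sq]
          rw [Complex.add_re, Complex.ofReal_re, Complex.re_ofReal_mul, Complex.I_re, mul_zero, add_zero]
        rw [this]
        nlinarith
      · rw [om_sq]
        have : ((-1/2 - (Real.sqrt 3 / 2 : ℝ) * Complex.I) * ((Real.exp (-x) : ℂ) * (((Real.cos y : ℝ) : ℂ) - (Real.sin y : ℝ) * Complex.I))).re = Real.exp (-x) * ((- Real.cos y - Real.sqrt 3 * Real.sin y) / 2) := by
          rw [show ((-1/2 - (Real.sqrt 3 / 2 : ℝ) * Complex.I) * ((Real.exp (-x) : ℂ) * (((Real.cos y : ℝ) : ℂ) - (Real.sin y : ℝ) * Complex.I))) =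
           ((Real.exp (-x) * ((- Real.cos y - Real.sqrt 3 * Real.sin y) / 2) : ℝ) : ℂ) + ((Real.exp (-x) * ((-Real.sqrt 3 * Real.cos y + Real.sin y) / 2) : ℝ) : ℂ) * Complex.I by
            push_cast; linear_combination ((Real.sqrt 3 : ℂ) / 2 * Complex.exp (-x) * Complex.sin y) * Complex.I_sq]
          rw [Complex.add_re, Complex.ofReal_re, Complex.re_ofReal_mul, Complex.I_re, mul_zero, add_zero]
        rw [this]
        nlinarith
    have h2 := Complex.re_le_norm (1 - η * Complex.exp (-(x + y * Complex.I)))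
    rw [Complex.sub_re, Complex.one_re] at h2
    linarith
  · have h1 := norm_sub_norm_le (1:ℂ) (η * Complex.exp (-(x + y * Complex.I)))
    rw [norm_one, norm_mul, hηn, one_mul, Complex.norm_exp, hre] at h1
    have h2 := Real.add_one_le_exp x
    have h3 : Real.exp (-x) ≤ 2/3 := by
      rw [Real.exp_neg, inv_le_comm₀ (Real.exp_pos _) (by norm_num)]; linarith
    linarith
end M2

namespace M2
open Filter Topology

lemma cot_tend (x : ℂ) (hx : x ∈ Complex.integerComplement) :
    Tendsto (fun N : ℕ => ∑ j ∈ Finset.range N, (1 / (x + j) - 1 / (j + 1 - x))) atTop (𝓝 (Real.pi * Complex.cot (Real.pi * x))) := by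
  have h := tendsto_logDeriv_euler_cot_sub hx
  have hN : Tendsto (fun N : ℕ => 1 / (x + N)) atTop (𝓝 0) := by
    simp_rw [one_div]
    apply tendsto_inv₀_cobounded.comp
    have h1 : Tendsto (fun N : ℕ => ‖(N:ℂ)‖ - ‖x‖) atTop atTop := by
      apply tendsto_atTop_add_const_right
      simpa using tendsto_natCast_atTop_atTop (R := ℝ)
    rw [← tendsto_norm_atTop_iff_cobounded]
    refine tendsto_atTop_mono (fun N => ?_) h1
    rw [add_comm]
    exact norm_sub_le_norm_add _ _
  have h2 := (h.const_add (1 / x)).sub hN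
  have e : 1 / x + (Real.pi * Complex.cot (Real.pi * x) - 1 / x) - 0 = Real.pi * Complex.cot (Real.pi * x) := by ring
  rw [e] at h2
  refine h2.congr ?_
  intro N
  induction N with
  | zero => simp
  | succ N ih =>
    rw [Finset.sum_range_succ, Finset.sum_range_succ, ← ih, cotTerm]
    have : (1:ℂ) / (x - (N + 1)) = - (1 / (N + 1 - x)) := by rw [← neg_sub, div_neg]
    rw [this]
    push_cast
    ring

lemma sum_lim : HasSum (fun j : ℕ => (1 / (2 * ((6 * j + 1 : ℕ) : ℂ)) - 1 / (2 * ((6 * j + 4 : ℕ) : ℂ))) +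
    (1 / (2 * ((6 * j + 2 : ℕ) : ℂ)) - 1 / (2 * ((6 * j + 5 : ℕ) : ℂ)))) (Real.pi / (3 * Real.sqrt 3) : ℝ) := by
  have hs : Summable (fun j : ℕ => (1 / (2 * ((6 * j + 1 : ℕ) : ℂ)) - 1 / (2 * ((6 * j + 4 : ℕ) : ℂ))) +
    (1 / (2 * ((6 * j + 2 : ℕ) : ℂ)) - 1 / (2 * ((6 * j + 5 : ℕ) : ℂ)))) := by
    have hb : Summable (fun j : ℕ => 3 * (1 / ((j + 1 : ℕ) : ℝ) ^ 2)) :=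
      ((summable_nat_add_iff 1 (f := fun j : ℕ => 1 / (j : ℝ) ^ 2)).mpr (Real.summable_one_div_nat_pow.mpr (by norm_num))).mul_left 3
    refine Summable.of_norm_bounded hb ?_
    intro j
    have e : (1 / (2 * ((6 * j + 1 : ℕ) : ℂ)) - 1 / (2 * ((6 * j + 4 : ℕ) : ℂ))) +
      (1 / (2 * ((6 * j + 2 : ℕ) : ℂ)) - 1 / (2 * ((6 * j + 5 : ℕ) : ℂ))) =
      ((3 / (2 * (6 * j + 1) * (6 * j + 4)) + 3 / (2 * (6 * j + 2) * (6 * j + 5)) : ℝ) : ℂ) := by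
      have h1 : (6 * (j:ℂ) + 1) ≠ 0 := by exact_mod_cast (by omega : 6 * j + 1 ≠ 0)
      have h2 : (6 * (j:ℂ) + 4) ≠ 0 := by exact_mod_cast (by omega : 6 * j + 4 ≠ 0)
      have h3 : (6 * (j:ℂ) + 2) ≠ 0 := by exact_mod_cast (by omega : 6 * j + 2 ≠ 0)
      have h4 : (6 * (j:ℂ) + 5) ≠ 0 := by exact_mod_cast (by omega : 6 * j + 5 ≠ 0)
      push_cast
      congr 1 <;> (field_simp; ring)
    rw [e, Complex.norm_real, Real.norm_of_nonneg (by positivity)]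
    have a1 : (3:ℝ) / (2 * (6 * j + 1) * (6 * j + 4)) ≤ 3/2 * (1 / ((j + 1 : ℕ) : ℝ) ^ 2) := by
      push_cast
      rw [mul_one_div, div_le_div_iff₀ (by positivity) (by positivity)]
      have : (0:ℝ) ≤ j := by positivity
      nlinarith
    have a2 : (3:ℝ) / (2 * (6 * j + 2) * (6 * j + 5)) ≤ 3/2 * (1 / ((j + 1 : ℕ) : ℝ) ^ 2) := by
      push_cast
      rw [mul_one_div, div_le_div_iff₀ (by positivity) (by positivity)]
      have : (0:ℝ) ≤ j := by positivity
      nlinarith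
    linarith
  have h6 : (1/6 : ℂ) ∈ Complex.integerComplement := by
    rw [Complex.mem_integerComplement_iff]
    rintro ⟨n, hn⟩
    have : (6 * n : ℂ) = 1 := by rw [hn]; norm_num
    have : (6 * n : ℤ) = 1 := by exact_mod_cast this
    omega
  have h3 : (1/3 : ℂ) ∈ Complex.integerComplement := by
    rw [Complex.mem_integerComplement_iff]
    rintro ⟨n, hn⟩
    have : (3 * n : ℂ) = 1 := by rw [hn]; norm_num
    have : (3 * n : ℤ) = 1 := by exact_mod_cast this
    omega
  have hsum := ((cot_tend _ h6).add (cot_tend _ h3)).const_mul (1/12 : ℂ)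
  have hval : (1/12 : ℂ) * (Real.pi * Complex.cot (Real.pi * (1/6)) + Real.pi * Complex.cot (Real.pi * (1/3))) = ((Real.pi / (3 * Real.sqrt 3) : ℝ) : ℂ) := by
    rw [show (Real.pi * (1/6) : ℂ) = ((Real.pi / 6 : ℝ) : ℂ) by push_cast; ring, show (Real.pi * (1/3) : ℂ) = ((Real.pi / 3 : ℝ) : ℂ) by push_cast; ring]
    unfold Complex.cot
    rw [← Complex.ofReal_cos, ← Complex.ofReal_cos, ← Complex.ofReal_sin, ← Complex.ofReal_sin, Real.cos_pi_div_six, Real.sin_pi_div_six, Real.cos_pi_div_three, Real.sin_pi_div_three]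
    have h : Real.sqrt 3 ^ 2 = 3 := Real.sq_sqrt (by norm_num)
    have h0 : Real.sqrt 3 ≠ 0 := by positivity
    rw [show (1/12 : ℂ) * (Real.pi * (((Real.sqrt 3 / 2 : ℝ) : ℂ) / ((1/2 : ℝ) : ℂ)) + Real.pi * (((1/2 : ℝ) : ℂ) / ((Real.sqrt 3 / 2 : ℝ) : ℂ))) =
      (((1/12 : ℝ) * (Real.pi * ((Real.sqrt 3 / 2) / (1/2)) + Real.pi * ((1/2) / (Real.sqrt 3 / 2))) : ℝ) : ℂ) by push_cast; ring]
    congr 1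
    field_simp
    rw [h]; norm_num
  rw [hval] at hsum
  have : ∑' j : ℕ, ((1 / (2 * ((6 * j + 1 : ℕ) : ℂ)) - 1 / (2 * ((6 * j + 4 : ℕ) : ℂ))) +
    (1 / (2 * ((6 * j + 2 : ℕ) : ℂ)) - 1 / (2 * ((6 * j + 5 : ℕ) : ℂ)))) = (Real.pi / (3 * Real.sqrt 3) : ℝ) := by
    refine tendsto_nhds_unique hs.hasSum.tendsto_sum_nat (hsum.congr ?_)
    intro N
    rw [← Finset.sum_add_distrib, Finset.mul_sum]
    apply Finset.sum_congr rfl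
    intro j _
    have h1 : (6 * (j:ℂ) + 1) ≠ 0 := by exact_mod_cast (by omega : 6 * j + 1 ≠ 0)
    have h2 : (6 * (j:ℂ) + 4) ≠ 0 := by exact_mod_cast (by omega : 6 * j + 4 ≠ 0)
    have h3 : (6 * (j:ℂ) + 2) ≠ 0 := by exact_mod_cast (by omega : 6 * j + 2 ≠ 0)
    have h4 : (6 * (j:ℂ) + 5) ≠ 0 := by exact_mod_cast (by omega : 6 * j + 5 ≠ 0)
    push_cast
    rw [show (1/6 + (j:ℂ)) = (6 * j + 1) / 6 by ring, show ((j:ℂ) + 1 - 1/6) = (6 * j + 5) / 6 by ring,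
      show (1/3 + (j:ℂ)) = (6 * j + 2) / 6 by ring, show ((j:ℂ) + 1 - 1/3) = (6 * j + 4) / 6 by ring]
    simp only [one_div, inv_div, mul_inv]
    ring
  rw [← this]
  exact hs.hasSum

lemma q_zpow (t : ℂ) (k : ℤ) : (om * Complex.exp (-t)) ^ k = om ^ k * Complex.exp (-(k * t)) := by
  rw [mul_zpow, ← Complex.exp_int_mul]; congr 2; ring

lemma q_norm (t : ℂ) : ‖om * Complex.exp (-t)‖ = Real.exp (-t.re) := by
  rw [norm_mul, om_norm, one_mul, Complex.norm_exp]; simp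

lemma den_lower' (η : ℂ) (hη : η = om ∨ η = om ^ 2) (t : ℂ) (ht : t ∈ Sec) (r : ℝ) (hr : 0 ≤ r) :
    1 / 3 ≤ ‖1 - η * Complex.exp (-(r * t))‖ := by
  have h := den_lower η hη (r * t.re) (r * t.im) (by rw [abs_mul, abs_of_nonneg hr]; exact mul_le_mul_of_nonneg_left ht.2 hr)
  have e : ((r * t.re : ℝ) : ℂ) + ((r * t.im : ℝ) : ℂ) * Complex.I = r * t := by
    conv_rhs => rw [← Complex.re_add_im t]
    push_cast; ring
  rwa [e] at h

lemma Lt_other (t : ℂ) (ht : t ∈ Sec) (n : ℤ) (hn : n ≠ 0) (h3 : n % 3 ≠ 1) :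
    ‖Lt (om * Complex.exp (-t)) om n‖ ≤ 3 * Real.exp (-(t.re * n ^ 2)) := by
  have hs := ht.1
  unfold Lt
  rw [if_neg hn, q_zpow, q_zpow, norm_div, norm_mul, norm_mul, norm_zpow, norm_zpow, om_norm, norm_neg, norm_one, one_zpow, one_zpow, one_mul, one_mul, Complex.norm_exp]
  have e1 : (-(((2 * n ^ 2 + n : ℤ) : ℂ) * t)).re = -(t.re * (2 * n ^ 2 + n)) := by
    rw [Complex.neg_re, ← Complex.ofReal_intCast, Complex.re_ofReal_mul]; push_cast; ring
  rw [e1]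
  have e2 : om * (om ^ (2 * n) * Complex.exp (-(((2 * n : ℤ) : ℂ) * t))) = om ^ (2 * n + 1) * Complex.exp (-(((2 * n : ℤ) : ℂ) * t)) := by
    rw [zpow_add₀ om_ne, zpow_one]; ring
  rw [e2]
  rcases lt_or_gt_of_ne hn with h | h
  · set η := om ^ (-(2 * n + 1)) with hηd
    have hη : η = om ∨ η = om ^ 2 := by
      have : (-(2 * n + 1)) % 3 = 2 ∨ (-(2 * n + 1)) % 3 = 1 := by omega
      rcases this with h | h
      · right; rw [hηd, om_zpow_mod _ _ h]; norm_cast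
      · left; rw [hηd, om_zpow_mod _ _ h]; norm_cast; simp
    have hd := den_lower' η hη t ht (-(2 * n : ℤ) : ℝ) (neg_nonneg.mpr (Int.cast_nonpos.mpr (by omega)))
    have e3 : 1 - om ^ (2 * n + 1) * Complex.exp (-(((2 * n : ℤ) : ℂ) * t)) = -(om ^ (2 * n + 1) * Complex.exp (-(((2 * n : ℤ) : ℂ) * t))) * (1 - η * Complex.exp (-(((-(2 * n : ℤ) : ℝ) : ℂ) * t))) := by
      rw [hηd, zpow_neg]
      have k1 : Complex.exp (-(((2 * n : ℤ) : ℂ) * t)) * Complex.exp (-(((-(2 * n : ℤ) : ℝ) : ℂ) * t)) = 1 := by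
        rw [← Complex.exp_add, Complex.exp_eq_one_iff]; exact ⟨0, by push_cast; ring⟩
      have k2 : om ^ (2 * n + 1) ≠ 0 := zpow_ne_zero _ om_ne
      generalize Complex.exp (-(((2 * n : ℤ) : ℂ) * t)) = A at k1 ⊢
      generalize Complex.exp (-(((-(2 * n : ℤ) : ℝ) : ℂ) * t)) = B at k1 ⊢
      generalize om ^ (2 * n + 1) = D at k2 ⊢
      have k3 : D * D⁻¹ = 1 := mul_inv_cancel₀ k2
      linear_combination -k1 - A * B * k3
    rw [e3, norm_mul, norm_neg, norm_mul, norm_zpow, om_norm, one_zpow, one_mul, Complex.norm_exp]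
    have e4 : (-(((2 * n : ℤ) : ℂ) * t)).re = -(t.re * (2 * n)) := by
      rw [Complex.neg_re, ← Complex.ofReal_intCast, Complex.re_ofReal_mul]; push_cast; ring
    rw [e4]
    calc _ ≤ Real.exp (-(t.re * (2 * n ^ 2 + n))) / (Real.exp (-(t.re * (2 * n))) * (1/3)) := by gcongr
      _ = 3 * Real.exp (-(t.re * (2 * n ^ 2 - n))) := by
        rw [show -(t.re * (2 * (n:ℝ) ^ 2 + n)) = -(t.re * (2 * n ^ 2 - n)) + -(t.re * (2 * n)) by ring, Real.exp_add]
        have := Real.exp_pos (-(t.re * (2 * n)))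
        field_simp
      _ ≤ _ := by
        have : (n:ℝ) < 0 := by exact_mod_cast h
        gcongr
        nlinarith
  · set η := om ^ (2 * n + 1) with hηd
    have hη : η = om ∨ η = om ^ 2 := by
      have : (2 * n + 1) % 3 = 2 ∨ (2 * n + 1) % 3 = 1 := by omega
      rcases this with h | h
      · right; rw [hηd, om_zpow_mod _ _ h]; norm_cast
      · left; rw [hηd, om_zpow_mod _ _ h]; norm_cast; simp
    have hd := den_lower' η hη t ht ((2 * n : ℤ) : ℝ) (Int.cast_nonneg (by omega))
    rw [Complex.ofReal_intCast] at hd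
    have hn0 : (0:ℝ) < n := by exact_mod_cast h
    calc _ ≤ Real.exp (-(t.re * (2 * n ^ 2 + n))) / (1/3) := by gcongr
      _ = 3 * Real.exp (-(t.re * (2 * n ^ 2 + n))) := by ring
      _ ≤ _ := by
        gcongr
        nlinarith
end M2

namespace M2
open Filter Topology

lemma Lt_summable_unit (q : ℂ) (hq0 : q ≠ 0) (hq1 : ‖q‖ < 1) (z : ℂ) (hz : ‖z‖ = 1) : Summable (Lt q z) := by
  have h0 := norm_pos_iff.mpr hq0
  refine Lt_summable q hq0 hq1 ‖q‖ h0 hq1 (by nlinarith) z ⟨by rw [hz]; exact hq1, ?_⟩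
  rw [hz]; exact (one_lt_inv₀ h0).mpr hq1

lemma qe_ne (t : ℂ) : om * Complex.exp (-t) ≠ 0 := mul_ne_zero om_ne (Complex.exp_ne_zero _)
lemma qe_lt (t : ℂ) (ht : 0 < t.re) : ‖om * Complex.exp (-t)‖ < 1 := by
  rw [q_norm, Real.exp_lt_one_iff]; linarith

lemma Lt_pos (t : ℂ) (m : ℕ) : t * Lt (om * Complex.exp (-t)) om (3 * (m:ℤ) + 1) = -(-1) ^ m * kk t (3 * m + 1) := by
  unfold Lt kk
  rw [if_neg (by omega), q_zpow, q_zpow]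
  have e1 : om ^ (2 * (3 * (m:ℤ) + 1) ^ 2 + (3 * (m:ℤ) + 1)) = 1 := by
    rw [om_zpow_mod _ 0 (by ring_nf; omega), zpow_zero]
  have e2 : om * (om ^ (2 * (3 * (m:ℤ) + 1)) * Complex.exp (-(((2 * (3 * (m:ℤ) + 1) : ℤ) : ℂ) * t))) = Complex.exp (-(((2 * (3 * (m:ℤ) + 1) : ℤ) : ℂ) * t)) := by
    rw [← mul_assoc, ← zpow_one_add₀ om_ne, om_zpow_mod _ 0 (by omega), zpow_zero, one_mul]
  have e3 : (-1 : ℂ) ^ (3 * (m:ℤ) + 1) = -(-1) ^ m := by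
    rw [zpow_add₀ (by norm_num), zpow_mul]; norm_num
  rw [e1, e2, e3, one_mul]
  push_cast
  rw [show -((2 * (3 * (m:ℂ) + 1) ^ 2 + (3 * m + 1)) * t) = -t * (2 * (3 * m + 1) ^ 2 + (3 * m + 1)) by ring]
  ring

lemma Lt_neg (t : ℂ) (m : ℕ) : t * Lt (om * Complex.exp (-t)) om (3 * (-((m:ℤ) + 1)) + 1) = -(-1) ^ m * kk t (3 * m + 2) := by
  unfold Lt kk
  rw [if_neg (by omega), q_zpow, q_zpow]
  have e1 : om ^ (2 * (3 * (-((m:ℤ) + 1)) + 1) ^ 2 + (3 * (-((m:ℤ) + 1)) + 1)) = 1 := by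
    rw [om_zpow_mod _ 0 (by ring_nf; omega), zpow_zero]
  have e2 : om * (om ^ (2 * (3 * (-((m:ℤ) + 1)) + 1)) * Complex.exp (-(((2 * (3 * (-((m:ℤ) + 1)) + 1) : ℤ) : ℂ) * t))) = Complex.exp (-(((2 * (3 * (-((m:ℤ) + 1)) + 1) : ℤ) : ℂ) * t)) := by
    rw [← mul_assoc, ← zpow_one_add₀ om_ne, om_zpow_mod _ 0 (by omega), zpow_zero, one_mul]
  have e3 : (-1 : ℂ) ^ (3 * (-((m:ℤ) + 1)) + 1) = (-1) ^ m := by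
    rw [show (3 * (-((m:ℤ) + 1)) + 1) = -2 + 3 * (-(m:ℤ)) by ring, zpow_add₀ (by norm_num), zpow_mul]
    rw [show (-1:ℂ) ^ (-2:ℤ) = 1 by norm_num, show (-1:ℂ) ^ (3:ℤ) = -1 by norm_num, zpow_neg, ← inv_zpow, inv_neg, inv_one, one_mul, zpow_natCast]
  rw [e1, e2, e3, one_mul]
  push_cast
  have k1 : Complex.exp (-(2 * (3 * (-((m:ℂ) + 1)) + 1) * t)) = (Complex.exp (-(2 * (3 * m + 2) * t)))⁻¹ := by
    rw [← Complex.exp_neg]; congr 1; ring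
  have k2 : Complex.exp (-t * (2 * (3 * (m:ℂ) + 2) ^ 2 + (3 * m + 2))) = Complex.exp (-((2 * (3 * (-((m:ℂ) + 1)) + 1) ^ 2 + (3 * (-((m:ℂ) + 1)) + 1)) * t)) * Complex.exp (-(2 * (3 * m + 2) * t)) := by
    rw [← Complex.exp_add]; congr 1; ring
  rw [k1, k2]
  have hv := Complex.exp_ne_zero (-(2 * (3 * (m:ℂ) + 2) * t))
  generalize Complex.exp (-(2 * (3 * (m:ℂ) + 2) * t)) = v at hv ⊢
  generalize Complex.exp (-((2 * (3 * (-((m:ℂ) + 1)) + 1) ^ 2 + (3 * (-((m:ℂ) + 1)) + 1)) * t)) = E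
  rw [show 1 - v⁻¹ = -((1 - v) / v) by field_simp; ring]
  by_cases h : 1 - v = 0
  · rw [h]; simp
  · field_simp

lemma tsum_main (t : ℂ) (ht : t ∈ Sec) :
    ∑' n : ℤ, (if n % 3 = 1 then t * Lt (om * Complex.exp (-t)) om n else 0) =
      -∑' j : ℕ, ((kk t (6 * j + 1) - kk t (6 * j + 4)) + (kk t (6 * j + 2) - kk t (6 * j + 5))) := by
  have hS := (Lt_summable_unit _ (qe_ne t) (qe_lt t ht.1) om om_norm).mul_left t
  set F := fun n : ℤ => t * Lt (om * Complex.exp (-t)) om n with hF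
  have hinj : Function.Injective (fun m : ℤ => 3 * m + 1) := by intro a b h; simpa using h
  have h1 : ∑' m : ℤ, F (3 * m + 1) = ∑' n : ℤ, (if n % 3 = 1 then t * Lt (om * Complex.exp (-t)) om n else 0) := by
    rw [← hinj.tsum_eq (f := fun n : ℤ => if n % 3 = 1 then t * Lt (om * Complex.exp (-t)) om n else 0)]
    · apply tsum_congr; intro m
      rw [if_pos (by omega)]
    · intro n hn
      rw [Function.mem_support] at hn
      by_cases h : n % 3 = 1
      · exact ⟨n / 3, by simp only; omega⟩
      · rw [if_neg h] at hn; exact absurd rfl hn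
  have hS1 : Summable (fun m : ℤ => F (3 * m + 1)) := hS.comp_injective hinj
  have hA : Summable (fun m : ℕ => -(-1 : ℂ) ^ m * kk t (3 * m + 1)) := by
    have := hS1.comp_injective (Nat.cast_injective (R := ℤ))
    refine this.congr ?_
    intro m; exact Lt_pos t m
  have hB : Summable (fun m : ℕ => -(-1 : ℂ) ^ m * kk t (3 * m + 2)) := by
    have := hS1.comp_injective (i := fun m : ℕ => -((m:ℤ) + 1)) (by intro a b h; simpa using h)
    refine this.congr ?_
    intro m; exact Lt_neg t m
  have h2 : ∑' m : ℤ, F (3 * m + 1) = (∑' m : ℕ, -(-1 : ℂ) ^ m * kk t (3 * m + 1)) + ∑' m : ℕ, -(-1 : ℂ) ^ m * kk t (3 * m + 2) := by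
    apply HasSum.tsum_eq
    apply HasSum.of_nat_of_neg_add_one
    · have : (fun m : ℕ => F (3 * (m:ℤ) + 1)) = fun m : ℕ => -(-1 : ℂ) ^ m * kk t (3 * m + 1) := funext fun m => Lt_pos t m
      rw [this]; exact hA.hasSum
    · have : (fun m : ℕ => F (3 * (-((m:ℤ) + 1)) + 1)) = fun m : ℕ => -(-1 : ℂ) ^ m * kk t (3 * m + 2) := funext fun m => Lt_neg t m
      rw [this]; exact hB.hasSum
  rw [← h1, h2, ← hA.tsum_add hB]
  have hAB := hA.add hB
  generalize hG : (fun m : ℕ => -(-1 : ℂ) ^ m * kk t (3 * m + 1) + -(-1 : ℂ) ^ m * kk t (3 * m + 2)) = G at hAB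
  have hGm : ∀ m, -(-1 : ℂ) ^ m * kk t (3 * m + 1) + -(-1 : ℂ) ^ m * kk t (3 * m + 2) = G m := fun m => congrFun hG m
  have s1 : Summable (fun k : ℕ => G (2 * k)) := hAB.comp_injective (by intro a b h; simpa using h)
  have s2 : Summable (fun k : ℕ => G (2 * k + 1)) := hAB.comp_injective (by intro a b h; simpa using h)
  rw [← tsum_even_add_odd s1 s2, ← s1.tsum_add s2, ← tsum_neg]
  apply tsum_congr
  intro j
  rw [← hGm, ← hGm, show 3 * (2 * j) + 1 = 6 * j + 1 by ring, show 3 * (2 * j) + 2 = 6 * j + 2 by ring,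
   show 3 * (2 * j + 1) + 1 = 6 * j + 4 by ring, show 3 * (2 * j + 1) + 2 = 6 * j + 5 by ring, pow_succ, pow_mul,
   neg_one_sq, one_pow]
  ring

lemma main_lim : Tendsto (fun t : ℂ => ∑' n : ℤ, (if n % 3 = 1 then t * Lt (om * Complex.exp (-t)) om n else 0)) (𝓝[Sec] 0)
    (𝓝 (-(Real.pi / (3 * Real.sqrt 3) : ℝ))) := by
  have hb : Summable (fun j : ℕ => 378 * (1 / ((j + 1 : ℕ) : ℝ) ^ 2)) :=
      ((summable_nat_add_iff 1 (f := fun j : ℕ => 1 / (j : ℝ) ^ 2)).mpr (Real.summable_one_div_nat_pow.mpr (by norm_num))).mul_left _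
  have h : Tendsto (fun t : ℂ => ∑' j : ℕ, ((kk t (6 * j + 1) - kk t (6 * j + 4)) + (kk t (6 * j + 2) - kk t (6 * j + 5)))) (𝓝[Sec] 0) (𝓝 (Real.pi / (3 * Real.sqrt 3) : ℝ)) := by
    rw [← sum_lim.tsum_eq]
    refine tendsto_tsum_of_dominated_convergence hb ?_ ?_
    · intro j
      exact ((kk_tendsto _ (by omega)).sub (kk_tendsto _ (by omega))).add ((kk_tendsto _ (by omega)).sub (kk_tendsto _ (by omega)))
    · filter_upwards [self_mem_nhdsWithin] with t ht j
      have a1 := kk_diff t ht (6 * j + 1) (by omega)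
      have a2 := kk_diff t ht (6 * j + 2) (by omega)
      have b1 : (189:ℝ) / ((6 * j + 1 : ℕ) : ℝ) ^ 2 ≤ 189 * (1 / ((j + 1 : ℕ) : ℝ) ^ 2) := by
        rw [mul_one_div]
        gcongr; omega
      have b2 : (189:ℝ) / ((6 * j + 2 : ℕ) : ℝ) ^ 2 ≤ 189 * (1 / ((j + 1 : ℕ) : ℝ) ^ 2) := by
        rw [mul_one_div]
        gcongr <;> omega
      refine (norm_add_le _ _).trans ?_
      have := add_le_add a1 a2
      linarith
  refine h.neg.congr' ?_
  filter_upwards [self_mem_nhdsWithin] with t ht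
  rw [tsum_main t ht]

lemma other_lim : Tendsto (fun t : ℂ => ∑' n : ℤ, (if n % 3 = 1 then 0 else t * Lt (om * Complex.exp (-t)) om n)) (𝓝[Sec] 0) (𝓝 0) := by
  have hb : Summable (fun n : ℤ => 6 * (1 / (n : ℝ) ^ 2)) :=
    (Real.summable_one_div_int_pow.mpr (by norm_num)).mul_left _
  have hz : (∑' n : ℤ, (0:ℂ)) = 0 := by simp
  suffices Tendsto (fun t : ℂ => ∑' n : ℤ, (if n % 3 = 1 then 0 else t * Lt (om * Complex.exp (-t)) om n)) (𝓝[Sec] 0) (𝓝 (∑' n : ℤ, (0:ℂ))) by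
    rwa [hz] at this
  refine tendsto_tsum_of_dominated_convergence hb ?_ ?_
  · intro n
    have hg : Tendsto (fun t : ℂ => ‖t‖ * 3) (𝓝[Sec] 0) (𝓝 0) := by
      have : Continuous (fun t : ℂ => ‖t‖ * 3) := by fun_prop
      simpa using (this.tendsto 0).mono_left (nhdsWithin_le_nhds (s := Sec))
    refine squeeze_zero_norm' ?_ hg
    filter_upwards [self_mem_nhdsWithin] with t ht
    split_ifs with h
    · rw [norm_zero]; positivity
    · by_cases h0 : n = 0
      · simp [Lt, h0]
      · rw [norm_mul]
        gcongr
        refine (Lt_other t ht n h0 h).trans ?_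
        have : Real.exp (-(t.re * n ^ 2)) ≤ 1 := Real.exp_le_one_iff.mpr (by have := ht.1; have : 0 ≤ t.re * (n:ℝ)^2 := by positivity
                                                                             linarith)
        linarith
  · filter_upwards [self_mem_nhdsWithin] with t ht n
    split_ifs with h
    · rw [norm_zero]; positivity
    · by_cases h0 : n = 0
      · simp [Lt, h0]
      · rw [norm_mul]
        have hnp : (0:ℝ) < (n:ℝ)^2 := by positivity
        have h1 := sec_norm t ht
        have h2 := Lt_other t ht n h0 h
        have h3 := x_exp_le (t.re * n ^ 2)
        have := ht.1
        calc _ ≤ (2 * t.re) * (3 * Real.exp (-(t.re * n ^ 2))) := by gcongr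
          _ ≤ _ := by
            rw [mul_one_div, le_div_iff₀ hnp]
            linarith

lemma Lf_lim : Tendsto (fun t : ℂ => t * Lf (om * Complex.exp (-t)) om) (𝓝[Sec] 0) (𝓝 (-(1 - om) * (Real.pi / (3 * Real.sqrt 3) : ℝ))) := by
  have h0 : Tendsto (fun t : ℂ => t) (𝓝[Sec] 0) (𝓝 0) := nhdsWithin_le_nhds
  have h := h0.add ((main_lim.add other_lim).const_mul (1 - om))
  have e : 0 + (1 - om) * (-(Real.pi / (3 * Real.sqrt 3) : ℝ) + 0) = -(1 - om) * (Real.pi / (3 * Real.sqrt 3) : ℝ) := by ring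
  rw [e] at h
  refine h.congr' ?_
  filter_upwards [self_mem_nhdsWithin] with t ht
  have hS := (Lt_summable_unit _ (qe_ne t) (qe_lt t ht.1) om om_norm).mul_left t
  have hA : Summable (fun n : ℤ => if n % 3 = 1 then t * Lt (om * Complex.exp (-t)) om n else 0) := by
    refine Summable.of_norm_bounded hS.norm ?_
    intro n; split_ifs
    · exact le_rfl
    · rw [norm_zero]; exact norm_nonneg _
  have hB : Summable (fun n : ℤ => if n % 3 = 1 then 0 else t * Lt (om * Complex.exp (-t)) om n) := by
    refine Summable.of_norm_bounded hS.norm ?_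
    intro n; split_ifs
    · rw [norm_zero]; exact norm_nonneg _
    · exact le_rfl
  rw [← hA.tsum_add hB]
  unfold Lf
  have : ∑' n : ℤ, ((if n % 3 = 1 then t * Lt (om * Complex.exp (-t)) om n else 0) + (if n % 3 = 1 then 0 else t * Lt (om * Complex.exp (-t)) om n)) = t * ∑' n : ℤ, Lt (om * Complex.exp (-t)) om n := by
    rw [← tsum_mul_left]
    apply tsum_congr; intro n; split_ifs <;> simp
  rw [this]; ring
end M2

namespace M2
open Filter Topology

lemma tsum_mod3 (f : ℤ → ℂ) (hf : Summable f) :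
    ∑' n, f n = ∑' m : ℤ, f (3 * m + 0) + ∑' m : ℤ, f (3 * m + 1) + ∑' m : ℤ, f (3 * m + 2) := by
  have hS : ∀ a : ℤ, Summable (fun n : ℤ => if n % 3 = a then f n else 0) := by
    intro a
    refine Summable.of_norm_bounded hf.norm ?_
    intro n; split_ifs
    · exact le_rfl
    · rw [norm_zero]; exact norm_nonneg _
  have key : ∀ a : ℤ, 0 ≤ a → a < 3 → ∑' m : ℤ, f (3 * m + a) = ∑' n : ℤ, if n % 3 = a then f n else 0 := by
    intro a h0 h3
    have hinj : Function.Injective (fun m : ℤ => 3 * m + a) := by intro x y h; simpa using h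
    rw [← hinj.tsum_eq (f := fun n : ℤ => if n % 3 = a then f n else 0)]
    · apply tsum_congr; intro m
      rw [if_pos (by omega)]
    · intro n hn
      rw [Function.mem_support] at hn
      by_cases h : n % 3 = a
      · exact ⟨n / 3, by simp only; omega⟩
      · rw [if_neg h] at hn; exact absurd rfl hn
  rw [key 0 (by norm_num) (by norm_num), key 1 (by norm_num) (by norm_num), key 2 (by norm_num) (by norm_num),
    ← (hS 0).tsum_add (hS 1), ← ((hS 0).add (hS 1)).tsum_add (hS 2)]
  apply tsum_congr
  intro n
  have : n % 3 = 0 ∨ n % 3 = 1 ∨ n % 3 = 2 := by omega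
  rcases this with h | h | h <;> simp [h]

noncomputable def Wt (t : ℂ) : ℂ := (18 * t / Real.pi) ^ (1 / 2 : ℂ)
noncomputable def Cc : ℝ := Real.pi ^ 2 / 72

lemma sec_ne (t : ℂ) (ht : 0 < t.re) : t ≠ 0 := by rintro rfl; simp at ht

lemma Wt_ne (t : ℂ) (ht : 0 < t.re) : Wt t ≠ 0 := by
  unfold Wt
  rw [Complex.cpow_ne_zero_iff]
  left
  have := sec_ne t ht
  have := Real.pi_pos.ne'
  have h3 : (Real.pi : ℂ) ≠ 0 := by exact_mod_cast this
  exact div_ne_zero (mul_ne_zero (by norm_num) (sec_ne t ht)) h3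

noncomputable def SB (B : ℝ) (t : ℂ) : ℂ := ∑' m : ℤ, (-1 : ℂ) ^ m * Complex.exp (-t * (18 * m ^ 2 + B * m))

lemma SB_FE (B : ℝ) (t : ℂ) (ht : 0 < t.re) :
    SB B t * Wt t * Complex.exp (Cc / t) = Complex.exp (t * B ^ 2 / 72) *
      ∑' k : ℤ, Complex.exp (-(Real.pi ^ 2 / 18 / t) * (k ^ 2 - k)) * Complex.exp (Real.pi * B * (k - 1/2) / 18 * Complex.I) := by
  have hp : (Real.pi : ℂ) ≠ 0 := by exact_mod_cast Real.pi_pos.ne'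
  have ht0 := sec_ne t ht
  have ha : 0 < (18 * t / Real.pi : ℂ).re := by
    rw [show (18 * t / Real.pi : ℂ) = ((18 / Real.pi : ℝ) : ℂ) * t by push_cast; field_simp, Complex.re_ofReal_mul]
    have := Real.pi_pos
    positivity
  have h := Complex.tsum_exp_neg_quadratic ha (Complex.I / 2 - t * B / (2 * Real.pi))
  have e1 : SB B t = ∑' n : ℤ, Complex.exp (-Real.pi * (18 * t / Real.pi) * (n : ℂ) ^ 2 + 2 * Real.pi * (Complex.I / 2 - t * B / (2 * Real.pi)) * (n : ℂ)) := by
    unfold SB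
    apply tsum_congr
    intro m
    rw [← Complex.exp_pi_mul_I, ← Complex.exp_int_mul, ← Complex.exp_add]
    congr 1
    field_simp
    ring
  rw [e1, h]
  have hW : (18 * t / Real.pi) ^ (1 / 2 : ℂ) = Wt t := rfl
  rw [hW]
  have hW0 := Wt_ne t ht
  rw [show ∀ S : ℂ, 1 / Wt t * S * Wt t * Complex.exp (Cc / t) = S * Complex.exp (Cc / t) by intro S; field_simp]
  rw [← tsum_mul_right, ← tsum_mul_left]
  apply tsum_congr
  intro k
  rw [← Complex.exp_add, ← Complex.exp_add, ← Complex.exp_add]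
  congr 1
  unfold Cc
  push_cast
  field_simp
  ring_nf
  rw [show Complex.I ^ 4 = 1 by rw [show (4:ℕ) = 2 * 2 by rfl, pow_mul, Complex.I_sq]; norm_num, Complex.I_sq, show Complex.I ^ 3 = -Complex.I by rw [pow_succ, Complex.I_sq]; ring]
  ring

lemma sec_inv (t : ℂ) (ht : t ∈ Sec) : 1 / (2 * t.re) ≤ (t⁻¹).re := by
  have hs := ht.1
  rw [Complex.inv_re, div_le_div_iff₀ (by positivity) (Complex.normSq_pos.mpr (sec_ne t hs)), Complex.normSq_apply]
  have : t.im ^ 2 ≤ t.re ^ 2 := by rw [← sq_abs t.im]; exact pow_le_pow_left₀ (abs_nonneg _) ht.2 2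
  nlinarith

lemma re_small : Tendsto (fun t : ℂ => t.re) (𝓝[Sec] 0) (𝓝[>] 0) := by
  rw [tendsto_nhdsWithin_iff]
  constructor
  · simpa using (Complex.continuous_re.tendsto 0).mono_left (nhdsWithin_le_nhds (s := Sec))
  · filter_upwards [self_mem_nhdsWithin] with t ht using ht.1

lemma expC_norm (t : ℂ) (c : ℝ) : ‖Complex.exp (-(c / t))‖ = Real.exp (-(c * (t⁻¹).re)) := by
  rw [Complex.norm_exp, Complex.neg_re, div_eq_mul_inv, Complex.re_ofReal_mul]

lemma SB_lim (B : ℝ) : Tendsto (fun t => SB B t * Wt t * Complex.exp (Cc / t)) (𝓝[Sec] 0) (𝓝 ((2 * Real.cos (Real.pi * B / 36) : ℝ))) := by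
  have hp := Real.pi_pos
  have h1 : Tendsto (fun t : ℂ => Complex.exp (t * B ^ 2 / 72)) (𝓝[Sec] 0) (𝓝 1) := by
    have : Continuous (fun t : ℂ => Complex.exp (t * B ^ 2 / 72)) := by fun_prop
    simpa using (this.tendsto 0).mono_left (nhdsWithin_le_nhds (s := Sec))
  set g : ℤ → ℂ := fun k => if k = 0 ∨ k = 1 then Complex.exp (Real.pi * B * (k - 1/2) / 18 * Complex.I) else 0 with hg
  have hgs : ∑' k, g k = ((2 * Real.cos (Real.pi * B / 36) : ℝ) : ℂ) := by
    rw [tsum_eq_sum (s := {0, 1})]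
    · rw [Finset.sum_pair (by norm_num)]
      simp only [hg, true_or, or_true, if_true]
      push_cast
      rw [Complex.two_cos]
      rw [add_comm]
      congr 2 <;> ring
    · intro k hk
      simp only [Finset.mem_insert, Finset.mem_singleton] at hk
      simp [hg, hk]
  have hnn : ∀ k : ℤ, 0 ≤ k ^ 2 - k := fun k => by
    rcases le_or_gt k 0 with h | h <;> nlinarith
  have nterm : ∀ (t : ℂ) (k : ℤ), ‖Complex.exp (-(Real.pi ^ 2 / 18 / t) * (k ^ 2 - k)) * Complex.exp (Real.pi * B * (k - 1/2) / 18 * Complex.I)‖ = Real.exp (-(Real.pi ^ 2 / 18 * (k ^ 2 - k) * (t⁻¹).re)) := by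
    intro t k
    rw [norm_mul, show (Real.pi * B * ((k:ℂ) - 1/2) / 18 * Complex.I) = ((Real.pi * B * (k - 1/2) / 18 : ℝ) : ℂ) * Complex.I by push_cast; ring, Complex.norm_exp_ofReal_mul_I, mul_one]
    rw [show -(Real.pi ^ 2 / 18 / t : ℂ) * ((k:ℂ) ^ 2 - k) = -(((Real.pi ^ 2 / 18 * (k ^ 2 - k) : ℝ) : ℂ) / t) by push_cast; ring, expC_norm]
  have h2 : Tendsto (fun t : ℂ => ∑' k : ℤ, Complex.exp (-(Real.pi ^ 2 / 18 / t) * (k ^ 2 - k)) * Complex.exp (Real.pi * B * (k - 1/2) / 18 * Complex.I)) (𝓝[Sec] 0) (𝓝 (∑' k, g k)) := by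
    have hb := summable_zpow_quad (Real.exp (-(Real.pi ^ 2 / 36))) (Real.exp_pos _) (by rw [Real.exp_lt_one_iff]; have := sq_pos_of_pos hp; linarith) 1 (-1) (by norm_num)
    refine tendsto_tsum_of_dominated_convergence hb ?_ ?_
    · intro k
      by_cases hk : k = 0 ∨ k = 1
      · have e : (k:ℂ) ^ 2 - k = 0 := by rcases hk with rfl | rfl <;> simp
        simp only [hg, if_pos hk, e, mul_zero, Complex.exp_zero, one_mul]
        exact tendsto_const_nhds
      · simp only [hg, if_neg hk]
        rw [tendsto_zero_iff_norm_tendsto_zero]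
        simp_rw [nterm]
        have hk2 : (1:ℝ) ≤ (k:ℝ) ^ 2 - k := by
          have : 1 ≤ k ^ 2 - k := by
            push Not at hk
            rcases lt_or_gt_of_ne hk.1 with h | h
            · nlinarith
            · have : 2 ≤ k := by omega
              nlinarith
          exact_mod_cast this
        apply Real.tendsto_exp_neg_atTop_nhds_zero.comp
        have hinv : Tendsto (fun t : ℂ => (Real.pi ^ 2 / 36) * (t.re)⁻¹) (𝓝[Sec] 0) atTop :=
          (tendsto_inv_nhdsGT_zero.comp re_small).const_mul_atTop (by positivity)
        refine tendsto_atTop_mono' _ ?_ hinv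
        filter_upwards [self_mem_nhdsWithin] with t ht
        have := sec_inv t ht
        have hs := ht.1
        calc Real.pi ^ 2 / 36 * (t.re)⁻¹ = Real.pi ^ 2 / 18 * 1 * (1 / (2 * t.re)) := by field_simp; norm_num
          _ ≤ _ := by gcongr
    · have h1 : ∀ᶠ t in 𝓝[Sec] (0:ℂ), t.re < 1 := by
        have := re_small.mono_right nhdsWithin_le_nhds
        exact this.eventually (gt_mem_nhds one_pos)
      filter_upwards [self_mem_nhdsWithin, h1] with t ht ht1 k
      rw [nterm, ← Real.rpow_intCast, ← Real.exp_mul]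
      apply Real.exp_le_exp.mpr
      have h0 : (0:ℝ) ≤ (k:ℝ) ^ 2 - k := by exact_mod_cast hnn k
      have := sec_inv t ht
      have hs := ht.1
      have h3 : (1:ℝ)/2 ≤ (t⁻¹).re := by
        refine le_trans ?_ this
        apply one_div_le_one_div_of_le (by positivity); linarith
      have : Real.pi ^ 2 / 18 * ((k:ℝ) ^ 2 - k) * (1/2) ≤ Real.pi ^ 2 / 18 * (k ^ 2 - k) * (t⁻¹).re := by gcongr
      push_cast
      linarith
  have h3 := h1.mul h2
  rw [one_mul, hgs] at h3
  refine h3.congr' ?_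
  filter_upwards [self_mem_nhdsWithin] with t ht
  rw [SB_FE B t ht.1]

lemma thS_split (t : ℂ) (ht : 0 < t.re) : thS (om * Complex.exp (-t)) =
    SB 3 t - Complex.exp (-t * 3) * SB 15 t + om * Complex.exp (-t * 10) * SB 27 t := by
  unfold thS
  rw [tsum_mod3 _ (thS_hasSum _ (qe_ne t) (qe_lt t ht)).summable, sub_eq_add_neg, ← neg_mul]
  unfold SB
  congr 1
  · congr 1
    · apply tsum_congr; intro m
      rw [q_zpow, om_zpow_mod _ 0 (by ring_nf; omega), zpow_zero, one_mul]
      have : (-1:ℂ) ^ (3 * m + 0) = (-1) ^ m := by rw [add_zero, zpow_mul]; norm_num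
      rw [this]
      congr 2; push_cast; ring
    · rw [← tsum_mul_left]
      apply tsum_congr; intro m
      rw [q_zpow, om_zpow_mod _ 0 (by ring_nf; omega), zpow_zero, one_mul]
      have : (-1:ℂ) ^ (3 * m + 1) = -(-1) ^ m := by rw [zpow_add₀ (by norm_num), zpow_mul]; norm_num
      rw [this, show -Complex.exp (-t * 3) * ((-1) ^ m * Complex.exp (-t * (18 * (m:ℂ) ^ 2 + ((15:ℝ):ℂ) * m))) = -(-1) ^ m * (Complex.exp (-t * 3) * Complex.exp (-t * (18 * (m:ℂ) ^ 2 + ((15:ℝ):ℂ) * m))) by ring, ← Complex.exp_add]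
      congr 2; push_cast; ring
  · rw [← tsum_mul_left]
    apply tsum_congr; intro m
    rw [q_zpow, om_zpow_mod _ 1 (by ring_nf; omega), zpow_one]
    have : (-1:ℂ) ^ (3 * m + 2) = (-1) ^ m := by rw [zpow_add₀ (by norm_num), zpow_mul]; norm_num
    rw [this, show om * Complex.exp (-t * 10) * ((-1) ^ m * Complex.exp (-t * (18 * (m:ℂ) ^ 2 + ((27:ℝ):ℂ) * m))) = (-1) ^ m * (om * (Complex.exp (-t * 10) * Complex.exp (-t * (18 * (m:ℂ) ^ 2 + ((27:ℝ):ℂ) * m)))) by ring, ← Complex.exp_add]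
    congr 3; push_cast; ring

lemma thS_lim : Tendsto (fun t => thS (om * Complex.exp (-t)) * Wt t * Complex.exp (Cc / t)) (𝓝[Sec] 0) (𝓝 ((Real.sqrt 2 : ℝ) * (1 - om))) := by
  have he : ∀ c : ℂ, Tendsto (fun t : ℂ => Complex.exp (-t * c)) (𝓝[Sec] 0) (𝓝 1) := by
    intro c
    have : Continuous (fun t : ℂ => Complex.exp (-t * c)) := by fun_prop
    simpa using (this.tendsto 0).mono_left (nhdsWithin_le_nhds (s := Sec))
  have h := ((SB_lim 3).sub ((he 3).mul (SB_lim 15))).add (((he 10).const_mul om).mul (SB_lim 27))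
  have e : ((2 * Real.cos (Real.pi * 3 / 36) : ℝ) : ℂ) - 1 * ((2 * Real.cos (Real.pi * 15 / 36) : ℝ) : ℂ) + om * 1 * ((2 * Real.cos (Real.pi * 27 / 36) : ℝ) : ℂ) = (Real.sqrt 2 : ℝ) * (1 - om) := by
    have c1 : Real.cos (Real.pi * 27 / 36) = -(Real.sqrt 2 / 2) := by
      rw [show Real.pi * 27 / 36 = Real.pi - Real.pi / 4 by ring, Real.cos_pi_sub, Real.cos_pi_div_four]
    have c2 : Real.cos (Real.pi * 3 / 36) - Real.cos (Real.pi * 15 / 36) = Real.sqrt 2 / 2 := by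
      rw [Real.cos_sub_cos, show (Real.pi * 3 / 36 + Real.pi * 15 / 36) / 2 = Real.pi / 4 by ring,
       show (Real.pi * 3 / 36 - Real.pi * 15 / 36) / 2 = -(Real.pi / 6) by ring, Real.sin_neg, Real.sin_pi_div_four, Real.sin_pi_div_six]
      ring
    have c3 : ((Real.cos (Real.pi * 3 / 36) : ℝ) : ℂ) - (Real.cos (Real.pi * 15 / 36) : ℝ) = (Real.sqrt 2 / 2 : ℝ) := by exact_mod_cast c2
    rw [c1]
    rw [Complex.ofReal_mul, Complex.ofReal_mul, Complex.ofReal_mul]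
    push_cast at c3 ⊢
    linear_combination 2 * c3
  rw [e] at h
  refine h.congr' ?_
  filter_upwards [self_mem_nhdsWithin] with t ht
  rw [thS_split t ht.1]
  ring

lemma one_sub_om_ne : (1:ℂ) - om ≠ 0 := by
  intro h
  have := om_sum
  have h1 : om = 1 := by linear_combination -h
  rw [h1] at this; norm_num at this

theorem Rb_lim : Tendsto (fun t : ℂ => t * Rb (om * Complex.exp (-t)) om / Wt t * Complex.exp (-(Cc / t))) (𝓝[Sec] 0) (𝓝 ((-(Real.pi / (3 * Real.sqrt 6)) : ℝ))) := by
  have h2 : ((Real.sqrt 2 : ℝ) : ℂ) ≠ 0 := by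
    have : Real.sqrt 2 ≠ 0 := by positivity
    exact_mod_cast this
  have h := Lf_lim.div thS_lim (mul_ne_zero h2 one_sub_om_ne)
  have e : -(1 - om) * ((Real.pi / (3 * Real.sqrt 3) : ℝ) : ℂ) / (((Real.sqrt 2 : ℝ) : ℂ) * (1 - om)) = ((-(Real.pi / (3 * Real.sqrt 6)) : ℝ) : ℂ) := by
    have h6 : Real.sqrt 6 = Real.sqrt 2 * Real.sqrt 3 := by rw [← Real.sqrt_mul (by norm_num)]; norm_num
    have := one_sub_om_ne
    have h3 : ((Real.sqrt 3 : ℝ) : ℂ) ≠ 0 := by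
      have : Real.sqrt 3 ≠ 0 := by positivity
      exact_mod_cast this
    rw [h6]
    push_cast
    field_simp
  rw [e] at h
  refine h.congr' ?_
  filter_upwards [self_mem_nhdsWithin] with t ht
  have m1 := (main_id _ (qe_ne t) (qe_lt t ht.1) om om_norm).1
  have m2 := thS_exp _ (qe_ne t) (qe_lt t ht.1)
  have hW := Wt_ne t ht.1
  simp only [Pi.div_apply]
  rw [m1, Complex.exp_neg (Cc / t)]
  have hth : thS (om * Complex.exp (-t)) ≠ 0 := left_ne_zero_of_mul (by rw [m2]; exact one_ne_zero)
  have he := Complex.exp_ne_zero (Cc / t)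
  have : Complex.exp (Lam (om * Complex.exp (-t))) = (thS (om * Complex.exp (-t)))⁻¹ := eq_inv_of_mul_eq_one_right m2
  rw [this]
  generalize Complex.exp (Cc / t) = E at he ⊢
  field_simp
end M2

namespace M2
open Filter Topology

lemma re_lower (w : ℂ) (h0 : 0 ≤ w.re) (h3 : |w.im| ≤ 3 * w.re) :
    -1/2 ≤ (Complex.exp (-w) + Complex.exp (-w) ^ 2).re := by
  have e1 : (Complex.exp (-w)).re = Real.exp (-w.re) * Real.cos w.im := by
    rw [Complex.exp_re]; simp
  have e2 : (Complex.exp (-w)).im = - (Real.exp (-w.re) * Real.sin w.im) := by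
    rw [Complex.exp_im]; simp
  rw [Complex.add_re, sq, Complex.mul_re, e1, e2]
  set s := w.re
  set r := Real.exp (-s) with hr
  set c := Real.cos w.im with hc
  have hsc : Real.sin w.im ^ 2 = 1 - c ^ 2 := by rw [hc, Real.sin_sq]
  have hrp : 0 < r := Real.exp_pos _
  have hr1 : r ≤ 1 := Real.exp_le_one_iff.mpr (by linarith)
  have goal' : 0 ≤ 2 * r ^ 2 * c ^ 2 + r * c - r ^ 2 + 1/2 := by
    rcases lt_or_ge (r^2) (3/8) with h | h
    · nlinarith [sq_nonneg (4 * (r * c) + 1)]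
    have hr2 : r ^ 2 = Real.exp (-(2 * s)) := by rw [hr, sq, ← Real.exp_add]; ring_nf
    have hs2 : s < 1/2 := by
      by_contra hcon
      push Not at hcon
      have : r ^ 2 ≤ Real.exp (-1) := by rw [hr2]; apply Real.exp_le_exp.mpr; linarith
      have := Real.exp_neg_one_lt_d9
      linarith
    have hpi := Real.pi_gt_d2
    have hc0 : 0 ≤ c := by
      rw [hc, ← Real.cos_abs]
      apply Real.cos_nonneg_of_mem_Icc
      constructor <;> linarith [abs_nonneg w.im]
    rcases le_or_gt (r^2) (1/2) with h' | h'
    · have : 0 ≤ r * c := by positivity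
      have : 0 ≤ r ^ 2 * c ^ 2 := by positivity
      linarith
    have hs3 : s < 0.347 := by
      have : Real.log (1/2) < -(2 * s) := by
        rw [Real.log_lt_iff_lt_exp (by norm_num), ← hr2]; exact h'
      rw [one_div, Real.log_inv] at this
      have := Real.log_two_lt_d9
      linarith
    have hch : 1/2 ≤ c := by
      rw [hc, ← Real.cos_abs, ← Real.cos_pi_div_three]
      apply Real.cos_le_cos_of_nonneg_of_le_pi (abs_nonneg _) <;> linarith
    nlinarith [mul_pos hrp hrp, mul_nonneg hrp.le (sub_nonneg.mpr hch), mul_nonneg (mul_pos hrp hrp).le (mul_nonneg (sub_nonneg.mpr hch) (sub_nonneg.mpr hch)),  mul_nonneg (mul_pos hrp hrp).le (sub_nonneg.mpr hch)]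
  nlinarith

lemma D_lower (x : ℂ) (h : -1/2 ≤ (x + x ^ 2).re) : 1/2 ≤ ‖1 + x + x ^ 2‖ ∧ ‖x + x ^ 2‖ ≤ ‖1 + x + x ^ 2‖ := by
  constructor
  · have := Complex.re_le_norm (1 + x + x ^ 2)
    rw [add_assoc, Complex.add_re, Complex.one_re] at this
    rw [add_assoc]; linarith
  · rw [add_assoc]
    generalize x + x ^ 2 = y at h ⊢
    rw [Complex.norm_def, Complex.norm_def]
    apply Real.sqrt_le_sqrt
    rw [Complex.normSq_apply, Complex.normSq_apply]
    simp only [Complex.add_re, Complex.one_re, Complex.add_im, Complex.one_im]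
    nlinarith

noncomputable def Fq (q : ℂ) (j : ℕ) : ℂ :=
  q ^ (2 * j + 1) * (1 + q ^ (2 * j + 1)) / (1 + q ^ (2 * j + 2) + (q ^ (2 * j + 2)) ^ 2)

lemma Tt_eq (q : ℂ) (n : ℕ) : Tt q om n = ∏ j ∈ Finset.range n, Fq q j := by
  induction n with
  | zero => simp [Tt]
  | succ n ih =>
    rw [Finset.prod_range_succ, ← ih]
    unfold Tt Fq
    rw [Finset.prod_range_succ]
    have h : (1 - om * q ^ (2 * n + 2)) * (1 - q ^ (2 * n + 2) * om⁻¹) = 1 + q ^ (2 * n + 2) + (q ^ (2 * n + 2)) ^ 2 := by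
      have h1 : om⁻¹ = om ^ 2 := by
        exact inv_eq_of_mul_eq_one_right (by rw [← pow_succ', om_cube])
      have := om_sum
      rw [h1]
      linear_combination (-q ^ (2 * n + 2)) * om_sum + (q ^ (2 * n + 2)) ^ 2 * om_cube
    rw [h, show (n + 1) ^ 2 = n ^ 2 + (2 * n + 1) by ring, pow_add]
    ring

lemma Rb_bound (q : ℂ) (hq0 : q ≠ 0) (hq1 : ‖q‖ < 1) (ε : ℝ) (hε : 0 ≤ ε) (J : ℕ)
    (h1 : ∀ i, ‖Fq q (2 * i)‖ * ‖Fq q (2 * i + 1)‖ ≤ 1 + ε) (h2 : ∀ i, ‖Fq q (2 * i)‖ ≤ 24)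
    (h3 : ∀ j, J ≤ j → ‖Fq q j‖ ≤ 1/2) : ‖Rb q om‖ ≤ 24 * Real.exp (ε * J) * (J + 2) := by
  have p1 : ∀ m, ∏ j ∈ Finset.range (2 * m), ‖Fq q j‖ ≤ (1 + ε) ^ m := by
    intro m
    induction m with
    | zero => simp
    | succ m ih =>
      rw [show 2 * (m + 1) = 2 * m + 1 + 1 by ring, Finset.prod_range_succ, Finset.prod_range_succ, pow_succ, mul_assoc]
      exact mul_le_mul ih (h1 m) (by positivity) (by positivity)
  have p2 : ∀ n, n ≤ J → ‖Tt q om n‖ ≤ 24 * Real.exp (ε * J) := by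
    intro n hn
    have key : ∀ m, m ≤ J → (1 + ε) ^ m ≤ Real.exp (ε * J) := by
      intro m hm
      have : 1 + ε ≤ Real.exp ε := by linarith [Real.add_one_le_exp ε]
      calc (1 + ε) ^ m ≤ Real.exp ε ^ m := by gcongr
        _ = Real.exp (m * ε) := (Real.exp_nat_mul _ _).symm
        _ ≤ _ := by apply Real.exp_le_exp.mpr; rw [mul_comm]; gcongr
    rw [Tt_eq, norm_prod]
    have he := Real.exp_pos (ε * J)
    rcases Nat.even_or_odd' n with ⟨m, rfl | rfl⟩
    · have := (p1 m).trans (key m (by omega))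
      linarith
    · rw [Finset.prod_range_succ]
      calc _ ≤ Real.exp (ε * J) * 24 := mul_le_mul ((p1 m).trans (key m (by omega))) (h2 m) (by positivity) (by positivity)
        _ = _ := by ring
  have p3 : ∀ i, ‖Tt q om (i + J)‖ ≤ 24 * Real.exp (ε * J) * (1/2) ^ i := by
    intro i
    induction i with
    | zero => simpa using p2 J le_rfl
    | succ i ih =>
      rw [Tt_eq, show i + 1 + J = i + J + 1 by ring, Finset.prod_range_succ, ← Tt_eq, norm_mul, pow_succ, ← mul_assoc]
      exact mul_le_mul ih (h3 _ (by omega)) (norm_nonneg _) (by positivity)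
  have hg : HasSum (fun i : ℕ => 24 * Real.exp (ε * J) * (1/2 : ℝ) ^ i) (24 * Real.exp (ε * J) * 2) :=
    hasSum_geometric_two.mul_left _
  have hs' : Summable (fun i => Tt q om (i + J)) := Summable.of_norm_bounded hg.summable p3
  have hs : Summable (fun i => Tt q om i) := (summable_nat_add_iff J).mp hs'
  unfold Rb
  rw [← hs.sum_add_tsum_nat_add J]
  refine (norm_add_le _ _).trans ?_
  have a1 : ‖∑ i ∈ Finset.range J, Tt q om i‖ ≤ J * (24 * Real.exp (ε * J)) := by
    refine (norm_sum_le_of_le _ (fun i hi => p2 i (Finset.mem_range.mp hi).le)).trans ?_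
    simp
  have a2 : ‖∑' i, Tt q om (i + J)‖ ≤ 24 * Real.exp (ε * J) * 2 := tsum_of_norm_bounded hg p3
  linarith

lemma Fq_tail (q : ℂ) (j : ℕ) (hq : ‖q‖ < 1) (h : ‖q‖ ^ (2 * j + 1) ≤ 1/8) : ‖Fq q j‖ ≤ 1/2 := by
  unfold Fq
  rw [norm_div, norm_mul]
  have h0 : ‖q ^ (2 * j + 1)‖ ≤ 1/8 := by rwa [norm_pow]
  have h1 : ‖1 + q ^ (2 * j + 1)‖ ≤ 9/8 := by
    have := norm_add_le (1:ℂ) (q ^ (2 * j + 1))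
    rw [norm_one] at this; linarith
  have h2 : ‖q ^ (2 * j + 2)‖ ≤ 1/8 := by
    rw [norm_pow]; exact (pow_le_pow_of_le_one (norm_nonneg _) hq.le (by omega)).trans h
  have h3 : 1/2 ≤ ‖1 + q ^ (2 * j + 2) + (q ^ (2 * j + 2)) ^ 2‖ := by
    generalize q ^ (2 * j + 2) = u at h2 ⊢
    have a := norm_sub_norm_le (1:ℂ) (-(u + u ^ 2))
    rw [norm_neg, norm_one, sub_neg_eq_add, ← add_assoc] at a
    have b := norm_add_le u (u ^ 2)
    rw [norm_pow] at b
    nlinarith [norm_nonneg u]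
  rw [div_le_iff₀ (by linarith)]
  calc ‖q ^ (2 * j + 1)‖ * ‖1 + q ^ (2 * j + 1)‖ ≤ 1/8 * (9/8) := by gcongr
    _ ≤ _ := by linarith

lemma ratio_bound (N D N0 D0 : ℂ) (δ : ℝ) (hδ : 0 ≤ δ) (hδ1 : δ ≤ 1/4) (h1 : ‖N - N0‖ ≤ δ) (h2 : ‖D - D0‖ ≤ δ) (h3 : 1/2 ≤ ‖D0‖) (h4 : ‖N0‖ ≤ ‖D0‖) :
    ‖N‖ / ‖D‖ ≤ 1 + 8 * δ ∧ 1/4 ≤ ‖D‖ := by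
  have a1 : ‖N‖ ≤ ‖N0‖ + δ := by
    have := norm_add_le N0 (N - N0)
    rw [add_sub_cancel] at this; linarith
  have a2 : ‖D0‖ ≤ ‖D‖ + δ := by
    have := norm_add_le D (D0 - D)
    rw [add_sub_cancel, norm_sub_rev] at this; linarith
  have a3 : 1/4 ≤ ‖D‖ := by linarith
  refine ⟨?_, a3⟩
  rw [div_le_iff₀ (by linarith)]
  nlinarith

lemma q_one_factor (t : ℂ) (h0 : 0 < t.re) (h3 : |t.im| ≤ 3 * t.re) (ht : ‖t‖ ≤ 1/12) (j : ℕ) :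
    ‖Fq (Complex.exp (-t)) j‖ ≤ 1 + 24 * ‖t‖ := by
  unfold Fq
  rw [norm_div]
  have hu : Complex.exp (-t) ^ (2 * j + 2) = Complex.exp (-((2 * j + 2 : ℝ) * t)) := by
    rw [← Complex.exp_nat_mul]; congr 1; push_cast; ring
  have hre := re_lower (((2 * j + 2 : ℝ) : ℂ) * t) (by rw [Complex.re_ofReal_mul]; positivity) (by
    rw [Complex.re_ofReal_mul, Complex.im_ofReal_mul, abs_mul, abs_of_nonneg (by positivity)]
    have : (0:ℝ) ≤ 2 * j + 2 := by positivity
    nlinarith)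
  rw [← hu] at hre
  obtain ⟨d1, d2⟩ := D_lower _ hre
  have hq : ‖Complex.exp (-t)‖ ≤ 1 := by
    rw [Complex.norm_exp]; apply Real.exp_le_one_iff.mpr; simp; exact h0.le
  have h1q := norm_one_sub_exp t h0.le
  rw [show Complex.exp (-t) ^ (2 * j + 2) = Complex.exp (-t) ^ (2 * j + 1) * Complex.exp (-t) by rw [pow_succ]] at *
  have hv : ‖Complex.exp (-t) ^ (2 * j + 1)‖ ≤ 1 := by rw [norm_pow]; exact pow_le_one₀ (norm_nonneg _) hq
  generalize Complex.exp (-t) ^ (2 * j + 1) = v at *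
  generalize Complex.exp (-t) = q at *
  have := (ratio_bound (v * (1 + v)) (1 + v * q + (v * q) ^ 2) (v * q + (v * q) ^ 2) (1 + v * q + (v * q) ^ 2) (3 * ‖t‖) (by positivity) (by linarith) ?_ (by simp) d1 d2).1
  · linarith
  · rw [show v * (1 + v) - (v * q + (v * q) ^ 2) = v * (1 - q) * (1 + v + v * q) by ring, norm_mul, norm_mul]
    have h5 : ‖1 + v + v * q‖ ≤ 3 := by
      refine (norm_add₃_le).trans ?_
      rw [norm_one, norm_mul]
      nlinarith [norm_nonneg v, norm_nonneg q]
    calc _ ≤ 1 * ‖t‖ * 3 := by gcongr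
      _ = _ := by ring

lemma q_i_factor (ι : ℂ) (hι : ι ^ 2 = -1) (t : ℂ) (h0 : 0 < t.re) (h3 : |t.im| ≤ 3 * t.re) (ht : ‖t‖ ≤ 1/72) (i : ℕ) :
    ‖Fq (ι * Complex.exp (-t)) (2 * i)‖ * ‖Fq (ι * Complex.exp (-t)) (2 * i + 1)‖ ≤ 1 + 144 * ‖t‖ ∧ ‖Fq (ι * Complex.exp (-t)) (2 * i)‖ ≤ 24 := by
  have hιn : ‖ι‖ = 1 := by
    have := congrArg norm hι
    rw [norm_pow, norm_neg, norm_one] at this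
    exact (pow_eq_one_iff_of_nonneg (norm_nonneg _) (by norm_num)).mp this
  have hι4 : ι ^ 4 = 1 := by rw [show (4:ℕ) = 2 * 2 by rfl, pow_mul, hι]; norm_num
  have hX : (Complex.exp (-t) ^ (4 * i) * Complex.exp (-t) ^ 4) ^ 2 = Complex.exp (-((8 * i + 8 : ℝ) * t)) := by
    rw [← pow_add, ← pow_mul, ← Complex.exp_nat_mul]; congr 1; push_cast; ring
  have hre := re_lower (((8 * i + 8 : ℝ) : ℂ) * t) (by rw [Complex.re_ofReal_mul]; positivity) (by
    rw [Complex.re_ofReal_mul, Complex.im_ofReal_mul, abs_mul, abs_of_nonneg (by positivity)]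
    have : (0:ℝ) ≤ 8 * i + 8 := by positivity
    nlinarith)
  rw [← hX] at hre
  obtain ⟨d1, d2⟩ := D_lower _ hre
  have hq : ‖Complex.exp (-t)‖ ≤ 1 := by
    rw [Complex.norm_exp]; apply Real.exp_le_one_iff.mpr; simp; exact h0.le
  have h1q := norm_one_sub_exp t h0.le
  have e1 : (ι * Complex.exp (-t)) ^ (2 * (2 * i) + 1) = ι * (Complex.exp (-t) ^ (4 * i) * Complex.exp (-t)) := by
    rw [show 2 * (2 * i) + 1 = 4 * i + 1 by ring, mul_pow, pow_succ, pow_succ, pow_mul ι, hι4]; ring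
  have e2 : (ι * Complex.exp (-t)) ^ (2 * (2 * i) + 2) = -(Complex.exp (-t) ^ (4 * i) * Complex.exp (-t) ^ 2) := by
    rw [show 2 * (2 * i) + 2 = 4 * i + 2 by ring, mul_pow, pow_add, pow_add, pow_mul ι, hι4, hι]; ring
  have e3 : (ι * Complex.exp (-t)) ^ (2 * (2 * i + 1) + 1) = -ι * (Complex.exp (-t) ^ (4 * i) * Complex.exp (-t) ^ 3) := by
    rw [show 2 * (2 * i + 1) + 1 = 4 * i + 3 by ring, mul_pow, pow_add, pow_add, pow_mul ι, hι4, pow_succ ι 2, hι]; ring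
  have e4 : (ι * Complex.exp (-t)) ^ (2 * (2 * i + 1) + 2) = Complex.exp (-t) ^ (4 * i) * Complex.exp (-t) ^ 4 := by
    rw [show 2 * (2 * i + 1) + 2 = 4 * i + 4 by ring, mul_pow, pow_add, pow_add, pow_mul ι, hι4]; ring
  unfold Fq
  rw [e1, e2, e3, e4]
  have ha : ‖Complex.exp (-t) ^ (4 * i)‖ ≤ 1 := by rw [norm_pow]; exact pow_le_one₀ (norm_nonneg _) hq
  generalize Complex.exp (-t) ^ (4 * i) = a at *
  generalize Complex.exp (-t) = q at *
  have hqk : ∀ k, ‖q ^ k‖ ≤ 1 := fun k => by rw [norm_pow]; exact pow_le_one₀ (norm_nonneg _) hq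
  have hq2 : ‖1 - q ^ 2‖ ≤ 2 * ‖t‖ := by
    rw [show 1 - q ^ 2 = (1 - q) * (1 + q) by ring, norm_mul]
    have : ‖1 + q‖ ≤ 2 := (norm_add_le _ _).trans (by rw [norm_one]; linarith)
    calc _ ≤ ‖t‖ * 2 := by gcongr
      _ = _ := by ring
  have hq4 : ‖1 - q ^ 4‖ ≤ 4 * ‖t‖ := by
    rw [show 1 - q ^ 4 = (1 - q ^ 2) * (1 + q ^ 2) by ring, norm_mul]
    have : ‖1 + q ^ 2‖ ≤ 2 := (norm_add_le _ _).trans (by rw [norm_one]; linarith [hqk 2])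
    calc _ ≤ (2 * ‖t‖) * 2 := by gcongr
      _ = _ := by ring
  have hq8 : ‖1 - q ^ 8‖ ≤ 8 * ‖t‖ := by
    rw [show 1 - q ^ 8 = (1 - q ^ 4) * (1 + q ^ 4) by ring, norm_mul]
    have : ‖1 + q ^ 4‖ ≤ 2 := (norm_add_le _ _).trans (by rw [norm_one]; linarith [hqk 4])
    calc _ ≤ (4 * ‖t‖) * 2 := by gcongr
      _ = _ := by ring
  have hu1 : ∀ k, ‖a * q ^ k‖ ≤ 1 := fun k => by
    rw [norm_mul]; exact mul_le_one₀ ha (norm_nonneg _) (hqk k)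
  have b3 : ‖1 + a * q ^ 4 + (a * q ^ 4) ^ 2‖ ≤ 3 := by
    refine (norm_add₃_le).trans ?_
    rw [norm_one, norm_pow]
    have := hu1 4
    nlinarith [norm_nonneg (a * q ^ 4)]
  have hN : ‖(ι * (a * q)) * (1 + ι * (a * q)) * ((-ι * (a * q ^ 3)) * (1 + -ι * (a * q ^ 3))) - ((a * q ^ 4) ^ 2 + ((a * q ^ 4) ^ 2) ^ 2)‖ ≤ 18 * ‖t‖ := by
    have e : (ι * (a * q)) * (1 + ι * (a * q)) * ((-ι * (a * q ^ 3)) * (1 + -ι * (a * q ^ 3))) - ((a * q ^ 4) ^ 2 + ((a * q ^ 4) ^ 2) ^ 2)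
        = (a * q ^ 2) ^ 2 * (1 - q ^ 4) + (a * q ^ 2) ^ 2 * (ι * (a * q ^ 1)) * (1 - q ^ 2) + (a * q ^ 2) ^ 4 * (1 - q ^ 8) := by
      linear_combination (-(a ^ 2 * q ^ 4) * (1 + ι * a * q - ι * a * q ^ 3) - a ^ 4 * q ^ 8 * (1 - ι ^ 2)) * hι
    rw [e]
    refine (norm_add₃_le).trans ?_
    simp only [norm_mul, norm_pow, hιn]
    have c1 : (‖a‖ * ‖q‖ ^ 2) ≤ 1 := by have := hu1 2; rwa [norm_mul, norm_pow] at this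
    have c2 : (‖a‖ * ‖q‖ ^ 1) ≤ 1 := by have := hu1 1; rwa [norm_mul, norm_pow] at this
    have c0 : 0 ≤ ‖a‖ * ‖q‖ ^ 2 := by positivity
    calc _ ≤ 1 ^ 2 * (4 * ‖t‖) + 1 ^ 2 * (1 * 1) * (2 * ‖t‖) + 1 ^ 4 * (8 * ‖t‖) := by gcongr
      _ ≤ _ := by nlinarith [norm_nonneg t]
  have hDe : (1 + -(a * q ^ 2) + (-(a * q ^ 2)) ^ 2) * (1 + a * q ^ 4 + (a * q ^ 4) ^ 2) - (1 + (a * q ^ 4) ^ 2 + ((a * q ^ 4) ^ 2) ^ 2) = (a * q ^ 2) * (1 - q ^ 2) * ((a * q ^ 2) + (a * q ^ 4) - 1) * (1 + a * q ^ 4 + (a * q ^ 4) ^ 2) := by ring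
  have hD : ‖(1 + -(a * q ^ 2) + (-(a * q ^ 2)) ^ 2) * (1 + a * q ^ 4 + (a * q ^ 4) ^ 2) - (1 + (a * q ^ 4) ^ 2 + ((a * q ^ 4) ^ 2) ^ 2)‖ ≤ 18 * ‖t‖ := by
    rw [hDe, norm_mul, norm_mul, norm_mul]
    have c3 : ‖(a * q ^ 2) + (a * q ^ 4) - 1‖ ≤ 3 := by
      refine (norm_sub_le _ _).trans ?_
      have := norm_add_le (a * q ^ 2) (a * q ^ 4)
      rw [norm_one]
      linarith [hu1 2, hu1 4]
    have := hu1 2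
    calc _ ≤ 1 * (2 * ‖t‖) * 3 * 3 := by gcongr
      _ = _ := by ring
  obtain ⟨f1, f2⟩ := ratio_bound _ _ _ _ (18 * ‖t‖) (by positivity) (by linarith) hN hD d1 d2
  constructor
  · rw [← norm_mul, div_mul_div_comm, norm_div]
    linarith
  · rw [norm_mul] at f2
    rw [norm_div]
    have g1 : 1/12 ≤ ‖1 + -(a * q ^ 2) + (-(a * q ^ 2)) ^ 2‖ := by
      nlinarith [norm_nonneg (1 + -(a * q ^ 2) + (-(a * q ^ 2)) ^ 2), norm_nonneg (1 + a * q ^ 4 + (a * q ^ 4) ^ 2)]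
    rw [div_le_iff₀ (by linarith)]
    have c2 : ‖a * q‖ ≤ 1 := by have := hu1 1; rwa [pow_one] at this
    have g2 : ‖1 + ι * (a * q)‖ ≤ 2 := by
      refine (norm_add_le _ _).trans ?_
      rw [norm_one, norm_mul, hιn]; linarith
    calc _ = ‖a * q‖ * ‖1 + ι * (a * q)‖ := by rw [norm_mul, norm_mul, hιn, one_mul]
      _ ≤ 1 * 2 := by gcongr
      _ ≤ _ := by linarith
end M2

namespace M2
open Filter Topology

noncomputable def qa (θ α : ℝ) : ℂ := Complex.exp (-((α : ℂ) - θ * Complex.I))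

lemma qa_norm (θ α : ℝ) : ‖qa θ α‖ = Real.exp (-α) := by
  unfold qa; rw [Complex.norm_exp]; simp

lemma qa_ne (θ α : ℝ) : qa θ α ≠ 0 := Complex.exp_ne_zero _

lemma qa_lt (θ α : ℝ) (h : 0 < α) : ‖qa θ α‖ < 1 := by
  rw [qa_norm, Real.exp_lt_one_iff]; linarith

lemma qa_shift (θ φ α : ℝ) : qa θ α = Complex.exp (φ * Complex.I) * Complex.exp (-((α : ℂ) - ((θ - φ : ℝ) : ℂ) * Complex.I)) := by
  unfold qa; rw [← Complex.exp_add]; congr 1; push_cast; ring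

lemma near_bound (ι : ℂ) (hι : ι = 1 ∨ ι ^ 2 = -1) (α : ℝ) (h0 : 0 < α) (h1 : α ≤ 1/1000) (φ : ℝ) (hφ : |φ| ≤ 3 * α) :
    ‖Rb (ι * Complex.exp (-((α : ℂ) - φ * Complex.I))) om‖ ≤ 72 * Real.exp 1300 / α := by
  set t : ℂ := (α : ℂ) - φ * Complex.I with ht
  have hre : t.re = α := by simp [ht]
  have him : t.im = -φ := by simp [ht]
  have htn : ‖t‖ ≤ 4 * α := by
    have := Complex.norm_le_abs_re_add_abs_im t
    rw [hre, him, abs_neg, abs_of_pos h0] at this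
    linarith
  have hιn : ‖ι‖ = 1 := by
    rcases hι with h | h
    · rw [h, norm_one]
    · have := congrArg norm h
      rw [norm_pow, norm_neg, norm_one] at this
      exact (pow_eq_one_iff_of_nonneg (norm_nonneg _) (by norm_num)).mp this
  have hqn : ‖ι * Complex.exp (-t)‖ = Real.exp (-α) := by
    rw [norm_mul, hιn, one_mul, Complex.norm_exp, Complex.neg_re, hre]
  have hq0 : ι * Complex.exp (-t) ≠ 0 := by
    rw [← norm_pos_iff, hqn]; positivity
  have hq1 : ‖ι * Complex.exp (-t)‖ < 1 := by
    rw [hqn, Real.exp_lt_one_iff]; linarith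
  have hp : ∀ i, ‖Fq (ι * Complex.exp (-t)) (2 * i)‖ * ‖Fq (ι * Complex.exp (-t)) (2 * i + 1)‖ ≤ 1 + 600 * α ∧ ‖Fq (ι * Complex.exp (-t)) (2 * i)‖ ≤ 24 := by
    intro i
    rcases hι with h | h
    · rw [h, one_mul]
      have f := fun j => q_one_factor t (by rw [hre]; exact h0) (by rw [hre, him, abs_neg]; exact hφ) (by linarith) j
      have f1 := f (2 * i)
      have f2 := f (2 * i + 1)
      constructor
      · calc _ ≤ (1 + 24 * ‖t‖) * (1 + 24 * ‖t‖) := by gcongr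
          _ ≤ (1 + 24 * (4 * α)) * (1 + 24 * (4 * α)) := by gcongr
          _ ≤ _ := by nlinarith
      · linarith
    · have := q_i_factor ι h t (by rw [hre]; exact h0) (by rw [hre, him, abs_neg]; exact hφ) (by linarith) i
      exact ⟨by linarith [this.1], this.2⟩
  have hJ := Nat.le_ceil (2 / α)
  have hJ2 := (Nat.ceil_lt_add_one (show 0 ≤ 2 / α by positivity)).le
  set J := ⌈2 / α⌉₊ with hJd
  have key := Rb_bound _ hq0 hq1 (600 * α) (by positivity) J (fun i => (hp i).1) (fun i => (hp i).2) (by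
    intro j hj
    refine Fq_tail _ j hq1 ?_
    rw [hqn, ← Real.exp_nat_mul]
    have hj' : 2 / α ≤ (j : ℝ) := hJ.trans (by exact_mod_cast hj)
    rw [div_le_iff₀ h0] at hj'
    have e2 : (2:ℝ) ≤ Real.exp 1 := by linarith [Real.add_one_le_exp (1:ℝ)]
    have e3 : (8:ℝ) ≤ Real.exp 3 := by
      have : Real.exp 3 = Real.exp 1 ^ 3 := by rw [← Real.exp_nat_mul]; norm_num
      rw [this]
      calc (8:ℝ) = 2 ^ 3 := by norm_num
        _ ≤ _ := by gcongr
    calc Real.exp (((2 * j + 1 : ℕ) : ℝ) * -α) ≤ Real.exp (-3) := by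
          apply Real.exp_le_exp.mpr; push_cast; nlinarith
      _ = 1 / Real.exp 3 := by rw [Real.exp_neg, one_div]
      _ ≤ 1 / 8 := by gcongr)
  refine key.trans ?_
  have a1 : 600 * α * J ≤ 1300 := by
    have : α * J ≤ α * (2 / α + 1) := by gcongr
    rw [mul_add, mul_div_cancel₀ _ h0.ne'] at this
    nlinarith
  have a2 : (J:ℝ) + 2 ≤ 3 / α := by
    have : 1000 ≤ 1 / α := by rw [le_div_iff₀ h0]; linarith
    have e : 3 / α = 2 / α + 1 / α := by ring
    linarith
  calc 24 * Real.exp (600 * α * J) * (J + 2) ≤ 24 * Real.exp 1300 * (3 / α) := by gcongr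
    _ = _ := by ring

lemma Lf_bound (q : ℂ) (hq0 : q ≠ 0) (hq1 : ‖q‖ < 1) : ‖Lf q om‖ ≤ 1 + 4 / (‖q‖ * (1 - ‖q‖) ^ 2) := by
  have h0 := norm_pos_iff.mpr hq0
  set r := ‖q‖ with hr
  have hb := Lt_bound q hq0 hq1 r h0 hq1 (by rw [← hr]; nlinarith) om ⟨by rw [om_norm]; exact hq1, by rw [om_norm]; exact (one_lt_inv₀ h0).mpr hq1⟩
  have hz : HasSum (fun n : ℤ => r ^ n.natAbs) ((1 - r)⁻¹ + r * (1 - r)⁻¹) := by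
    have g := hasSum_geometric_of_lt_one h0.le hq1
    refine HasSum.of_nat_of_neg_add_one (f := fun n : ℤ => r ^ n.natAbs) ?_ ?_
    · simpa using g
    · have := g.mul_left r
      have e : (fun n : ℕ => r ^ (-((n:ℤ) + 1)).natAbs) = fun n => r * r ^ n := by
        funext n
        rw [← pow_succ']
        congr 1
      rw [e]; exact this
  have hle : ∀ n : ℤ, ‖Lt q om n‖ ≤ r ^ n.natAbs * (r * (1 - r))⁻¹ := by
    intro n
    refine (hb n).trans ?_
    rw [show r ^ 2 / r = r by field_simp, div_eq_mul_inv]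
    have : 0 < r * (1 - r) := by nlinarith
    gcongr
    rw [← zpow_natCast r n.natAbs]
    apply zpow_le_zpow_right_of_le_one₀ h0 hq1.le
    rw [Int.natCast_natAbs]
    rcases abs_cases n with h | h <;> rcases eq_or_ne n 0 with h2 | h2
    · subst h2; simp
    · rw [h.1]; nlinarith [h.2, sq_nonneg n]
    · omega
    · rw [h.1]; nlinarith [h.2]
  have hS := tsum_of_norm_bounded (hz.mul_right (r * (1 - r))⁻¹) hle
  unfold Lf
  have h2 : ‖1 - om‖ ≤ 2 := (norm_sub_le _ _).trans (by rw [norm_one, om_norm]; norm_num)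
  have h1r : 0 < 1 - r := by linarith
  calc _ ≤ ‖(1:ℂ)‖ + ‖1 - om‖ * ‖∑' n : ℤ, Lt q om n‖ := by rw [← norm_mul]; exact norm_add_le _ _
    _ ≤ 1 + 2 * (((1 - r)⁻¹ + r * (1 - r)⁻¹) * (r * (1 - r))⁻¹) := by rw [norm_one]; gcongr
    _ ≤ 1 + 2 * (((1 - r)⁻¹ + 1 * (1 - r)⁻¹) * (r * (1 - r))⁻¹) := by gcongr
    _ = _ := by field_simp; ring

lemma Lf_bound' (θ α : ℝ) (h0 : 0 < α) (h1 : α ≤ 1) : ‖Lf (qa θ α) om‖ ≤ 49 / α ^ 2 := by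
  have := Lf_bound (qa θ α) (qa_ne _ _) (qa_lt _ _ h0)
  rw [qa_norm] at this
  refine this.trans ?_
  have e0 : 1 / 3 ≤ Real.exp (-α) := by
    have a : Real.exp (-1) ≤ Real.exp (-α) := Real.exp_le_exp.mpr (by linarith)
    have b : 1/3 ≤ Real.exp (-1) := by
      rw [Real.exp_neg, one_div]
      apply inv_anti₀ (Real.exp_pos _) 
      linarith [Real.exp_one_lt_d9]
    linarith
  have e1 : α / 2 ≤ 1 - Real.exp (-α) := by
    have : Real.exp (-α) ≤ 1 / (1 + α) := by
      rw [Real.exp_neg, ← one_div]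
      apply one_div_le_one_div_of_le (by linarith)
      linarith [Real.add_one_le_exp α]
    have h3 : 1 / (1 + α) ≤ 1 - α / 2 := by
      rw [div_le_iff₀ (by linarith)]; nlinarith
    linarith
  have : 4 / (Real.exp (-α) * (1 - Real.exp (-α)) ^ 2) ≤ 4 / (1 / 3 * (α / 2) ^ 2) := by gcongr
  have h3 : 1 ≤ 1 / α ^ 2 := by rw [le_div_iff₀ (by positivity)]; nlinarith
  calc _ ≤ 1 / α ^ 2 + 4 / (1 / 3 * (α / 2) ^ 2) := by linarith
    _ = _ := by field_simp; ring

lemma Lamt_norm (θ α : ℝ) (h0 : 0 < α) (k : ℕ) : α * ‖Lamt (qa θ α) k‖ ≤ 1 / (k:ℝ) ^ 2 := by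
  rcases Nat.eq_zero_or_pos k with rfl | hk
  · simp [Lamt]
  have hk' : (0:ℝ) < k := by exact_mod_cast hk
  unfold Lamt
  rw [norm_neg, norm_div, norm_div, norm_pow, norm_neg, qa_norm, ← Real.exp_nat_mul, Complex.norm_natCast]
  have h1 : 1 - Real.exp (k * -α) ≤ ‖1 + (-qa θ α) ^ k‖ := by
    have h := norm_sub_norm_le (1:ℂ) (-(-qa θ α) ^ k)
    rw [norm_one, norm_neg, norm_pow, norm_neg, qa_norm, ← Real.exp_nat_mul, sub_neg_eq_add] at h
    exact h
  have hx : 0 < k * α := by positivity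
  have h2 : 0 < 1 - Real.exp (k * -α) := by
    have : Real.exp (k * -α) < 1 := by rw [Real.exp_lt_one_iff]; linarith
    linarith
  have h3 : Real.exp (k * -α) / (1 - Real.exp (k * -α)) ≤ 1 / (k * α) := by
    rw [div_le_div_iff₀ h2 hx]
    have e := Real.add_one_le_exp (k * α)
    have e2 : Real.exp (k * -α) * Real.exp (k * α) = 1 := by rw [← Real.exp_add]; simp
    nlinarith [Real.exp_pos (k * -α)]
  calc α * (Real.exp (k * -α) / ‖1 + (-qa θ α) ^ k‖ / k) ≤ α * (Real.exp (k * -α) / (1 - Real.exp (k * -α)) / k) := by gcongr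
    _ ≤ α * (1 / (k * α) / k) := by gcongr
    _ = _ := by field_simp

lemma odd_sum : HasSum (fun a : ℕ => 1 / ((2 * a + 1 : ℕ) : ℝ) ^ 2) (Real.pi ^ 2 / 8) := by
  have h := hasSum_zeta_two
  have he : HasSum (fun a : ℕ => 1 / ((2 * a : ℕ) : ℝ) ^ 2) (Real.pi ^ 2 / 24) := by
    have h4 := h.mul_left (1/4)
    have e : (fun a : ℕ => 1 / ((2 * a : ℕ) : ℝ) ^ 2) = fun a : ℕ => 1 / 4 * (1 / (a:ℝ) ^ 2) := by
      funext a; push_cast; rw [mul_pow]; norm_num; ring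
    rw [e, show Real.pi ^ 2 / 24 = 1 / 4 * (Real.pi ^ 2 / 6) by ring]
    exact h4
  have ho : Summable (fun a : ℕ => 1 / ((2 * a + 1 : ℕ) : ℝ) ^ 2) :=
    h.summable.comp_injective (i := fun a => 2 * a + 1) (fun a b h => by simpa using h)
  have := (HasSum.even_add_odd (f := fun n : ℕ => 1 / (n:ℝ) ^ 2) he ho.hasSum).unique h
  have h2 : ∑' a : ℕ, 1 / ((2 * a + 1 : ℕ) : ℝ) ^ 2 = Real.pi ^ 2 / 8 := by linarith
  rw [← h2]; exact ho.hasSum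

lemma K_struct (Q : ℂ) (d : ℕ) (hd : Q ^ d = -1) (hmin : ∀ k < d, Q ^ k ≠ -1) (k : ℕ) (hk : Q ^ k = -1) :
    ∃ a, k = d * (2 * a + 1) := by
  have hd0 : 0 < d := by
    rcases Nat.eq_zero_or_pos d with rfl | h
    · norm_num at hd
    · exact h
  have h2 : Q ^ (2 * d) = 1 := by rw [mul_comm, pow_mul, hd]; norm_num
  have hr : Q ^ (k % (2 * d)) = -1 := by
    rw [← Nat.mod_add_div k (2 * d), pow_add, pow_mul, h2, one_pow, mul_one] at hk
    exact hk
  have hlt := Nat.mod_lt k (show 0 < 2 * d by omega)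
  set r := k % (2 * d) with hrd
  have hge : d ≤ r := by
    by_contra h
    exact hmin r (by omega) hr
  have hrd' : r = d := by
    by_contra hne
    have he : Q ^ (r - d) = 1 := by
      have : Q ^ (r - d) * Q ^ d = -1 := by rw [← pow_add, Nat.sub_add_cancel hge, hr]
      rw [hd] at this
      linear_combination -this
    refine hmin (d - (r - d)) (by omega) ?_
    have : Q ^ (d - (r - d)) * Q ^ (r - d) = -1 := by rw [← pow_add, Nat.sub_add_cancel (by omega), hd]
    rwa [he, mul_one] at this
  refine ⟨k / (2 * d), ?_⟩
  have := Nat.mod_add_div k (2 * d)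
  rw [← hrd, hrd'] at this
  rw [← this]
  have e : (d + 2 * d * (k / (2 * d))) / (2 * d) = k / (2 * d) := by rw [this]
  rw [e]; ring

lemma K_sum (Q : ℂ) (c : ℝ) (hc : 0 < c) (h : ∀ k : ℕ, Q ^ k = -1 → 9 < c * k ^ 2) :
    ∑' k : ℕ, (if Q ^ k = -1 then 1 / c / (k:ℝ) ^ 2 else 0) < Cc := by
  have hC : 0 < Cc := by unfold Cc; positivity
  by_cases hex : ∃ k, Q ^ k = -1
  · set d := Nat.find hex with hdd
    have hd := Nat.find_spec hex
    rw [← hdd] at hd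
    have hmin : ∀ k < d, Q ^ k ≠ -1 := fun k hk => Nat.find_min hex hk
    have hd0 : 0 < d := by
      rcases Nat.eq_zero_or_pos d with h0 | h0
      · rw [h0] at hd; norm_num at hd
      · exact h0
    have hinj : Function.Injective (fun a : ℕ => d * (2 * a + 1)) := by
      intro a b hab
      have := Nat.eq_of_mul_eq_mul_left hd0 hab
      omega
    rw [← hinj.tsum_eq (f := fun k : ℕ => (if Q ^ k = -1 then 1 / c / (k:ℝ) ^ 2 else 0)) (by
      intro k hk
      have : Q ^ k = -1 := by
        by_contra hne; simp [hne] at hk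
      obtain ⟨a, ha⟩ := K_struct Q d hd hmin k this
      exact ⟨a, ha.symm⟩)]
    have e : ∀ a : ℕ, (if Q ^ (d * (2 * a + 1)) = -1 then 1 / c / ((d * (2 * a + 1) : ℕ):ℝ) ^ 2 else 0) = 1 / (c * d ^ 2) * (1 / ((2 * a + 1 : ℕ) : ℝ) ^ 2) := by
      intro a
      rw [if_pos (by rw [pow_mul, hd, pow_succ, pow_mul]; norm_num)]
      push_cast
      field_simp
    simp_rw [e]
    rw [(odd_sum.mul_left _).tsum_eq]
    have h9 := h d hd
    unfold Cc
    have hdp : (0:ℝ) < c * d ^ 2 := by linarith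
    rw [show 1 / (c * d ^ 2) * (Real.pi ^ 2 / 8) = Real.pi ^ 2 / (8 * (c * d ^ 2)) by ring]
    have := Real.pi_pos
    apply div_lt_div_of_pos_left (by positivity) (by norm_num) (by linarith)
  · push Not at hex
    simp only [hex, if_false, tsum_zero]
    exact hC

end M2

namespace M2
open Filter Topology

lemma snd_ev (θs : ℝ) (P : ℝ → Prop) (h : ∀ᶠ α in 𝓝[>] (0:ℝ), P α) : ∀ᶠ p : ℝ × ℝ in 𝓝 θs ×ˢ 𝓝[>] 0, P p.2 :=
  h.prod_inr _

lemma inv_exp_sub (x : ℂ) (h0 : x ≠ 0) (h : ‖x‖ ≤ 1/2) : ‖(Complex.exp x - 1)⁻¹ - x⁻¹‖ ≤ 2 := by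
  have hp := norm_pos_iff.mpr h0
  have h1 := Complex.norm_exp_sub_one_sub_id_le (x := x) (by linarith)
  have h2 : ‖x‖ / 2 ≤ ‖Complex.exp x - 1‖ := by
    have := norm_sub_norm_le x (-(Complex.exp x - 1 - x))
    rw [norm_neg, sub_neg_eq_add, show x + (Complex.exp x - 1 - x) = Complex.exp x - 1 by ring] at this
    nlinarith
  have h3 : Complex.exp x - 1 ≠ 0 := by
    rw [← norm_pos_iff]; linarith
  have e : (Complex.exp x - 1)⁻¹ - x⁻¹ = -(Complex.exp x - 1 - x) / ((Complex.exp x - 1) * x) := by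
    generalize Complex.exp x - 1 = y at *
    field_simp; ring
  rw [e, norm_div, norm_neg, norm_mul, div_le_iff₀ (by positivity)]
  nlinarith

lemma pole_term (θs θ α : ℝ) (h0 : 0 < α) (k : ℕ) (hk : (-Complex.exp (θs * Complex.I)) ^ k = -1)
    (ρ : ℝ) (hρ : 0 ≤ ρ) (h : ρ * α ^ 2 ≤ (θ - θs) ^ 2) (hs : k * (α + |θ - θs|) ≤ 1/2) :
    α * (Lamt (qa θ α) k).re ≤ 1 / (1 + ρ) / (k:ℝ) ^ 2 + 2 * α := by
  have hk0 : k ≠ 0 := by rintro rfl; norm_num at hk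
  have hk' : (1:ℝ) ≤ k := by exact_mod_cast Nat.one_le_iff_ne_zero.mpr hk0
  set φ := θ - θs with hφ
  set t : ℂ := (α : ℂ) - (φ : ℂ) * Complex.I with ht
  have hre : t.re = α := by simp [ht]
  have him : t.im = -φ := by simp [ht]
  have e1 : (-qa θ α) ^ k = -Complex.exp (-(k * t)) := by
    rw [qa_shift θ θs α, ← neg_mul, mul_pow, hk, ← Complex.exp_nat_mul, neg_one_mul]
    congr 2; ring
  have ht0 : t ≠ 0 := by intro h; rw [h] at hre; simp at hre; linarith
  have hkc : (k:ℂ) ≠ 0 := by exact_mod_cast hk0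
  have hx0 : (k:ℂ) * t ≠ 0 := mul_ne_zero hkc ht0
  have hxn : ‖(k:ℂ) * t‖ ≤ 1/2 := by
    rw [norm_mul, Complex.norm_natCast]
    refine le_trans ?_ hs
    gcongr
    have := Complex.norm_le_abs_re_add_abs_im t
    rwa [hre, him, abs_neg, abs_of_pos h0] at this
  have hb := inv_exp_sub _ hx0 hxn
  have e2 : Lamt (qa θ α) k = (Complex.exp (k * t) - 1)⁻¹ / k := by
    unfold Lamt
    rw [e1, Complex.exp_neg (k * t)]
    have hne := Complex.exp_ne_zero (k * t)
    have h1 : Complex.exp (k * t) - 1 ≠ 0 := by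
      intro hh
      have h5 : ‖Complex.exp (k * t)‖ = 1 := by rw [sub_eq_zero.mp hh, norm_one]
      rw [Complex.norm_exp, Real.exp_eq_one_iff] at h5
      rw [← Complex.ofReal_natCast, Complex.re_ofReal_mul, hre] at h5
      have : 0 < (k:ℝ) * α := by positivity
      linarith
    generalize Complex.exp (k * t) = y at *
    have h2 : 1 + -y⁻¹ ≠ 0 := by
      intro hh; apply h1; field_simp at hh; linear_combination hh
    have h7 : -y⁻¹ / (1 + -y⁻¹) = -(y - 1)⁻¹ := by
      rw [div_eq_iff h2, show 1 + -y⁻¹ = (y - 1) * y⁻¹ by rw [sub_mul, mul_inv_cancel₀ hne]; ring]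
      rw [neg_mul, ← mul_assoc, inv_mul_cancel₀ h1, one_mul]
    rw [h7]; ring
  have h3 : (Lamt (qa θ α) k).re = ((Complex.exp (k * t) - 1)⁻¹).re / k := by
    rw [e2, Complex.div_natCast_re]
  have h4 : ((Complex.exp (k * t) - 1)⁻¹).re ≤ (((k:ℂ) * t)⁻¹).re + 2 := by
    have := (Complex.re_le_norm _).trans hb
    rw [Complex.sub_re] at this; linarith
  have h5 : (((k:ℂ) * t)⁻¹).re = α / (k * (α ^ 2 + φ ^ 2)) := by
    rw [Complex.inv_re, ← Complex.ofReal_natCast, Complex.re_ofReal_mul, Complex.normSq_mul, Complex.normSq_ofReal, Complex.normSq_apply, hre, him]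
    field_simp
  rw [h3]
  have h6 : α * (α / (k * (α ^ 2 + φ ^ 2))) / k ≤ 1 / (1 + ρ) / (k:ℝ) ^ 2 := by
    rw [show α * (α / (k * (α ^ 2 + φ ^ 2))) / k = α ^ 2 / (α ^ 2 + φ ^ 2) / (k:ℝ) ^ 2 by field_simp]
    refine div_le_div_of_nonneg_right ?_ (by positivity)
    rw [div_le_div_iff₀ (by positivity) (by positivity)]
    linarith
  calc α * (((Complex.exp (k * t) - 1)⁻¹).re / k) ≤ α * ((α / (k * (α ^ 2 + φ ^ 2)) + 2) / k) := by
        gcongr; rw [← h5]; exact h4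
    _ = α * (α / (k * (α ^ 2 + φ ^ 2))) / k + 2 * α / k := by ring
    _ ≤ _ := by
      have : 2 * α / k ≤ 2 * α := div_le_self (by linarith) hk'
      linarith

lemma Lamt_cont (θs : ℝ) (k : ℕ) (hk : (-Complex.exp (θs * Complex.I)) ^ k ≠ -1) :
    Tendsto (fun p : ℝ × ℝ => p.2 * (Lamt (qa p.1 p.2) k).re) (𝓝 θs ×ˢ 𝓝[>] 0) (𝓝 0) := by
  have hle : (𝓝 θs ×ˢ 𝓝[>] (0:ℝ)) ≤ 𝓝 (θs, (0:ℝ)) := by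
    rw [nhds_prod_eq]; exact prod_mono le_rfl nhdsWithin_le_nhds
  have hq : ContinuousAt (fun p : ℝ × ℝ => qa p.1 p.2) (θs, 0) := by
    unfold qa; fun_prop
  have hq0 : qa θs 0 = Complex.exp (θs * Complex.I) := by unfold qa; congr 1; push_cast; ring
  have hL : ContinuousAt (fun p : ℝ × ℝ => Lamt (qa p.1 p.2) k) (θs, 0) := by
    unfold Lamt
    have h1 : ContinuousAt (fun p : ℝ × ℝ => (-qa p.1 p.2) ^ k) (θs, 0) := hq.neg.pow k
    have h2 : ContinuousAt (fun p : ℝ × ℝ => 1 + (-qa p.1 p.2) ^ k) (θs, 0) := continuousAt_const.add h1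
    exact ((h1.div h2 (by
      simp only [hq0]
      intro h; apply hk; linear_combination h)).div_const _).neg
  have h3 : ContinuousAt (fun p : ℝ × ℝ => p.2 * (Lamt (qa p.1 p.2) k).re) (θs, 0) :=
    continuousAt_snd.mul (Complex.continuous_re.continuousAt.comp hL)
  have h4 := h3.tendsto.mono_left hle
  simpa using h4

lemma Lam_bound (θs ρ : ℝ) (hρ : 0 ≤ ρ)
    (h : ∀ k : ℕ, (-Complex.exp (θs * Complex.I)) ^ k = -1 → 9 < (1 + ρ) * k ^ 2) :
    ∃ η > 0, ∀ᶠ p : ℝ × ℝ in 𝓝 θs ×ˢ 𝓝[>] 0, ρ * p.2 ^ 2 ≤ (p.1 - θs) ^ 2 → p.2 * (Lam (qa p.1 p.2)).re ≤ Cc - η := by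
  set Q := -Complex.exp (θs * Complex.I) with hQ
  have hS := K_sum Q (1 + ρ) (by linarith) h
  set s : ℕ → ℝ := fun k => if Q ^ k = -1 then 1 / (1 + ρ) / (k:ℝ) ^ 2 else 0 with hs
  have hs0 : ∀ k, 0 ≤ s k := by intro k; simp only [hs]; split_ifs <;> positivity
  have hs1 : ∀ k, s k ≤ 1 / (k:ℝ) ^ 2 := by
    intro k; simp only [hs]; split_ifs
    · gcongr; rw [div_le_one (by positivity)]; linarith
    · positivity
  set F := (𝓝 θs ×ˢ 𝓝[>] (0:ℝ)) ⊓ 𝓟 {p : ℝ × ℝ | ρ * p.2 ^ 2 ≤ (p.1 - θs) ^ 2} with hF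
  have hFle : F ≤ 𝓝 θs ×ˢ 𝓝[>] (0:ℝ) := inf_le_left
  have hle : F ≤ 𝓝 (θs, (0:ℝ)) := by
    refine hFle.trans ?_
    rw [nhds_prod_eq]; exact prod_mono le_rfl nhdsWithin_le_nhds
  have hpos : ∀ᶠ p in F, 0 < p.2 := hFle (snd_ev θs (fun α => 0 < α) eventually_mem_nhdsWithin)
  have hfar : ∀ᶠ p in F, ρ * p.2 ^ 2 ≤ (p.1 - θs) ^ 2 := mem_inf_of_right (mem_principal_self _)
  have hsum : Summable (fun k : ℕ => 1 / (k:ℝ) ^ 2) := hasSum_zeta_two.summable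
  have hT := tendsto_tsum_of_dominated_convergence (𝓕 := F)
    (f := fun p k => max (p.2 * (Lamt (qa p.1 p.2) k).re) (s k)) (g := s) hsum (by
      intro k
      by_cases hk : Q ^ k = -1
      · have ha : Tendsto (fun p : ℝ × ℝ => p.2) F (𝓝 0) := (continuous_snd.tendsto (θs, (0:ℝ))).mono_left hle
        have hb : Tendsto (fun p : ℝ × ℝ => (k:ℝ) * (p.2 + |p.1 - θs|)) F (𝓝 0) := by
          have : Continuous (fun p : ℝ × ℝ => (k:ℝ) * (p.2 + |p.1 - θs|)) := by fun_prop
          have := (this.tendsto (θs, (0:ℝ))).mono_left hle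
          simpa using this
        have hc : Tendsto (fun p : ℝ × ℝ => s k + 2 * p.2) F (𝓝 (s k)) := by
          have := (ha.const_mul 2).const_add (s k)
          simpa using this
        refine tendsto_of_tendsto_of_tendsto_of_le_of_le' tendsto_const_nhds hc (Eventually.of_forall fun p => le_max_right _ _) ?_
        filter_upwards [hpos, hfar, hb.eventually (ge_mem_nhds (show (0:ℝ) < 1/2 by norm_num))] with p h1 h2 h3
        apply max_le
        · have := pole_term θs p.1 p.2 h1 k hk ρ hρ h2 h3
          simpa only [hs, if_pos hk] using this
        · linarith
      · have h1 := (Lamt_cont θs k hk).mono_left hFle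
        have h2 := h1.max (tendsto_const_nhds (x := s k))
        have h3 : max 0 (s k) = s k := max_eq_right (hs0 k)
        rw [h3] at h2
        exact h2) (by
      filter_upwards [hpos] with p hp k
      have hl := Lamt_norm p.1 p.2 hp k
      have hl2 := Complex.abs_re_le_norm (Lamt (qa p.1 p.2) k)
      have hl3 : |p.2 * (Lamt (qa p.1 p.2) k).re| ≤ 1 / (k:ℝ) ^ 2 := by
        rw [abs_mul, abs_of_pos hp]
        exact (mul_le_mul_of_nonneg_left hl2 hp.le).trans hl
      rw [Real.norm_eq_abs, abs_le]
      rw [abs_le] at hl3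
      exact ⟨hl3.1.trans (le_max_left _ _), max_le hl3.2 (hs1 k)⟩)
  refine ⟨(Cc - ∑' k, s k) / 2, by linarith, ?_⟩
  have hev := hT.eventually (ge_mem_nhds (show ∑' k, s k < Cc - (Cc - ∑' k, s k) / 2 by linarith))
  have hfin : ∀ᶠ p in F, p.2 * (Lam (qa p.1 p.2)).re ≤ Cc - (Cc - ∑' k, s k) / 2 := by
    filter_upwards [hev, hpos] with p h1 hp
    refine le_trans ?_ h1
    have hLs : Summable (fun k => Lamt (qa p.1 p.2) k) := by
      refine Summable.of_norm_bounded (hsum.mul_left p.2⁻¹) fun k => ?_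
      rw [← div_eq_inv_mul, le_div_iff₀' hp]
      exact Lamt_norm p.1 p.2 hp k
    have hre : (Lam (qa p.1 p.2)).re = ∑' k, (Lamt (qa p.1 p.2) k).re := Complex.re_tsum hLs
    have hrs : Summable (fun k => p.2 * (Lamt (qa p.1 p.2) k).re) :=
      (Complex.reCLM.summable hLs).mul_left _
    rw [hre, ← tsum_mul_left]
    refine Summable.tsum_le_tsum (fun k => le_max_left _ _) hrs ?_
    refine Summable.of_norm_bounded hsum fun k => ?_
    have hl := Lamt_norm p.1 p.2 hp k
    have hl2 := Complex.abs_re_le_norm (Lamt (qa p.1 p.2) k)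
    have hl3 : |p.2 * (Lamt (qa p.1 p.2) k).re| ≤ 1 / (k:ℝ) ^ 2 := by
      rw [abs_mul, abs_of_pos hp]
      exact (mul_le_mul_of_nonneg_left hl2 hp.le).trans hl
    rw [Real.norm_eq_abs, abs_le]
    rw [abs_le] at hl3
    exact ⟨hl3.1.trans (le_max_left _ _), max_le hl3.2 (hs1 k)⟩
  rw [hF, eventually_inf_principal] at hfin
  exact hfin

lemma absorb (M η : ℝ) (hη : 0 < η) (m : ℕ) : ∀ᶠ α : ℝ in 𝓝[>] 0, M / α ^ m ≤ Real.exp (η / α) := by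
  have h1 : Tendsto (fun α : ℝ => α⁻¹) (𝓝[>] 0) atTop := tendsto_inv_nhdsGT_zero
  have h2 : Tendsto (fun x : ℝ => M * (x ^ m * Real.exp (-η * x))) atTop (𝓝 (M * 0)) := by
    apply Tendsto.const_mul
    have := tendsto_rpow_mul_exp_neg_mul_atTop_nhds_zero (m:ℝ) η hη
    simpa [Real.rpow_natCast] using this
  rw [mul_zero] at h2
  filter_upwards [(h2.comp h1).eventually (ge_mem_nhds (show (0:ℝ) < 1 by norm_num))] with α h
  simp only [Function.comp] at h
  have e : Real.exp (η / α) * Real.exp (-η * α⁻¹) = 1 := by rw [← Real.exp_add, ← Real.exp_zero]; congr 1; ring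
  calc M / α ^ m = (M * (α⁻¹ ^ m * Real.exp (-η * α⁻¹))) * Real.exp (η / α) := by
        rw [show (M * (α⁻¹ ^ m * Real.exp (-η * α⁻¹))) * Real.exp (η / α) = M * α⁻¹ ^ m * (Real.exp (η / α) * Real.exp (-η * α⁻¹)) by ring, e, inv_pow]
        ring
    _ ≤ 1 * Real.exp (η / α) := by gcongr
    _ = _ := one_mul _

lemma far_bound (θs ρ : ℝ) (hρ : 0 ≤ ρ)
    (h : ∀ k : ℕ, (-Complex.exp (θs * Complex.I)) ^ k = -1 → 9 < (1 + ρ) * k ^ 2) :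
    ∃ η > 0, ∀ᶠ p : ℝ × ℝ in 𝓝 θs ×ˢ 𝓝[>] 0, ρ * p.2 ^ 2 ≤ (p.1 - θs) ^ 2 → ‖Rb (qa p.1 p.2) om‖ ≤ Real.exp ((Cc - η) / p.2) := by
  obtain ⟨η, hη, hev⟩ := Lam_bound θs ρ hρ h
  refine ⟨η / 2, by positivity, ?_⟩
  have hpos : ∀ᶠ p : ℝ × ℝ in 𝓝 θs ×ˢ 𝓝[>] 0, 0 < p.2 := snd_ev θs (fun α => 0 < α) eventually_mem_nhdsWithin
  have h1 : ∀ᶠ p : ℝ × ℝ in 𝓝 θs ×ˢ 𝓝[>] 0, p.2 ≤ 1 :=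
    snd_ev θs _ (nhdsWithin_le_nhds (ge_mem_nhds (show (0:ℝ) < 1 by norm_num)))
  have h2 : ∀ᶠ p : ℝ × ℝ in 𝓝 θs ×ˢ 𝓝[>] 0, 49 / p.2 ^ 2 ≤ Real.exp (η / 2 / p.2) :=
    snd_ev θs _ (absorb 49 (η / 2) (by positivity) 2)
  filter_upwards [hev, hpos, h1, h2] with p a0 a1 a2 a3 hp
  rw [(main_id _ (qa_ne _ _) (qa_lt _ _ a1) om om_norm).1, norm_mul, Complex.norm_exp]
  have b1 := Lf_bound' p.1 p.2 a1 a2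
  have b2 : (Lam (qa p.1 p.2)).re ≤ (Cc - η) / p.2 := by
    rw [le_div_iff₀' a1]; exact a0 hp
  calc _ ≤ Real.exp (η / 2 / p.2) * Real.exp ((Cc - η) / p.2) := by
        gcongr; exact b1.trans a3
    _ = _ := by rw [← Real.exp_add]; congr 1; ring

end M2

namespace M2
open Filter Topology

lemma minor_local (θs : ℝ) (hθ : θs ∈ Set.Icc (-Real.pi) Real.pi) :
    ∃ η > 0, ∀ᶠ p : ℝ × ℝ in 𝓝 θs ×ˢ 𝓝[>] 0, p.2 < |p.1 - 2 * Real.pi / 3| → p.2 < |p.1 + 2 * Real.pi / 3| →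
      ‖Rb (qa p.1 p.2) om‖ ≤ Real.exp ((Cc - η) / p.2) := by
  set ι := Complex.exp (θs * Complex.I) with hι
  have hpi := Real.pi_pos
  have hC : 0 < Cc := by unfold Cc; positivity
  by_cases hA : ι = 1 ∨ ι ^ 2 = -1
  · obtain ⟨η, hη, hev⟩ := far_bound θs 9 (by norm_num) (by
      intro k hk
      have hk0 : k ≠ 0 := by rintro rfl; norm_num at hk
      have hk' : (1:ℝ) ≤ k := by exact_mod_cast Nat.one_le_iff_ne_zero.mpr hk0
      nlinarith)
    refine ⟨min η (Cc / 2), lt_min hη (by positivity), ?_⟩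
    have hpos := snd_ev θs (fun α => 0 < α) eventually_mem_nhdsWithin
    have h1 := snd_ev θs (fun α => α ≤ 1/1000) (nhdsWithin_le_nhds (ge_mem_nhds (show (0:ℝ) < 1/1000 by norm_num)))
    have h2 := snd_ev θs _ (absorb (72 * Real.exp 1300) (Cc / 2) (by positivity) 1)
    filter_upwards [hev, hpos, h1, h2] with p a0 a1 a2 a3 _ _
    by_cases hp : |p.1 - θs| ≤ 3 * p.2
    · have := near_bound ι hA p.2 a1 a2 (p.1 - θs) hp
      rw [hι, ← qa_shift p.1 θs p.2] at this
      rw [pow_one] at a3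
      refine (this.trans a3).trans (Real.exp_le_exp.mpr ?_)
      gcongr
      linarith [min_le_right η (Cc / 2)]
    · refine (a0 ?_).trans (Real.exp_le_exp.mpr ?_)
      · push Not at hp
        rw [← sq_abs (p.1 - θs)]
        nlinarith
      · gcongr
        exact min_le_left _ _
  push Not at hA
  by_cases hB : ι ^ 3 = 1
  · obtain ⟨η, hη, hev⟩ := far_bound θs 1 (by norm_num) (by
      intro k hk
      have hk3 : 3 ≤ k := by
        by_contra hlt
        have : k = 0 ∨ k = 1 ∨ k = 2 := by omega
        rcases this with rfl | rfl | rfl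
        · norm_num at hk
        · apply hA.1; rw [pow_one] at hk; exact neg_injective hk
        · apply hA.2; rwa [neg_sq] at hk
      have hk' : (3:ℝ) ≤ k := by exact_mod_cast hk3
      nlinarith)
    refine ⟨η, hη, ?_⟩
    have hθ2 : θs = 2 * Real.pi / 3 ∨ θs = -(2 * Real.pi / 3) := by
      rw [hι, ← Complex.exp_nat_mul, Complex.exp_eq_one_iff] at hB
      obtain ⟨n, hn⟩ := hB
      have hn2 : 3 * θs = n * (2 * Real.pi) := by
        have := congrArg Complex.im hn
        simpa using this
      have hn0 : n ≠ 0 := by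
        rintro rfl
        apply hA.1
        have : θs = 0 := by simpa using hn2
        rw [hι, this]; simp
      have n1 : n < 2 := by
        by_contra h
        have : (2:ℝ) ≤ n := by exact_mod_cast (not_lt.mp h)
        nlinarith [hθ.2]
      have n2 : -2 < n := by
        by_contra h
        have : (n:ℝ) ≤ -2 := by exact_mod_cast (not_lt.mp h)
        nlinarith [hθ.1]
      have : n = 1 ∨ n = -1 := by omega
      rcases this with rfl | rfl
      · left; push_cast at hn2; linarith
      · right; push_cast at hn2; linarith
    have hpos := snd_ev θs (fun α => 0 < α) eventually_mem_nhdsWithin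
    filter_upwards [hev, hpos] with p a0 a1 b1 b2
    apply a0
    rw [one_mul, ← sq_abs (p.1 - θs)]
    have : p.2 < |p.1 - θs| := by
      rcases hθ2 with h | h
      · rwa [h]
      · rwa [h, sub_neg_eq_add]
    gcongr
  · obtain ⟨η, hη, hev⟩ := far_bound θs 0 le_rfl (by
      intro k hk
      have hk3 : 4 ≤ k := by
        by_contra hlt
        have : k = 0 ∨ k = 1 ∨ k = 2 ∨ k = 3 := by omega
        rcases this with rfl | rfl | rfl | rfl
        · norm_num at hk
        · apply hA.1; rw [pow_one] at hk; exact neg_injective hk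
        · apply hA.2; rwa [neg_sq] at hk
        · apply hB; linear_combination -hk
      have hk' : (4:ℝ) ≤ k := by exact_mod_cast hk3
      nlinarith)
    refine ⟨η, hη, ?_⟩
    filter_upwards [hev] with p a0 b1 b2
    apply a0
    rw [zero_mul]; positivity

theorem minor_arcs : ∃ η > 0, ∀ᶠ α : ℝ in 𝓝[>] 0, ∀ θ ∈ Set.Icc (-Real.pi) Real.pi,
    α < |θ - 2 * Real.pi / 3| → α < |θ + 2 * Real.pi / 3| → ‖Rb (qa θ α) om‖ ≤ Real.exp ((Cc - η) / α) := by
  refine (isCompact_Icc (a := -Real.pi) (b := Real.pi)).induction_on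
    (p := fun s => ∃ η > 0, ∀ᶠ α : ℝ in 𝓝[>] 0, ∀ θ ∈ s,
      α < |θ - 2 * Real.pi / 3| → α < |θ + 2 * Real.pi / 3| → ‖Rb (qa θ α) om‖ ≤ Real.exp ((Cc - η) / α)) ?_ ?_ ?_ ?_
  · exact ⟨1, one_pos, Eventually.of_forall fun α θ h => absurd h (Set.notMem_empty _)⟩
  · rintro s t hst ⟨η, hη, h⟩
    exact ⟨η, hη, h.mono fun α h θ hθ => h θ (hst hθ)⟩
  · rintro s t ⟨η, hη, h⟩ ⟨η', hη', h'⟩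
    refine ⟨min η η', lt_min hη hη', ?_⟩
    filter_upwards [h, h', self_mem_nhdsWithin] with α a b hα θ hθ c d
    have hα' : 0 < α := hα
    rcases hθ with hθ | hθ
    · refine (a θ hθ c d).trans (Real.exp_le_exp.mpr ?_)
      gcongr
      exact min_le_left _ _
    · refine (b θ hθ c d).trans (Real.exp_le_exp.mpr ?_)
      gcongr
      exact min_le_right _ _
  · intro θs hθ
    obtain ⟨η, hη, hev⟩ := minor_local θs hθ
    rw [eventually_prod_iff] at hev
    obtain ⟨pa, ha, pb, hb, hab⟩ := hev
    refine ⟨{θ | pa θ}, nhdsWithin_le_nhds ha, η, hη, ?_⟩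
    filter_upwards [hb] with α hα θ hθ
    exact hab hθ hα

end M2

namespace M2
open Filter Topology

section genfun
open PowerSeries
open scoped PowerSeries.WithPiTopology

def Good (F : PowerSeries ℂ) (q v : ℂ) : Prop :=
  Summable (fun n => ‖coeff n F * q ^ n‖) ∧ ∑' n, coeff n F * q ^ n = v

lemma Good_mul (F G : PowerSeries ℂ) (q v u : ℂ) (hF : Good F q v) (hG : Good G q u) : Good (F * G) q (v * u) := by
  have e : ∀ n, coeff n (F * G) * q ^ n = ∑ kl ∈ Finset.HasAntidiagonal.antidiagonal n, (coeff kl.1 F * q ^ kl.1) * (coeff kl.2 G * q ^ kl.2) := by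
    intro n
    rw [coeff_mul, Finset.sum_mul]
    refine Finset.sum_congr rfl fun kl h => ?_
    rw [← Finset.HasAntidiagonal.mem_antidiagonal.mp h, pow_add]; ring
  constructor
  · have := summable_norm_sum_mul_antidiagonal_of_summable_norm (f := fun n => coeff n F * q ^ n) (g := fun n => coeff n G * q ^ n) hF.1 hG.1
    have e' : (fun n => ‖coeff n (F * G) * q ^ n‖) = _ := funext fun n => congrArg norm (e n)
    rw [e']; exact this
  · have := tsum_mul_tsum_eq_tsum_sum_antidiagonal_of_summable_norm (f := fun n => coeff n F * q ^ n) (g := fun n => coeff n G * q ^ n) hF.1 hG.1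
    rw [hF.2, hG.2] at this
    rw [this]
    exact congrArg tsum (funext e) |>.trans rfl

lemma Good_one (q : ℂ) : Good 1 q 1 := by
  have e : ∀ n, coeff n (1 : PowerSeries ℂ) * q ^ n = if n = 0 then 1 else 0 := by
    intro n; rw [coeff_one]; split_ifs with h
    · subst h; simp
    · simp
  constructor
  · refine summable_of_ne_finset_zero (s := {0}) fun b hb => ?_
    rw [e, if_neg (by simpa using hb), norm_zero]
  · simp_rw [e]; exact tsum_ite_eq 0 _

lemma Good_prod (q : ℂ) (F : ℕ → PowerSeries ℂ) (v : ℕ → ℂ) (N : ℕ) (h : ∀ i < N, Good (F i) q (v i)) :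
    Good (∏ i ∈ Finset.range N, F i) q (∏ i ∈ Finset.range N, v i) := by
  induction N with
  | zero => simpa using Good_one q
  | succ N ih =>
    rw [Finset.prod_range_succ, Finset.prod_range_succ]
    exact Good_mul _ _ _ _ _ (ih fun i hi => h i (by omega)) (h N (by omega))

noncomputable def geng (c : ℕ → ℂ) (p : ℕ) : PowerSeries ℂ := PowerSeries.mk (fun n => if p ∣ n then c (n / p) else 0)

lemma geng_eq (c : ℕ → ℂ) (p : ℕ) (hp : 0 < p) (hc : c 0 = 1) :
    1 + ∑' j, c (j + 1) • (X : PowerSeries ℂ) ^ (p * (j + 1)) = geng c p := by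
  have : HasSum (fun j => c (j + 1) • (X : PowerSeries ℂ) ^ (p * (j + 1))) (geng c p - 1) := by
    rw [PowerSeries.WithPiTopology.hasSum_iff_hasSum_coeff]
    intro d
    have e : ∀ j, coeff d (c (j + 1) • (X : PowerSeries ℂ) ^ (p * (j + 1))) = if d = p * (j + 1) then c (j + 1) else 0 := by
      intro j
      rw [PowerSeries.coeff_smul, coeff_X_pow]; split_ifs <;> simp
    simp_rw [e]
    rw [map_sub, geng, coeff_mk, coeff_one]
    by_cases hd : p ∣ d
    · obtain ⟨k, rfl⟩ := hd
      rw [if_pos (dvd_mul_right _ _), Nat.mul_div_cancel_left _ hp]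
      rcases Nat.eq_zero_or_eq_succ_pred k with h | h
      · subst h
        simp only [mul_zero, if_true, hc, sub_self]
        have : ∀ j, (if 0 = p * (j + 1) then c (j + 1) else 0) = 0 := by
          intro j; rw [if_neg]; exact (Nat.mul_pos hp (Nat.succ_pos j)).ne
        simp_rw [this]; exact hasSum_zero
      · rw [h]
        generalize k.pred = e
        have h0 : p * e.succ ≠ 0 := Nat.mul_ne_zero hp.ne' (Nat.succ_ne_zero _)
        rw [if_neg h0, sub_zero]
        have := hasSum_single (f := fun j => if p * e.succ = p * (j + 1) then c (j + 1) else 0) e (by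
          intro j hj
          rw [if_neg]
          intro h
          have := Nat.eq_of_mul_eq_mul_left hp h
          omega)
        simpa using this
    · rw [if_neg hd, if_neg (by rintro rfl; exact hd (dvd_zero _)), sub_self]
      have : ∀ j, (if d = p * (j + 1) then c (j + 1) else 0) = 0 := by
        intro j; rw [if_neg]; rintro rfl; exact hd (dvd_mul_right _ _)
      simp_rw [this]; exact hasSum_zero
  rw [this.tsum_eq]; ring

lemma geng_good (c : ℕ → ℂ) (p : ℕ) (hp : 0 < p) (q v : ℂ) (hs : Summable fun j => ‖c j * q ^ (p * j)‖)
    (hv : ∑' j, c j * q ^ (p * j) = v) : Good (geng c p) q v := by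
  have hinj : Function.Injective (fun j => p * j) := fun a b h => Nat.eq_of_mul_eq_mul_left hp h
  have e : ∀ n, coeff n (geng c p) * q ^ n = if p ∣ n then c (n / p) * q ^ n else 0 := by
    intro n; rw [geng, coeff_mk]; split_ifs <;> simp
  have hsupp : ∀ n ∉ Set.range (fun j => p * j), coeff n (geng c p) * q ^ n = 0 := by
    intro n hn
    rw [e, if_neg]
    rintro ⟨k, rfl⟩; exact hn ⟨k, rfl⟩
  have e2 : ∀ j, coeff (p * j) (geng c p) * q ^ (p * j) = c j * q ^ (p * j) := by
    intro j; rw [e, if_pos (dvd_mul_right _ _), Nat.mul_div_cancel_left _ hp]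
  constructor
  · rw [← hinj.summable_iff (fun n hn => by rw [hsupp n hn, norm_zero])]
    simp only [Function.comp_def, e2]; exact hs
  · rw [← hinj.tsum_eq (f := fun n => coeff n (geng c p) * q ^ n) (by
      intro n hn; by_contra h; exact hn (hsupp n h))]
    simp only [e2]; exact hv

/-- character -/
noncomputable def chf (w : ℂ) (m : ℕ) (i c : ℕ) : ℂ := if i ≤ 2 * m ∧ (Odd i → c ≤ 1) then w ^ c else 0

/-- weighted count of partitions with parts at most 2 * m -/
noncomputable def cw (w : ℂ) (m n : ℕ) : ℂ :=
  ∑ P : n.Partition, if NoRepeatedOddParts P ∧ ∀ i ∈ P.parts, i ≤ 2 * m then w ^ (Multiset.card P.parts) else 0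

lemma cw_coeff (w : ℂ) (m n : ℕ) : coeff n (Nat.Partition.genFun (chf w m)) = cw w m n := by
  rw [Nat.Partition.coeff_genFun, cw]
  refine Finset.sum_congr rfl fun P _ => ?_
  rw [Finsupp.prod, Multiset.toFinsupp_support]
  split_ifs with h
  · rw [← Multiset.toFinset_sum_count_eq, ← Finset.prod_pow_eq_pow_sum]
    refine Finset.prod_congr rfl fun i hi => ?_
    rw [Multiset.toFinsupp_apply, chf, if_pos]
    exact ⟨h.2 i (Multiset.mem_toFinset.mp hi), fun ho => h.1 i ho⟩
  · rw [not_and_or] at h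
    rcases h with h | h
    · unfold NoRepeatedOddParts at h
      push Not at h
      obtain ⟨j, hj, hc⟩ := h
      refine Finset.prod_eq_zero (i := j) (Multiset.mem_toFinset.mpr (Multiset.count_pos.mp (by omega))) ?_
      rw [Multiset.toFinsupp_apply, chf, if_neg]
      intro h; have := h.2 hj; omega
    · push Not at h
      obtain ⟨i, hi, hc⟩ := h
      refine Finset.prod_eq_zero (i := i) (Multiset.mem_toFinset.mpr hi) ?_
      rw [chf, if_neg]
      intro h; have := h.1; omega

lemma gen_good (w : ℂ) (hw : ‖w‖ = 1) (q : ℂ) (hq : ‖q‖ < 1) (m : ℕ) :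
    Good (Nat.Partition.genFun (chf w m)) q (Gp q w m) := by
  set c : ℕ → ℕ → ℂ := fun p j => if j = 0 then 1 else chf w m p j with hc
  have hfac : ∀ i, (1 + ∑' j, chf w m (i + 1) (j + 1) • (X : PowerSeries ℂ) ^ ((i + 1) * (j + 1))) = geng (c (i + 1)) (i + 1) := by
    intro i
    rw [← geng_eq (c (i + 1)) (i + 1) (by omega) (by simp [hc])]
    simp [hc]
  have h1 := Nat.Partition.hasProd_genFun (chf w m)
  simp_rw [hfac] at h1
  have h2 : ∀ i ∉ Finset.range (2 * m), geng (c (i + 1)) (i + 1) = 1 := by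
    intro i hi
    rw [← hfac]
    have : ∀ j, chf w m (i + 1) (j + 1) = 0 := by
      intro j; rw [chf, if_neg]; intro h; rw [Finset.mem_range] at hi; omega
    simp [this]
  rw [h1.unique (hasProd_prod_of_ne_finset_one h2)]
  have h3 : ∀ i < 2 * m, Good (geng (c (i + 1)) (i + 1)) q (if Odd (i + 1) then 1 + w * q ^ (i + 1) else (1 - w * q ^ (i + 1))⁻¹) := by
    intro i hi
    have hlt : ‖w * q ^ (i + 1)‖ < 1 := by
      rw [norm_mul, hw, one_mul, norm_pow]; exact pow_lt_one₀ (norm_nonneg _) hq (by omega)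
    split_ifs with ho
    · have hz : ∀ j ∉ Finset.range 2, c (i + 1) j * q ^ ((i + 1) * j) = 0 := by
        intro j hj
        rw [Finset.mem_range] at hj
        simp only [hc]
        rw [if_neg (by omega), chf, if_neg, zero_mul]
        intro h; have := h.2 ho; omega
      refine geng_good _ _ (by omega) _ _ (summable_of_ne_finset_zero (s := Finset.range 2) fun j hj => by rw [hz j hj, norm_zero]) ?_
      rw [tsum_eq_sum hz, Finset.sum_range_succ, Finset.sum_range_one]
      simp only [hc, chf]
      rw [if_pos trivial, if_neg (by norm_num), if_pos ⟨by omega, fun _ => le_rfl⟩]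
      simp
    · have e : ∀ j, c (i + 1) j * q ^ ((i + 1) * j) = (w * q ^ (i + 1)) ^ j := by
        intro j
        rw [mul_pow, ← pow_mul]
        congr 1
        simp only [hc]
        split_ifs with hj
        · simp [hj]
        · rw [chf, if_pos ⟨by omega, fun h => absurd h ho⟩]
      refine geng_good _ _ (by omega) _ _ ?_ ?_
      · simp_rw [e]
        simp_rw [norm_pow]
        exact summable_geometric_of_lt_one (norm_nonneg _) hlt
      · simp_rw [e]
        exact tsum_geometric_of_norm_lt_one hlt
  have h4 := Good_prod q _ _ (2 * m) h3
  convert h4 using 1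
  clear h4 h3 h2 h1 hfac hc c
  unfold Gp
  induction m with
  | zero => simp
  | succ m ih =>
    rw [Finset.prod_range_succ, ih, show 2 * (m + 1) = 2 * m + 1 + 1 by ring, Finset.prod_range_succ _ (2 * m + 1), Finset.prod_range_succ _ (2 * m), if_pos ⟨m, rfl⟩, if_neg (by rw [Nat.not_odd_iff_even]; exact ⟨m + 1, by ring⟩), div_eq_mul_inv]
    ring

end genfun

end M2

namespace M2
open Filter Topology

lemma cw_summable (w : ℂ) (hw : ‖w‖ = 1) (q : ℂ) (hq : ‖q‖ < 1) (m : ℕ) :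
    Summable (fun n => ‖cw w m n * q ^ n‖) := by
  have := (gen_good w hw q hq m).1
  simp only [cw_coeff] at this; exact this

lemma cw_hasSum (w : ℂ) (hw : ‖w‖ = 1) (q : ℂ) (hq : ‖q‖ < 1) (m : ℕ) :
    HasSum (fun n => cw w m n * q ^ n) (Gp q w m) := by
  have h := (gen_good w hw q hq m).2
  simp only [cw_coeff] at h
  rw [← h]; exact (cw_summable w hw q hq m).of_norm.hasSum

noncomputable def dw (w : ℂ) (m n : ℕ) : ℂ :=
  ∑ P : n.Partition, if NoRepeatedOddParts P ∧ (P.parts.sup + 1) / 2 = m then w ^ (Multiset.card P.parts) else 0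

noncomputable def Dr (m n : ℕ) : ℝ :=
  ∑ P : n.Partition, if NoRepeatedOddParts P ∧ (P.parts.sup + 1) / 2 = m then 1 else 0

lemma cw_eq (w : ℂ) (m n : ℕ) : cw w m n =
    ∑ P : n.Partition, if NoRepeatedOddParts P ∧ (P.parts.sup + 1) / 2 ≤ m then w ^ (Multiset.card P.parts) else 0 := by
  unfold cw
  refine Finset.sum_congr rfl fun P _ => ?_
  have : (∀ i ∈ P.parts, i ≤ 2 * m) ↔ (P.parts.sup + 1) / 2 ≤ m := by
    rw [← Multiset.sup_le]; omega
  simp only [this]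

lemma dw_zero (w : ℂ) (n : ℕ) : dw w 0 n = cw w 0 n := by
  rw [cw_eq, dw]; simp only [Nat.le_zero]

lemma dw_succ (w : ℂ) (m n : ℕ) : dw w (m + 1) n = cw w (m + 1) n - cw w m n := by
  rw [cw_eq, cw_eq, dw, ← Finset.sum_sub_distrib]
  refine Finset.sum_congr rfl fun P _ => ?_
  by_cases h : NoRepeatedOddParts P
  · simp only [h, true_and]
    rcases lt_trichotomy ((P.parts.sup + 1) / 2) (m + 1) with h1 | h1 | h1
    · rw [if_neg (by omega), if_pos (by omega), if_pos (by omega), sub_self]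
    · rw [if_pos (by omega), if_pos (by omega), if_neg (by omega), sub_zero]
    · rw [if_neg (by omega), if_neg (by omega), if_neg (by omega), sub_zero]
  · simp [h]

lemma dw_norm (w : ℂ) (hw : ‖w‖ = 1) (m n : ℕ) : ‖dw w m n‖ ≤ Dr m n := by
  unfold dw Dr
  refine (norm_sum_le _ _).trans (Finset.sum_le_sum fun P _ => ?_)
  split_ifs
  · rw [norm_pow, hw, one_pow]
  · simp

lemma Dr_nonneg (m n : ℕ) : 0 ≤ Dr m n := Finset.sum_nonneg fun P _ => by split_ifs <;> norm_num

lemma dw_one (m n : ℕ) : dw 1 m n = (Dr m n : ℂ) := by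
  unfold dw Dr
  rw [Complex.ofReal_sum]
  refine Finset.sum_congr rfl fun P _ => ?_
  split_ifs <;> simp

/-- first differences of Gp -/
noncomputable def dG (q w : ℂ) (m : ℕ) : ℂ := if m = 0 then 1 else Gp q w m - Gp q w (m - 1)

lemma dw_hasSum (w : ℂ) (hw : ‖w‖ = 1) (q : ℂ) (hq : ‖q‖ < 1) (m : ℕ) :
    HasSum (fun n => dw w m n * q ^ n) (dG q w m) := by
  unfold dG
  split_ifs with h
  · subst h
    simp_rw [dw_zero]
    have := cw_hasSum w hw q hq 0
    simpa [Gp] using this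
  · obtain ⟨k, rfl⟩ := Nat.exists_eq_succ_of_ne_zero h
    simp only [Nat.succ_eq_add_one, dw_succ, sub_mul, Nat.add_sub_cancel]
    exact (cw_hasSum w hw q hq (k + 1)).sub (cw_hasSum w hw q hq k)

lemma dG_succ (q w : ℂ) (hw : ‖w‖ = 1) (hq : ‖q‖ < 1) (m : ℕ) :
    dG q w (m + 1) = w * ((q ^ 2) ^ (m + 1) * Gp q w (m + 1)) + w * q * ((q ^ 2) ^ m * Gp q w m) := by
  unfold dG
  rw [if_neg (by omega), Nat.add_sub_cancel]
  have hne : 1 - w * q ^ (2 * m + 2) ≠ 0 := by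
    intro h
    have h1 : ‖w * q ^ (2 * m + 2)‖ = 1 := by rw [← sub_eq_zero.mp h, norm_one]
    rw [norm_mul, hw, one_mul, norm_pow] at h1
    have := pow_lt_one₀ (norm_nonneg q) hq (show 2 * m + 2 ≠ 0 by omega)
    linarith
  have h1 : Gp q w (m + 1) * (1 - w * q ^ (2 * m + 2)) = Gp q w m * (1 + w * q ^ (2 * m + 1)) := by
    unfold Gp
    rw [Finset.prod_range_succ]
    generalize ∏ j ∈ Finset.range m, (1 + w * q ^ (2 * j + 1)) / (1 - w * q ^ (2 * j + 2)) = G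
    field_simp
  rw [← pow_mul, ← pow_mul, show 2 * (m + 1) = 2 * m + 2 by ring]
  linear_combination h1

lemma Sa_summ (q : ℂ) (hq0 : q ≠ 0) (hq : ‖q‖ < 1) (z : ℂ) (hz : ‖z‖ = 1) :
    Summable (fun m => (z * q ^ 2) ^ m * Gp q z⁻¹ m) := by
  have h0 := norm_pos_iff.mpr hq0
  exact Sat_summable q hq0 hq ‖q‖ h0 (by nlinarith) z ⟨by rw [hz]; exact hq, by rw [hz]; exact (one_lt_inv₀ h0).mpr hq⟩

lemma dG_hasSum (q : ℂ) (hq0 : q ≠ 0) (hq : ‖q‖ < 1) (z : ℂ) (hz : ‖z‖ = 1) :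
    HasSum (fun m => z ^ m * dG q z⁻¹ m) (Ra q z) := by
  have hz0 : z ≠ 0 := by rw [← norm_pos_iff, hz]; exact one_pos
  have hzi : ‖z⁻¹‖ = 1 := by rw [norm_inv, hz, inv_one]
  have hS := (Sa_summ q hq0 hq z hz).hasSum
  have hS1 : HasSum (fun m => (z * q ^ 2) ^ (m + 1) * Gp q z⁻¹ (m + 1)) (Sa q z - 1) := by
    have := (hasSum_nat_add_iff' 1).mpr hS
    simpa [Gp, Sa] using this
  rw [← hasSum_nat_add_iff' 1]
  have h3 := (hS1.mul_left z⁻¹).add (hS.mul_left q)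
  have e : (fun m => z ^ (m + 1) * dG q z⁻¹ (m + 1)) = fun m => z⁻¹ * ((z * q ^ 2) ^ (m + 1) * Gp q z⁻¹ (m + 1)) + q * ((z * q ^ 2) ^ m * Gp q z⁻¹ m) := by
    funext m
    rw [dG_succ q z⁻¹ hzi hq, mul_pow, mul_pow]
    generalize Gp q z⁻¹ (m + 1) = A
    generalize Gp q z⁻¹ m = B
    field_simp
    ring
  rw [e]
  have h4 : Ra q z - ∑ i ∈ Finset.range 1, z ^ i * dG q z⁻¹ i = z⁻¹ * (Sa q z - 1) + q * ∑' (b : ℕ), (z * q ^ 2) ^ b * Gp q z⁻¹ b := by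
    rw [Finset.sum_range_one, dG, if_pos rfl, pow_zero, Ra, Sa]
    ring
  rw [h4]; exact h3

lemma Dr_summable (r : ℝ) (h0 : 0 < r) (h1 : r < 1) : Summable (fun p : ℕ × ℕ => Dr p.1 p.2 * r ^ p.2) := by
  have hr : ‖(r:ℂ)‖ < 1 := by rw [Complex.norm_real, Real.norm_of_nonneg h0.le]; exact h1
  have hs : ∀ m, HasSum (fun n => ((Dr m n * r ^ n : ℝ) : ℂ)) (dG r 1 m) := by
    intro m
    have := dw_hasSum 1 norm_one (r:ℂ) hr m
    simp_rw [dw_one] at this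
    push_cast; exact this
  have hs' : ∀ m, Summable (fun n => Dr m n * r ^ n) := fun m => Complex.summable_ofReal.mp (hs m).summable
  rw [summable_prod_of_nonneg (fun p => mul_nonneg (Dr_nonneg _ _) (by positivity))]
  refine ⟨hs', ?_⟩
  rw [← Complex.summable_ofReal]
  have e : (fun m => ((∑' n, Dr m n * r ^ n : ℝ) : ℂ)) = fun m => dG r 1 m := by
    funext m
    rw [Complex.ofReal_tsum]; exact (hs m).tsum_eq
  rw [e]
  have := (dG_hasSum (r:ℂ) (by exact_mod_cast h0.ne') hr 1 norm_one).summable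
  simpa using this

noncomputable def Aw (n : ℕ) : ℂ :=
  ∑ P : n.Partition, if NoRepeatedOddParts P then om ^ ((P.parts.sup + 1) / 2) * om⁻¹ ^ (Multiset.card P.parts) else 0

lemma om_inv_norm : ‖om⁻¹‖ = 1 := by rw [norm_inv, om_norm, inv_one]

lemma Aw_eq (n : ℕ) : ∑' m, om ^ m * dw om⁻¹ m n = Aw n := by
  have hb : ∀ P : n.Partition, (P.parts.sup + 1) / 2 ≤ n := by
    intro P
    have : P.parts.sup ≤ n := Multiset.sup_le.mpr fun i hi => Nat.Partition.le_of_mem_parts hi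
    omega
  rw [tsum_eq_sum (s := Finset.range (n + 1)) (by
    intro m hm
    rw [Finset.mem_range] at hm
    unfold dw
    rw [Finset.sum_eq_zero, mul_zero]
    intro P _
    rw [if_neg]
    intro h; have := hb P; omega)]
  unfold dw Aw
  simp_rw [Finset.mul_sum]
  rw [Finset.sum_comm]
  refine Finset.sum_congr rfl fun P _ => ?_
  by_cases h : NoRepeatedOddParts P
  · simp only [h, true_and, if_true]
    rw [Finset.sum_eq_single ((P.parts.sup + 1) / 2)]
    · rw [if_pos rfl]
    · intro m _ hm; rw [if_neg (Ne.symm hm), mul_zero]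
    · intro hm; exfalso; apply hm; rw [Finset.mem_range]; have := hb P; omega
  · simp [h]

lemma Aw_hasSum (q : ℂ) (hq0 : q ≠ 0) (hq : ‖q‖ < 1) :
    Summable (fun n => ‖Aw n * q ^ n‖) ∧ HasSum (fun n => Aw n * q ^ n) (Ra q om) := by
  have hD := Dr_summable ‖q‖ (norm_pos_iff.mpr hq0) hq
  have hn : ∀ p : ℕ × ℕ, ‖om ^ p.1 * dw om⁻¹ p.1 p.2 * q ^ p.2‖ ≤ Dr p.1 p.2 * ‖q‖ ^ p.2 := by
    intro p
    rw [norm_mul, norm_mul, norm_pow, om_norm, one_pow, one_mul, norm_pow]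
    gcongr
    exact dw_norm _ om_inv_norm _ _
  have hS : Summable (fun p : ℕ × ℕ => om ^ p.1 * dw om⁻¹ p.1 p.2 * q ^ p.2) := Summable.of_norm_bounded hD hn
  have hD' := hD.prod_symm.prod
  have hnA : ∀ n, ‖Aw n * q ^ n‖ ≤ ∑' m, Dr m n * ‖q‖ ^ n := by
    intro n
    rw [← Aw_eq, ← tsum_mul_right]
    refine tsum_of_norm_bounded (hD.prod_symm.prod_factor n).hasSum fun m => hn (m, n)
  have hsA : Summable (fun n => ‖Aw n * q ^ n‖) :=
    Summable.of_nonneg_of_le (fun _ => norm_nonneg _) hnA hD'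
  refine ⟨hsA, ?_⟩
  have : ∑' n, Aw n * q ^ n = Ra q om := by
    simp_rw [← Aw_eq, ← tsum_mul_right]
    rw [Summable.tsum_comm (f := fun m n => om ^ m * dw om⁻¹ m n * q ^ n) hS]
    rw [← (dG_hasSum q hq0 hq om om_norm).tsum_eq]
    congr 1
    funext m
    simp_rw [mul_assoc]
    rw [tsum_mul_left, (dw_hasSum om⁻¹ om_inv_norm q hq m).tsum_eq]
  rw [← this]
  exact hsA.of_norm.hasSum

lemma Acoef_eq (n : ℕ) : Acoef 1 3 n = Aw n := by
  unfold Acoef Aw N2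
  have e : ∀ r : ℕ, Complex.exp (2 * Real.pi * Complex.I * ((1:ℤ) : ℂ) * (r : ℂ) / ((3:ℕ) : ℂ)) = om ^ (r:ℤ) := by
    intro r
    rw [zpow_natCast]
    unfold om
    rw [← Complex.exp_nat_mul]
    congr 1; push_cast; ring
  simp_rw [e]
  have e2 : ∀ r : ℕ, ((Nat.card {P : n.Partition // NoRepeatedOddParts P ∧ m2Rank P ≡ (r:ℤ) [ZMOD ((3:ℕ) : ℤ)]} : ℕ) : ℂ) * om ^ (r:ℤ)
      = ∑ P : n.Partition, if NoRepeatedOddParts P ∧ m2Rank P ≡ (r:ℤ) [ZMOD ((3:ℕ) : ℤ)] then om ^ (r:ℤ) else 0 := by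
    intro r
    rw [Nat.card_eq_fintype_card, Fintype.card_subtype, ← Finset.sum_filter, Finset.sum_const, nsmul_eq_mul]
  simp_rw [e2]
  rw [Finset.sum_comm]
  refine Finset.sum_congr rfl fun P _ => ?_
  by_cases h : NoRepeatedOddParts P
  · simp only [h, true_and, if_true]
    have h3 : om ^ ((P.parts.sup + 1) / 2) * om⁻¹ ^ (Multiset.card P.parts) = om ^ (m2Rank P) := by
      unfold m2Rank
      rw [zpow_sub₀ om_ne, zpow_natCast, zpow_natCast, inv_pow, div_eq_mul_inv]
    rw [h3]
    have hm := Int.emod_nonneg (m2Rank P) (show (3:ℤ) ≠ 0 by norm_num)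
    have hm2 := Int.emod_lt_of_pos (m2Rank P) (show (0:ℤ) < 3 by norm_num)
    rw [Finset.sum_eq_single (m2Rank P % 3).toNat]
    · rw [Int.toNat_of_nonneg hm, if_pos, ← om_zpow_mod (m2Rank P) _ rfl]
      unfold Int.ModEq; push_cast; rw [Int.emod_emod_of_dvd _ (dvd_refl _)]
    · intro r hr hne
      rw [if_neg]
      intro hc
      unfold Int.ModEq at hc
      rw [Finset.mem_range] at hr
      push_cast at hc
      omega
    · intro hm3; exfalso; apply hm3; rw [Finset.mem_range]; omega
  · simp [h]

end M2

namespace M2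
open Filter Topology

lemma qa_pow (θ α : ℝ) (m : ℕ) : qa θ α ^ m = ((Real.exp (-(m * α)) : ℝ) : ℂ) * Complex.exp (m * (θ * Complex.I)) := by
  unfold qa
  rw [← Complex.exp_nat_mul, Complex.ofReal_exp, ← Complex.exp_add]
  congr 1; push_cast; ring

lemma Rb_hasSum (θ α : ℝ) (h : 0 < α) : HasSum (fun m => Aw m * qa θ α ^ m) (Rb (qa θ α) om) := by
  have h1 := main_id _ (qa_ne θ α) (qa_lt θ α h) om om_norm
  rw [h1.1, ← h1.2]
  exact (Aw_hasSum _ (qa_ne θ α) (qa_lt θ α h)).2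

lemma Aw_bound_summable (α : ℝ) (h : 0 < α) : Summable (fun m : ℕ => ‖Aw m‖ * Real.exp (-(m * α))) := by
  have := (Aw_hasSum _ (qa_ne 0 α) (qa_lt 0 α h)).1
  have e : (fun m => ‖Aw m * qa 0 α ^ m‖) = fun m : ℕ => ‖Aw m‖ * Real.exp (-(m * α)) := by
    funext m
    rw [norm_mul, norm_pow, qa_norm, ← Real.exp_nat_mul]; congr 2; ring
  rw [← e]; exact this

lemma Aw_term_norm (θ α : ℝ) (m : ℕ) : ‖Aw m * qa θ α ^ m‖ = ‖Aw m‖ * Real.exp (-(m * α)) := by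
  rw [norm_mul, norm_pow, qa_norm, ← Real.exp_nat_mul]; congr 2; ring

lemma qa_cont (α : ℝ) : Continuous (fun θ : ℝ => qa θ α) := by unfold qa; fun_prop

lemma Rb_cont (α : ℝ) (h : 0 < α) : Continuous (fun θ : ℝ => Rb (qa θ α) om) := by
  have e : (fun θ : ℝ => Rb (qa θ α) om) = fun θ => ∑' m, Aw m * qa θ α ^ m := funext fun θ => (Rb_hasSum θ α h).tsum_eq.symm
  rw [e]
  refine continuous_tsum (fun m => continuous_const.mul ((qa_cont α).pow m)) (Aw_bound_summable α h) fun m θ => (Aw_term_norm θ α m).le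

lemma exp_int (k : ℤ) : ∫ θ in (-Real.pi)..Real.pi, Complex.exp (k * (θ * Complex.I)) = if k = 0 then 2 * (Real.pi : ℂ) else 0 := by
  split_ifs with h
  · subst h; simp; ring
  · have hc : (k:ℂ) * Complex.I ≠ 0 := mul_ne_zero (by exact_mod_cast h) Complex.I_ne_zero
    have := integral_exp_mul_complex (a := -Real.pi) (b := Real.pi) hc
    have e : (fun θ : ℝ => Complex.exp (k * (θ * Complex.I))) = fun θ : ℝ => Complex.exp (k * Complex.I * θ) := by
      funext θ; congr 1; ring
    rw [e, this]
    have : Complex.exp (k * Complex.I * (Real.pi : ℝ)) = Complex.exp (k * Complex.I * ((-Real.pi : ℝ) : ℂ)) := by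
      rw [Complex.exp_eq_exp_iff_exists_int]
      exact ⟨k, by push_cast; ring⟩
    rw [this, sub_self, zero_div]

theorem fourier_coef (α : ℝ) (h : 0 < α) (n : ℕ) :
    ∫ θ in (-Real.pi)..Real.pi, Rb (qa θ α) om * Complex.exp (-(n * (θ * Complex.I))) = 2 * Real.pi * Aw n * ((Real.exp (-(n * α)) : ℝ) : ℂ) := by
  have hn : ∀ θ : ℝ, ‖Complex.exp (-(n * (θ * Complex.I)))‖ = 1 := by
    intro θ; rw [Complex.norm_exp]; simp
  have key := intervalIntegral.hasSum_integral_of_dominated_convergence (μ := MeasureTheory.volume) (a := -Real.pi) (b := Real.pi)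
    (F := fun (m : ℕ) (θ : ℝ) => Aw m * qa θ α ^ m * Complex.exp (-(n * (θ * Complex.I))))
    (f := fun θ : ℝ => Rb (qa θ α) om * Complex.exp (-(n * (θ * Complex.I))))
    (bound := fun m _ => ‖Aw m‖ * Real.exp (-(m * α)))
    (fun m => by
      apply Continuous.aestronglyMeasurable
      have := qa_cont α
      fun_prop)
    (fun m => Eventually.of_forall fun θ _ => by rw [norm_mul, hn, mul_one, Aw_term_norm])
    (Eventually.of_forall fun θ _ => Aw_bound_summable α h)
    (by apply Continuous.intervalIntegrable; fun_prop)
    (Eventually.of_forall fun θ _ => (Rb_hasSum θ α h).mul_right _)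
  have e : ∀ m : ℕ, ∫ θ in (-Real.pi)..Real.pi, Aw m * qa θ α ^ m * Complex.exp (-(n * (θ * Complex.I))) =
      if m = n then 2 * Real.pi * Aw n * ((Real.exp (-(n * α)) : ℝ) : ℂ) else 0 := by
    intro m
    have e1 : (fun θ : ℝ => Aw m * qa θ α ^ m * Complex.exp (-(n * (θ * Complex.I)))) =
        fun θ : ℝ => (Aw m * ((Real.exp (-(m * α)) : ℝ) : ℂ)) * Complex.exp (((m - n : ℤ) : ℂ) * (θ * Complex.I)) := by
      funext θ
      rw [qa_pow, mul_assoc, mul_assoc, mul_assoc, ← Complex.exp_add]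
      congr 3; push_cast; ring
    rw [e1, intervalIntegral.integral_const_mul, exp_int]
    by_cases hmn : m = n
    · subst hmn; rw [if_pos (by ring), if_pos rfl]; ring
    · rw [if_neg (by omega), if_neg hmn, mul_zero]
  simp_rw [e] at key
  exact key.unique (hasSum_ite_eq n _)

/-- conjugation symmetry -/
lemma Rb_conj (q : ℂ) : Rb (starRingEnd ℂ q) om = starRingEnd ℂ (Rb q om) := by
  unfold Rb
  rw [Complex.conj_tsum]
  congr 1
  funext n
  rw [Tt_eq, Tt_eq, map_prod]
  refine Finset.prod_congr rfl fun j _ => ?_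
  unfold Fq
  simp only [map_div₀, map_mul, map_add, map_pow, map_one]

lemma qa_conj (θ α : ℝ) : qa (-θ) α = starRingEnd ℂ (qa θ α) := by
  unfold qa
  rw [← Complex.exp_conj]
  congr 1
  simp
  ring

end M2

namespace M2
open Filter Topology

/-- the rescaled kernel -/
noncomputable def gk (t : ℂ) : ℂ := t*Rb (om*Complex.exp (-t)) om / Wt t * Complex.exp (-(Cc/t))

noncomputable def tv (s u : ℝ) : ℂ := ((s^2 : ℝ) : ℂ) * (1 - ((s*u : ℝ) : ℂ) * Complex.I)

noncomputable def F0 (s u : ℝ) : ℂ :=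
  (s : ℂ) * Rb (qa (2*Real.pi/3 + s^3*u) (s^2)) om * Complex.exp (-(((Cc/s^4*(s^3*u) : ℝ) : ℂ) * Complex.I))
    * ((Real.exp (-(Cc/s^2)) : ℝ) : ℂ)

noncomputable def F1 (s u : ℝ) : ℂ := (Set.Icc (-(1/s)) (1/s)).indicator (F0 s) u

lemma Cc_pos : 0 < Cc := by unfold Cc; positivity

lemma tv_re (s u : ℝ) : (tv s u).re = s^2 := by
  unfold tv; rw [Complex.re_ofReal_mul]; simp
lemma tv_im (s u : ℝ) : (tv s u).im = -(s^3*u) := by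
  unfold tv; rw [Complex.im_ofReal_mul]; simp; ring

lemma tv_sec (s u : ℝ) (hs : 0 < s) (hu : |s*u| ≤ 1) : tv s u ∈ Sec := by
  refine ⟨?_, ?_⟩
  · rw [tv_re]; positivity
  · rw [tv_re, tv_im, abs_neg]
    have : s^3*u = s^2*(s*u) := by ring
    rw [this, abs_mul, abs_of_pos (by positivity : 0 < s^2)]
    nlinarith [sq_nonneg s]

lemma tv_norm (s u : ℝ) (hu : |s*u| ≤ 1) : ‖tv s u‖ ≤ 2*s^2 := by
  unfold tv
  rw [norm_mul, Complex.norm_real, Real.norm_of_nonneg (sq_nonneg s)]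
  have : ‖(1 - ((s*u : ℝ) : ℂ) * Complex.I)‖ ≤ 2 := by
    refine (norm_sub_le _ _).trans ?_
    rw [norm_mul, Complex.norm_I, Complex.norm_real, norm_one, Real.norm_eq_abs]; linarith
  nlinarith [sq_nonneg s]

lemma qa_tv (s u : ℝ) : qa (2*Real.pi/3 + s^3*u) (s^2) = om * Complex.exp (-(tv s u)) := by
  rw [qa_shift _ (2*Real.pi/3)]
  unfold om tv
  congr 1
  · congr 1; push_cast; ring
  · congr 2; push_cast; ring

lemma one_sub_ne (x : ℝ) : (1 - (x : ℂ) * Complex.I) ≠ 0 := by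
  intro h
  have := congrArg Complex.re h
  simp at this

lemma one_sub_norm (x : ℝ) : 1 ≤ ‖(1 - (x : ℂ) * Complex.I)‖ := by
  have := Complex.abs_re_le_norm (1 - (x : ℂ) * Complex.I)
  simpa using this

lemma F0_eq (s u : ℝ) (hs : 0 < s) (hu : |s*u| ≤ 1) :
    F0 s u = gk (tv s u) * ((Real.sqrt (18/Real.pi) : ℝ) : ℂ) *
      ((1 - ((s*u : ℝ) : ℂ) * Complex.I)^(1/2:ℂ) / (1 - ((s*u : ℝ) : ℂ) * Complex.I)) *
      Complex.exp (-((Cc*u^2 : ℝ) : ℂ)/(1 - ((s*u : ℝ) : ℂ) * Complex.I)) := by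
  have hsec := tv_sec s u hs hu
  have hw := Wt_ne _ hsec.1
  have ht := sec_ne _ hsec.1
  have h1 := one_sub_ne (s*u)
  have hsC : (s : ℂ) ≠ 0 := by exact_mod_cast hs.ne'
  have hW : Wt (tv s u) = ((Real.sqrt (18/Real.pi) : ℝ) : ℂ) * s * (1 - ((s*u : ℝ) : ℂ) * Complex.I)^(1/2:ℂ) := by
    unfold Wt tv
    have e : (18 * (((s^2 : ℝ) : ℂ) * (1 - ((s*u : ℝ) : ℂ) * Complex.I)) / (Real.pi : ℂ)) =
      ((18/Real.pi*s^2 : ℝ) : ℂ) * (1 - ((s*u : ℝ) : ℂ) * Complex.I) := by push_cast; ring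
    have hr : 0 < 18/Real.pi*s^2 := by positivity
    have hrC : ((18/Real.pi*s^2 : ℝ) : ℂ) ≠ 0 := by exact_mod_cast hr.ne'
    have hsq : Real.sqrt (18/Real.pi*s^2) = Real.sqrt (18/Real.pi) * s := by
      rw [Real.sqrt_mul (by positivity), Real.sqrt_sq hs.le]
    rw [e, Complex.cpow_def_of_ne_zero (mul_ne_zero hrC h1), Complex.log_ofReal_mul hr h1, add_mul, Complex.exp_add,
      Complex.cpow_def_of_ne_zero h1, ← Complex.ofReal_mul, ← hsq, Real.sqrt_eq_rpow, Real.rpow_def_of_pos hr]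
    push_cast
    rfl
  have hE : Complex.exp (-(((Cc/s^4*(s^3*u) : ℝ) : ℂ) * Complex.I)) * ((Real.exp (-(Cc/s^2)) : ℝ) : ℂ)
     = Complex.exp (-(Cc/tv s u)) * Complex.exp (-((Cc*u^2 : ℝ) : ℂ)/(1 - ((s*u : ℝ) : ℂ) * Complex.I)) := by
    rw [Complex.ofReal_exp, ← Complex.exp_add, ← Complex.exp_add]
    congr 1
    unfold tv
    have hI : Complex.I^2 = -1 := Complex.I_sq
    push_cast at h1 ⊢
    field_simp
    ring_nf
    rw [hI]
    ring
  unfold F0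
  rw [qa_tv, mul_assoc _ (Complex.exp _) _, hE]
  unfold gk
  rw [hW] at hw ⊢
  generalize Complex.exp (-(Cc/tv s u)) = E1
  generalize Complex.exp (-((Cc*u^2 : ℝ) : ℂ)/(1 - ((s*u : ℝ) : ℂ) * Complex.I)) = E2
  generalize Rb (om * Complex.exp (-tv s u)) om = R
  unfold tv
  generalize (1 - ((s*u : ℝ) : ℂ) * Complex.I)^(1/2:ℂ) = p at *
  generalize (1 - ((s*u : ℝ) : ℂ) * Complex.I) = w at *
  have hp : p ≠ 0 := right_ne_zero_of_mul hw
  have hq := left_ne_zero_of_mul (left_ne_zero_of_mul hw)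
  generalize ((Real.sqrt (18/Real.pi) : ℝ) : ℂ) = z at *
  push_cast
  field_simp

end M2

namespace M2
open Filter Topology MeasureTheory

lemma h_norm (x : ℝ) : ‖(1 - (x : ℂ) * Complex.I)^(1/2:ℂ) / (1 - (x : ℂ) * Complex.I)‖ ≤ 1 := by
  have h1 := one_sub_norm x
  have e : (1/2:ℂ) = ((1/2:ℝ):ℂ) := by push_cast; ring
  rw [norm_div, e, Complex.norm_cpow_real, div_le_one (by linarith)]
  calc ‖(1 - (x : ℂ) * Complex.I)‖ ^ (1/2:ℝ) ≤ ‖(1 - (x : ℂ) * Complex.I)‖ ^ (1:ℝ) :=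
        Real.rpow_le_rpow_of_exponent_le h1 (by norm_num)
    _ = _ := Real.rpow_one _

lemma e_norm (u x : ℝ) (hx : |x| ≤ 1) :
    ‖Complex.exp (-((Cc*u^2 : ℝ) : ℂ)/(1 - (x : ℂ) * Complex.I))‖ ≤ Real.exp (-(Cc/2)*u^2) := by
  rw [Complex.norm_exp]
  apply Real.exp_le_exp.mpr
  have hN : Complex.normSq (1 - (x : ℂ) * Complex.I) = 1 + x^2 := by
    rw [Complex.normSq_apply]; simp; ring
  rw [Complex.div_re, hN]
  have hx2 : x^2 ≤ 1 := by rw [← sq_abs]; nlinarith [abs_nonneg x]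
  have e1 : (-((Cc*u^2 : ℝ) : ℂ)).re = -(Cc*u^2) := by rw [Complex.neg_re, Complex.ofReal_re]
  have e2 : (-((Cc*u^2 : ℝ) : ℂ)).im = 0 := by rw [Complex.neg_im, Complex.ofReal_im, neg_zero]
  have e3 : (1 - (x : ℂ) * Complex.I).re = 1 := by simp
  rw [e1, e2, e3, zero_mul, zero_div, add_zero, mul_one, div_le_iff₀ (by positivity)]
  have := mul_nonneg Cc_pos.le (sq_nonneg u)
  nlinarith

lemma F0_cont (s : ℝ) (hs : 0 < s) : Continuous (F0 s) := by
  unfold F0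
  have h := Rb_cont (s^2) (by positivity)
  have h2 : Continuous (fun u : ℝ => Rb (qa (2*Real.pi/3 + s^3*u) (s^2)) om) :=
    h.comp (by fun_prop : Continuous fun u : ℝ => 2*Real.pi/3 + s^3*u)
  fun_prop

lemma gk_lim : Tendsto gk (𝓝[Sec] 0) (𝓝 ((-(Real.pi / (3 * Real.sqrt 6)) : ℝ))) := Rb_lim

lemma mem_abs (s u : ℝ) (hs : 0 < s) : u ∈ Set.Icc (-(1/s)) (1/s) ↔ |s*u| ≤ 1 := by
  rw [abs_le, Set.mem_Icc, ← neg_div, div_le_iff₀ hs, le_div_iff₀ hs, mul_comm u s]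

lemma gk_bd : ∃ M > 0, ∀ᶠ s in 𝓝[>] (0:ℝ), ∀ u : ℝ, |s*u| ≤ 1 → ‖gk (tv s u)‖ ≤ M := by
  have h := gk_lim.norm
  set c := ‖((-(Real.pi / (3 * Real.sqrt 6)) : ℝ) : ℂ)‖ with hc
  refine ⟨c + 1, by positivity, ?_⟩
  have h1 : ∀ᶠ t in 𝓝[Sec] (0:ℂ), ‖gk t‖ ≤ c + 1 := (h.eventually (ge_mem_nhds (by linarith : c < c+1)))
  rw [eventually_nhdsWithin_iff, Metric.eventually_nhds_iff] at h1
  obtain ⟨δ, hδ, h1⟩ := h1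
  have hs0 : Tendsto (fun s : ℝ => 2*s^2) (𝓝[>] 0) (𝓝 0) := by
    have : Tendsto (fun s : ℝ => 2*s^2) (𝓝 0) (𝓝 (2*0^2)) := (by fun_prop : Continuous fun s : ℝ => 2*s^2).tendsto 0
    simp only [ne_eq, OfNat.ofNat_ne_zero, not_false_eq_true, zero_pow, mul_zero] at this
    exact this.mono_left nhdsWithin_le_nhds
  filter_upwards [hs0.eventually (gt_mem_nhds hδ), self_mem_nhdsWithin] with s hs hs' u hu
  refine h1 ?_ (tv_sec s u hs' hu)
  rw [dist_zero_right]
  exact (tv_norm s u hu).trans_lt hs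

lemma F1_lim : Tendsto (fun s => ∫ u, F1 s u) (𝓝[>] 0)
    (𝓝 (∫ u : ℝ, ((-(Real.pi / (3 * Real.sqrt 6)) : ℝ) : ℂ) * ((Real.sqrt (18/Real.pi) : ℝ) : ℂ) * ((Real.exp (-Cc*u^2) : ℝ) : ℂ))) := by
  obtain ⟨M, hM, hb⟩ := gk_bd
  refine tendsto_integral_filter_of_dominated_convergence
    (fun u => M * Real.sqrt (18/Real.pi) * Real.exp (-(Cc/2)*u^2)) ?_ ?_ ?_ ?_
  · filter_upwards [self_mem_nhdsWithin] with s hs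
    exact ((F0_cont s hs).aestronglyMeasurable).indicator measurableSet_Icc
  · filter_upwards [hb, self_mem_nhdsWithin] with s h hs
    refine Eventually.of_forall fun u => ?_
    unfold F1
    by_cases hu : u ∈ Set.Icc (-(1/s)) (1/s)
    · rw [Set.indicator_of_mem hu]
      have hu' := (mem_abs s u hs).1 hu
      rw [F0_eq s u hs hu', norm_mul, norm_mul, norm_mul, Complex.norm_real, Real.norm_of_nonneg (Real.sqrt_nonneg _)]
      have h1 := h u hu'
      have h2 := h_norm (s*u)
      have h3 := e_norm u (s*u) hu'
      calc _ ≤ M * Real.sqrt (18/Real.pi) * 1 * Real.exp (-(Cc/2)*u^2) := by gcongr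
        _ = _ := by ring
    · rw [Set.indicator_of_notMem hu, norm_zero]; positivity
  · exact (integrable_exp_neg_mul_sq (half_pos Cc_pos)).const_mul _
  · refine Eventually.of_forall fun u => ?_
    have hx : Tendsto (fun s : ℝ => s*u) (𝓝[>] 0) (𝓝 0) := by
      have : Tendsto (fun s : ℝ => s*u) (𝓝 0) (𝓝 (0*u)) := (by fun_prop : Continuous fun s : ℝ => s*u).tendsto 0
      rw [zero_mul] at this
      exact this.mono_left nhdsWithin_le_nhds
    have hev : ∀ᶠ s in 𝓝[>] (0:ℝ), |s*u| ≤ 1 := by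
      have := hx.abs
      rw [abs_zero] at this
      exact this.eventually (ge_mem_nhds (by norm_num))
    have hE : (fun s => F1 s u) =ᶠ[𝓝[>] 0] fun s => gk (tv s u) * ((Real.sqrt (18/Real.pi) : ℝ) : ℂ) *
      ((1 - ((s*u : ℝ) : ℂ) * Complex.I)^(1/2:ℂ) / (1 - ((s*u : ℝ) : ℂ) * Complex.I)) *
      Complex.exp (-((Cc*u^2 : ℝ) : ℂ)/(1 - ((s*u : ℝ) : ℂ) * Complex.I)) := by
      filter_upwards [hev, self_mem_nhdsWithin] with s h hs
      unfold F1
      rw [Set.indicator_of_mem ((mem_abs s u hs).2 h), F0_eq s u hs h]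
    refine Tendsto.congr' hE.symm ?_
    have hw : Tendsto (fun s : ℝ => (1 - ((s*u : ℝ) : ℂ) * Complex.I)) (𝓝[>] 0) (𝓝 1) := by
      have h0 := (Complex.continuous_ofReal.tendsto 0).comp hx
      have := (h0.mul_const Complex.I).const_sub 1
      simpa using this
    have hp : Tendsto (fun s : ℝ => (1 - ((s*u : ℝ) : ℂ) * Complex.I)^(1/2:ℂ)) (𝓝[>] 0) (𝓝 1) := by
      have := (continuousAt_cpow_const (a := (1:ℂ)) (b := (1/2:ℂ)) (by simp)).tendsto.comp hw
      simp only [Complex.one_cpow] at this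
      exact this
    have htv : Tendsto (fun s : ℝ => tv s u) (𝓝[>] 0) (𝓝[Sec] 0) := by
      refine tendsto_nhdsWithin_iff.2 ⟨?_, ?_⟩
      · have h2 : Tendsto (fun s : ℝ => ((s^2 : ℝ) : ℂ)) (𝓝[>] 0) (𝓝 0) := by
          have : Tendsto (fun s : ℝ => ((s^2 : ℝ) : ℂ)) (𝓝 0) (𝓝 (((0:ℝ)^2 : ℝ) : ℂ)) :=
            (by fun_prop : Continuous fun s : ℝ => ((s^2 : ℝ) : ℂ)).tendsto 0
          have e : (((0:ℝ)^2 : ℝ) : ℂ) = 0 := by norm_num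
          rw [e] at this
          exact this.mono_left nhdsWithin_le_nhds
        have := h2.mul hw
        rw [zero_mul] at this
        exact this
      · filter_upwards [hev, self_mem_nhdsWithin] with s h hs using tv_sec s u hs h
    have he : Tendsto (fun s : ℝ => Complex.exp (-((Cc*u^2 : ℝ) : ℂ)/(1 - ((s*u : ℝ) : ℂ) * Complex.I))) (𝓝[>] 0)
        (𝓝 ((Real.exp (-Cc*u^2) : ℝ) : ℂ)) := by
      have := (Complex.continuous_exp.tendsto _).comp ((tendsto_const_nhds (x := -((Cc*u^2 : ℝ) : ℂ))).div hw one_ne_zero)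
      have e : Complex.exp (-((Cc*u^2 : ℝ) : ℂ)/1) = ((Real.exp (-Cc*u^2) : ℝ) : ℂ) := by
        rw [Complex.ofReal_exp]; congr 1; push_cast; ring
      rw [e] at this
      exact this
    have := (((gk_lim.comp htv).mul_const ((Real.sqrt (18/Real.pi) : ℝ) : ℂ)).mul (hp.div hw one_ne_zero)).mul he
    rw [div_one, mul_one] at this
    exact this

lemma gauss_val : (∫ u : ℝ, ((-(Real.pi / (3 * Real.sqrt 6)) : ℝ) : ℂ) * ((Real.sqrt (18/Real.pi) : ℝ) : ℂ) * ((Real.exp (-Cc*u^2) : ℝ) : ℂ))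
   = ((-2*Real.sqrt 6 : ℝ) : ℂ) := by
  have e : (fun u : ℝ => ((-(Real.pi / (3 * Real.sqrt 6)) : ℝ) : ℂ) * ((Real.sqrt (18/Real.pi) : ℝ) : ℂ) * ((Real.exp (-Cc*u^2) : ℝ) : ℂ))
     = fun u : ℝ => ((-(Real.pi / (3 * Real.sqrt 6)) * Real.sqrt (18/Real.pi) * Real.exp (-Cc*u^2) : ℝ) : ℂ) := by
    funext u; push_cast; ring
  rw [e, integral_complex_ofReal, integral_const_mul, integral_gaussian]
  congr 1
  have hpi := Real.pi_pos
  have h1 : Real.sqrt (18/Real.pi) * Real.sqrt (Real.pi/Cc) = 36/Real.pi := by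
    rw [← Real.sqrt_mul (by positivity)]
    rw [Real.sqrt_eq_iff_mul_self_eq (by unfold Cc; positivity) (by positivity)]
    unfold Cc; field_simp; norm_num
  rw [mul_assoc, h1]
  have h6 : Real.sqrt 6 * Real.sqrt 6 = 6 := Real.mul_self_sqrt (by norm_num)
  field_simp
  nlinarith

noncomputable def J1 (s : ℝ) : ℂ := ∫ φ in (-(s^2))..(s^2), Rb (qa (2*Real.pi/3 + φ) (s^2)) om * Complex.exp (-(((Cc/s^4*φ : ℝ) : ℂ) * Complex.I))

lemma F1_J1 (s : ℝ) (hs : 0 < s) : ∫ u, F1 s u = J1 s * ((Real.exp (-(Cc/s^2))/s^2 : ℝ) : ℂ) := by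
  have hsC : (s : ℂ) ≠ 0 := by exact_mod_cast hs.ne'
  have h1 : (-(1/s)) ≤ 1/s := by
    have : 0 < 1/s := by positivity
    linarith
  unfold F1 J1
  rw [integral_indicator measurableSet_Icc, integral_Icc_eq_integral_Ioc, ← intervalIntegral.integral_of_le h1]
  have e : F0 s = fun u => ((s : ℂ) * ((Real.exp (-(Cc/s^2)) : ℝ) : ℂ)) *
     (fun φ : ℝ => Rb (qa (2*Real.pi/3 + φ) (s^2)) om * Complex.exp (-(((Cc/s^4*φ : ℝ) : ℂ) * Complex.I))) (s^3*u) := by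
    funext u; unfold F0; ring
  rw [e, intervalIntegral.integral_const_mul,
    intervalIntegral.integral_comp_mul_left
      (fun φ : ℝ => Rb (qa (2*Real.pi/3 + φ) (s^2)) om * Complex.exp (-(((Cc/s^4*φ : ℝ) : ℂ) * Complex.I))) (by positivity : s^3 ≠ 0)]
  have e2 : s^3 * (-(1/s)) = -(s^2) := by field_simp
  have e3 : s^3 * (1/s) = s^2 := by field_simp
  rw [e2, e3]
  generalize (∫ φ in (-(s^2))..(s^2), Rb (qa (2*Real.pi/3 + φ) (s^2)) om * Complex.exp (-(((Cc/s^4*φ : ℝ) : ℂ) * Complex.I))) = K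
  generalize Real.exp (-(Cc/s^2)) = E
  rw [Complex.real_smul]
  push_cast
  field_simp

theorem J1_lim : Tendsto (fun s => J1 s * ((Real.exp (-(Cc/s^2))/s^2 : ℝ) : ℂ)) (𝓝[>] 0) (𝓝 ((-2*Real.sqrt 6 : ℝ) : ℂ)) := by
  rw [← gauss_val]
  refine F1_lim.congr' ?_
  filter_upwards [self_mem_nhdsWithin] with s hs using F1_J1 s hs

end M2

namespace M2
open Filter Topology MeasureTheory

noncomputable def Gi (n : ℕ) (α θ : ℝ) : ℂ := Rb (qa θ α) om * Complex.exp (-(n*(θ*Complex.I)))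

lemma Gi_cont (n : ℕ) (α : ℝ) (h : 0 < α) : Continuous (Gi n α) := by
  unfold Gi
  have := Rb_cont α h
  fun_prop

lemma Gi_norm (n : ℕ) (α θ : ℝ) : ‖Gi n α θ‖ = ‖Rb (qa θ α) om‖ := by
  unfold Gi
  rw [norm_mul]
  have : -((n:ℂ)*(θ*Complex.I)) = ((-(n*θ) : ℝ) : ℂ) * Complex.I := by push_cast; ring
  rw [this, Complex.norm_exp_ofReal_mul_I, mul_one]

lemma Gi_neg (n : ℕ) (α θ : ℝ) : Gi n α (-θ) = starRingEnd ℂ (Gi n α θ) := by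
  unfold Gi
  rw [qa_conj, Rb_conj, map_mul, ← Complex.exp_conj]
  congr 2
  simp

noncomputable def Ki (n : ℕ) (α : ℝ) : ℂ := ∫ θ in (0:ℝ)..Real.pi, Gi n α θ

lemma full_eq (n : ℕ) (α : ℝ) (h : 0 < α) :
    2*Real.pi*Aw n*((Real.exp (-(n*α)) : ℝ) : ℂ) = Ki n α + starRingEnd ℂ (Ki n α) := by
  rw [← fourier_coef α h n]
  change ∫ θ in (-Real.pi)..Real.pi, Gi n α θ = _
  have hi := fun a b => (Gi_cont n α h).intervalIntegrable (μ := volume) a b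
  rw [← intervalIntegral.integral_add_adjacent_intervals (hi (-Real.pi) 0) (hi 0 Real.pi), add_comm]
  congr 1
  have h1 := intervalIntegral.integral_comp_neg (a := 0) (b := Real.pi) (Gi n α)
  rw [neg_zero] at h1
  rw [← h1]
  simp_rw [Gi_neg]
  unfold Ki
  rw [intervalIntegral.integral_of_le Real.pi_pos.le, intervalIntegral.integral_of_le Real.pi_pos.le]
  exact integral_conj

noncomputable def wn (n : ℕ) : ℂ := Complex.exp (-(n*((2*Real.pi/3 : ℝ)*Complex.I)))

lemma mid_eq (n : ℕ) (s : ℝ) (hn : (n : ℝ) = Cc/s^4) :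
    ∫ θ in (2*Real.pi/3 - s^2)..(2*Real.pi/3 + s^2), Gi n (s^2) θ = wn n * J1 s := by
  have h1 := intervalIntegral.integral_comp_add_left (a := -(s^2)) (b := s^2) (Gi n (s^2)) (2*Real.pi/3)
  rw [← sub_eq_add_neg] at h1
  rw [← h1]
  unfold J1
  rw [← intervalIntegral.integral_const_mul]
  congr 1
  funext φ
  unfold Gi wn
  rw [← hn]
  have : Complex.exp (-(n*(((2*Real.pi/3 + φ : ℝ):ℂ)*Complex.I))) =
    Complex.exp (-(n*((2*Real.pi/3 : ℝ)*Complex.I))) * Complex.exp (-(((n*φ : ℝ) : ℂ) * Complex.I)) := by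
    rw [← Complex.exp_add]; congr 1; push_cast; ring
  rw [this]; ring

lemma Ki_err : ∃ η > 0, ∀ᶠ s in 𝓝[>] (0:ℝ), ∀ n : ℕ, (n : ℝ) = Cc/s^4 →
    ‖Ki n (s^2) - wn n * J1 s‖ ≤ 2*Real.pi*Real.exp ((Cc-η)/s^2) := by
  obtain ⟨η, hη, hm⟩ := minor_arcs
  refine ⟨η, hη, ?_⟩
  have hs0 : Tendsto (fun s : ℝ => s^2) (𝓝[>] 0) (𝓝[>] 0) := by
    refine tendsto_nhdsWithin_iff.2 ⟨?_, ?_⟩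
    · have : Tendsto (fun s : ℝ => s^2) (𝓝 0) (𝓝 (0^2)) := (by fun_prop : Continuous fun s : ℝ => s^2).tendsto 0
      simp only [ne_eq, OfNat.ofNat_ne_zero, not_false_eq_true, zero_pow] at this
      exact this.mono_left nhdsWithin_le_nhds
    · filter_upwards [self_mem_nhdsWithin] with s hs
      have : 0 < s := hs
      exact (by positivity : 0 < s^2)
  have hsm : ∀ᶠ s in 𝓝[>] (0:ℝ), s^2 < 1 :=
    (tendsto_nhdsWithin_iff.1 hs0).1.eventually (gt_mem_nhds one_pos)
  filter_upwards [hs0.eventually hm, hsm, self_mem_nhdsWithin] with s h h1 hs n hn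
  have hspos : 0 < s := hs
  have hs2 : 0 < s^2 := by positivity
  have hpi := Real.pi_gt_three
  have hi := fun a b => (Gi_cont n (s^2) hs2).intervalIntegrable (μ := volume) a b
  have hK : Ki n (s^2) - wn n * J1 s = (∫ θ in (0:ℝ)..(2*Real.pi/3 - s^2), Gi n (s^2) θ) +
      ∫ θ in (2*Real.pi/3 + s^2)..Real.pi, Gi n (s^2) θ := by
    unfold Ki
    rw [← mid_eq n s hn, ← intervalIntegral.integral_add_adjacent_intervals (hi 0 (2*Real.pi/3 - s^2)) (hi _ Real.pi),
      ← intervalIntegral.integral_add_adjacent_intervals (hi (2*Real.pi/3 - s^2) (2*Real.pi/3 + s^2)) (hi _ Real.pi)]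
    ring
  have hpos : 0 ≤ Real.exp ((Cc-η)/s^2) := (Real.exp_pos _).le
  have hA : ‖∫ θ in (0:ℝ)..(2*Real.pi/3 - s^2), Gi n (s^2) θ‖ ≤ Real.exp ((Cc-η)/s^2) * |2*Real.pi/3 - s^2 - 0| := by
    refine intervalIntegral.norm_integral_le_of_norm_le_const_ae ?_
    have : ∀ᵐ x : ℝ, x ≠ 2*Real.pi/3 - s^2 := by
      rw [ae_iff]; simp
    filter_upwards [this] with x hx hxm
    rw [Set.uIoc_of_le (by linarith)] at hxm
    have hlt := lt_of_le_of_ne hxm.2 hx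
    rw [Gi_norm]
    refine h x ⟨by linarith [hxm.1], by linarith⟩ ?_ ?_
    · rw [abs_of_neg (by linarith)]; linarith
    · rw [abs_of_pos (by linarith [hxm.1])]; linarith [hxm.1]
  have hB : ‖∫ θ in (2*Real.pi/3 + s^2)..Real.pi, Gi n (s^2) θ‖ ≤ Real.exp ((Cc-η)/s^2) * |Real.pi - (2*Real.pi/3 + s^2)| := by
    by_cases hle : 2*Real.pi/3 + s^2 ≤ Real.pi
    · refine intervalIntegral.norm_integral_le_of_norm_le_const ?_
      intro x hxm
      rw [Set.uIoc_of_le hle] at hxm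
      rw [Gi_norm]
      refine h x ⟨by linarith [hxm.1], hxm.2⟩ ?_ ?_
      · rw [abs_of_pos (by linarith [hxm.1])]; linarith [hxm.1]
      · rw [abs_of_pos (by linarith [hxm.1])]; linarith [hxm.1]
    · exfalso; linarith
  have hA' : |2*Real.pi/3 - s^2 - 0| ≤ Real.pi := by rw [abs_le]; constructor <;> linarith
  have hB' : |Real.pi - (2*Real.pi/3 + s^2)| ≤ Real.pi := by rw [abs_le]; constructor <;> linarith
  rw [hK]
  refine (norm_add_le _ _).trans ?_
  have := mul_le_mul_of_nonneg_left hA' hpos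
  have := mul_le_mul_of_nonneg_left hB' hpos
  linarith

noncomputable def sn (n : ℕ) : ℝ := Real.sqrt (Real.sqrt (Cc/n))

lemma sn_pos (n : ℕ) (h : 0 < n) : 0 < sn n := by
  have := Cc_pos
  unfold sn; positivity

lemma sn_sq (n : ℕ) : sn n^2 = Real.sqrt (Cc/n) := Real.sq_sqrt (Real.sqrt_nonneg _)

lemma sn_four (n : ℕ) (h : 0 < n) : (n : ℝ) = Cc/sn n^4 := by
  have hc := Cc_pos
  have : sn n^4 = Cc/n := by
    rw [show sn n^4 = (sn n^2)^2 by ring, sn_sq, Real.sq_sqrt (by positivity)]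
  rw [this]; field_simp

lemma sn_lim : Tendsto sn atTop (𝓝[>] 0) := by
  refine tendsto_nhdsWithin_iff.2 ⟨?_, ?_⟩
  · have h0 : Tendsto (fun n : ℕ => Cc/(n:ℝ)) atTop (𝓝 0) := tendsto_const_div_atTop_nhds_zero_nat Cc
    have := (h0.sqrt).sqrt
    rw [Real.sqrt_zero, Real.sqrt_zero] at this
    exact this
  · filter_upwards [eventually_gt_atTop 0] with n hn using sn_pos n hn

lemma wn_norm (n : ℕ) : ‖wn n‖ = 1 := by
  unfold wn
  have : -((n:ℂ)*((2*Real.pi/3 : ℝ)*Complex.I)) = ((-(n*(2*Real.pi/3)) : ℝ) : ℂ) * Complex.I := by push_cast; ring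
  rw [this, Complex.norm_exp_ofReal_mul_I]

lemma wn_sum (n : ℕ) : wn n + starRingEnd ℂ (wn n) = ((if n % 3 = 0 then 2 else -1 : ℝ) : ℂ) := by
  have h1 : starRingEnd ℂ (wn n) = om^n := by
    unfold wn om
    rw [← Complex.exp_conj, ← Complex.exp_nat_mul]
    congr 1
    rw [map_neg, map_mul, map_mul, Complex.conj_ofReal, Complex.conj_I, map_natCast]
    push_cast
    ring
  have h2 : wn n = om^(2*n) := by
    have e : wn n * om^n = 1 := by
      unfold wn om
      rw [← Complex.exp_nat_mul, ← Complex.exp_add, Complex.exp_eq_one_iff]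
      exact ⟨0, by push_cast; ring⟩
    have e2 : om^(2*n) * om^n = 1 := by
      rw [← pow_add, show 2*n+n = 3*n by ring, pow_mul, om_cube, one_pow]
    exact mul_right_cancel₀ (pow_ne_zero n om_ne) (e.trans e2.symm)
  rw [h1, h2]
  have hd : n = 3*(n/3) + n%3 := by omega
  have hp : om^n = om^(n%3) := by
    conv_lhs => rw [hd, pow_add, pow_mul, om_cube, one_pow, one_mul]
  rw [mul_comm 2 n, pow_mul, hp]
  have hs := om_sum
  have h3 : n % 3 < 3 := Nat.mod_lt _ (by norm_num)
  have hc := om_cube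
  interval_cases n % 3
  · norm_num
  · norm_num; linear_combination hs
  · norm_num; linear_combination hs + om * hc

end M2

namespace M2
open Filter Topology MeasureTheory

noncomputable def ep (n : ℕ) : ℝ := if n % 3 = 0 then (-4) * Real.sqrt 6 else 2 * Real.sqrt 6

lemma ep_eq (n : ℕ) : ((ep n : ℝ) : ℂ) = ((-2*Real.sqrt 6 : ℝ) : ℂ) * (wn n + starRingEnd ℂ (wn n)) := by
  rw [wn_sum, ← Complex.ofReal_mul]
  congr 1
  unfold ep
  split_ifs <;> ring

lemma ep_abs (n : ℕ) : 1 ≤ |ep n| := by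
  have h6 : 1 ≤ Real.sqrt 6 := Real.one_le_sqrt.2 (by norm_num)
  unfold ep
  split_ifs
  · rw [abs_of_neg (by linarith)]; linarith
  · rw [abs_of_pos (by linarith)]; linarith

noncomputable def Qn (n : ℕ) : ℂ := 2*Real.pi*Aw n*((Real.exp (-(2*(Cc/sn n^2)))/sn n^2 : ℝ) : ℂ)

lemma sn_mul (n : ℕ) (h : 0 < n) : n * sn n^2 = Cc/sn n^2 := by
  have := sn_pos n h
  conv_lhs => rw [sn_four n h]
  field_simp

lemma err_lim (η : ℝ) (hη : 0 < η) :
    Tendsto (fun α : ℝ => 2*Real.pi*Real.exp ((Cc-η)/α)*(Real.exp (-(Cc/α))/α)) (𝓝[>] 0) (𝓝 0) := by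
  have h1 : Tendsto (fun α : ℝ => α⁻¹) (𝓝[>] 0) atTop := tendsto_inv_nhdsGT_zero
  have h2 := (tendsto_rpow_mul_exp_neg_mul_atTop_nhds_zero 1 η hη).comp h1
  have h3 := h2.const_mul (2*Real.pi)
  rw [mul_zero] at h3
  refine h3.congr' ?_
  filter_upwards [self_mem_nhdsWithin] with α hα
  simp only [Function.comp, Real.rpow_one]
  have : Real.exp ((Cc-η)/α) * Real.exp (-(Cc/α)) = Real.exp (-η*α⁻¹) := by
    rw [← Real.exp_add]; congr 1; field_simp; ring
  rw [← this]; ring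

lemma Q_lim : Tendsto (fun n => Qn n - (ep n : ℂ)) atTop (𝓝 0) := by
  obtain ⟨η, hη, hE⟩ := Ki_err
  have hJ := J1_lim.comp sn_lim
  have hs2 : Tendsto (fun n => sn n^2) atTop (𝓝[>] 0) := by
    have h := tendsto_nhdsWithin_iff.1 sn_lim
    refine tendsto_nhdsWithin_iff.2 ⟨?_, ?_⟩
    · have := h.1.pow 2
      simp only [ne_eq, OfNat.ofNat_ne_zero, not_false_eq_true, zero_pow] at this
      exact this
    · filter_upwards [h.2] with n hn
      have : 0 < sn n := hn
      exact (by positivity : 0 < sn n^2)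
  have hK : Tendsto (fun n => (Ki n (sn n^2) - wn n * J1 (sn n)) * ((Real.exp (-(Cc/sn n^2))/sn n^2 : ℝ) : ℂ)) atTop (𝓝 0) := by
    refine squeeze_zero_norm' ?_ ((err_lim η hη).comp hs2)
    filter_upwards [sn_lim.eventually hE, eventually_gt_atTop 0] with n h hn
    have hp := sn_pos n hn
    rw [norm_mul, Complex.norm_real, Real.norm_of_nonneg (by positivity)]
    exact mul_le_mul_of_nonneg_right (h n (sn_four n hn)) (by positivity)
  have hJ0 : Tendsto (fun n => wn n * (J1 (sn n) * ((Real.exp (-(Cc/sn n^2))/sn n^2 : ℝ) : ℂ) - ((-2*Real.sqrt 6 : ℝ) : ℂ))) atTop (𝓝 0) := by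
    have := (hJ.sub_const ((-2*Real.sqrt 6 : ℝ) : ℂ)).norm
    rw [sub_self, norm_zero] at this
    refine squeeze_zero_norm (fun n => ?_) this
    rw [norm_mul, wn_norm, one_mul]; rfl
  have hS := hK.add hJ0
  rw [add_zero] at hS
  have hC := hS.add ((Complex.continuous_conj.tendsto 0).comp hS)
  rw [map_zero, add_zero] at hC
  refine hC.congr' ?_
  filter_upwards [eventually_gt_atTop 0] with n hn
  have hp := sn_pos n hn
  have hf := full_eq n (sn n^2) (by positivity)
  have hq : Qn n = (Ki n (sn n^2) + starRingEnd ℂ (Ki n (sn n^2))) * ((Real.exp (-(Cc/sn n^2))/sn n^2 : ℝ) : ℂ) := by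
    rw [← hf, sn_mul n hn]
    unfold Qn
    rw [mul_assoc _ ((Real.exp (-(Cc/sn n^2)) : ℝ) : ℂ), ← Complex.ofReal_mul]
    congr 2
    rw [show -(2*(Cc/sn n^2)) = -(Cc/sn n^2) + -(Cc/sn n^2) by ring, Real.exp_add]; ring
  rw [hq, ep_eq]
  simp only [Function.comp, map_add, map_sub, map_mul, Complex.conj_ofReal]
  ring

lemma Q_lim2 : Tendsto (fun n => Qn n / (ep n : ℂ)) atTop (𝓝 1) := by
  have h : Tendsto (fun n => (Qn n - (ep n : ℂ)) / (ep n : ℂ)) atTop (𝓝 0) := by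
    have := Q_lim.norm
    rw [norm_zero] at this
    refine squeeze_zero_norm (fun n => ?_) this
    rw [norm_div, Complex.norm_real, Real.norm_eq_abs]
    exact div_le_self (norm_nonneg _) (ep_abs n)
  have h1 := h.add_const 1
  rw [zero_add] at h1
  refine h1.congr fun n => ?_
  have : (ep n : ℂ) ≠ 0 := by
    have h0 := ep_abs n
    have : ep n ≠ 0 := by intro h; rw [h] at h0; norm_num at h0
    exact_mod_cast this
  field_simp
  ring

noncomputable def xn (n : ℕ) : ℝ := Real.sqrt (8*(n:ℝ) - 1)
noncomputable def yn (n : ℕ) : ℝ := Real.sqrt (8*(n:ℝ))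

lemma yn_top : Tendsto yn atTop atTop := by
  unfold yn
  exact Real.tendsto_sqrt_atTop.comp ((tendsto_natCast_atTop_atTop).const_mul_atTop (by norm_num))

lemma diff_lim : Tendsto (fun n => yn n - xn n) atTop (𝓝 0) := by
  have h1 : Tendsto (fun n => (yn n)⁻¹) atTop (𝓝 0) := tendsto_inv_atTop_zero.comp yn_top
  refine squeeze_zero' ?_ ?_ h1
  · refine Eventually.of_forall fun n => ?_
    unfold xn yn
    exact sub_nonneg.2 (Real.sqrt_le_sqrt (by linarith))
  · filter_upwards [eventually_gt_atTop 0] with n hn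
    have hn1 : (1:ℝ) ≤ n := by exact_mod_cast hn
    have hy : yn n^2 = 8*n := Real.sq_sqrt (by positivity)
    have hx : xn n^2 = 8*n-1 := Real.sq_sqrt (by linarith)
    have hx0 : 0 ≤ xn n := Real.sqrt_nonneg _
    have hy0 : 0 < yn n := Real.sqrt_pos.2 (by positivity)
    have hle : xn n ≤ yn n := Real.sqrt_le_sqrt (by linarith)
    rw [← one_div, le_div_iff₀ hy0]
    nlinarith

lemma D_lim : Tendsto (fun n => xn n / yn n * (Real.exp (Real.pi*yn n/12) / (2*Real.cosh (Real.pi*xn n/12)))) atTop (𝓝 1) := by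
  have hx : Tendsto xn atTop atTop := by
    have := yn_top.atTop_add diff_lim.neg
    refine this.congr fun n => ?_
    ring
  have h1 : Tendsto (fun n => xn n / yn n) atTop (𝓝 1) := by
    have := (diff_lim.mul (tendsto_inv_atTop_zero.comp yn_top)).const_sub 1
    rw [mul_zero, sub_zero] at this
    refine this.congr' ?_
    filter_upwards [yn_top.eventually_gt_atTop 0] with n hn
    simp only [Function.comp]
    field_simp; ring
  have h2 : Tendsto (fun n => Real.exp (Real.pi/12*(yn n - xn n))) atTop (𝓝 1) := by
    have := (Real.continuous_exp.tendsto _).comp (diff_lim.const_mul (Real.pi/12))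
    rw [mul_zero, Real.exp_zero] at this
    exact this
  have h3 : Tendsto (fun n => 1 + Real.exp (-(Real.pi/6*xn n))) atTop (𝓝 (1+0)) := by
    apply Tendsto.const_add
    exact Real.tendsto_exp_neg_atTop_nhds_zero.comp (hx.const_mul_atTop (by positivity))
  rw [add_zero] at h3
  have := h1.mul (h2.div h3 one_ne_zero)
  rw [div_one, mul_one] at this
  refine this.congr fun n => ?_
  congr 1
  rw [Real.cosh_eq, Pi.div_apply]
  have e1 : Real.exp (Real.pi*yn n/12) = Real.exp (Real.pi/12*(yn n - xn n)) * Real.exp (Real.pi*xn n/12) := by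
    rw [← Real.exp_add]; congr 1; ring
  have e2 : Real.exp (-(Real.pi*xn n/12)) = Real.exp (-(Real.pi/6*xn n)) * Real.exp (Real.pi*xn n/12) := by
    rw [← Real.exp_add]; congr 1; ring
  rw [e1, e2]
  have p1 := Real.exp_pos (Real.pi*xn n/12)
  have p2 := Real.exp_pos (-(Real.pi/6*xn n))
  generalize Real.exp (Real.pi*xn n/12) = A at *
  generalize Real.exp (-(Real.pi/6*xn n)) = B at *
  field_simp

lemma sn_yn (n : ℕ) (hn : 0 < n) : sn n^2 = Real.pi/(3*yn n) := by
  have hn1 : (0:ℝ) < n := by exact_mod_cast hn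
  have hy : yn n^2 = 8*n := Real.sq_sqrt (by positivity)
  have hy0 : 0 < yn n := Real.sqrt_pos.2 (by positivity)
  rw [sn_sq, Real.sqrt_eq_iff_mul_self_eq (by have := Cc_pos; positivity) (by positivity)]
  have : Real.pi/(3*yn n) * (Real.pi/(3*yn n)) = Real.pi^2/(9*yn n^2) := by field_simp; norm_num
  rw [this, hy]; unfold Cc; field_simp; norm_num

theorem final : Tendsto (fun n : ℕ => Acoef 1 3 n * ((3 * xn n : ℝ) : ℂ) /
    (((ep n : ℝ) : ℂ) * ((Real.cosh (Real.pi * xn n / 12) : ℝ) : ℂ))) atTop (𝓝 1) := by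
  have h := Q_lim2.mul ((Complex.continuous_ofReal.tendsto _).comp D_lim)
  rw [Complex.ofReal_one, mul_one] at h
  refine h.congr' ?_
  filter_upwards [eventually_gt_atTop 0] with n hn
  have hn1 : (0:ℝ) < n := by exact_mod_cast hn
  have hy0 : 0 < yn n := Real.sqrt_pos.2 (by positivity)
  have hyC : (yn n : ℂ) ≠ 0 := by exact_mod_cast hy0.ne'
  have hpC : (Real.pi : ℂ) ≠ 0 := by exact_mod_cast Real.pi_ne_zero
  simp only [Function.comp]
  rw [Acoef_eq]
  unfold Qn
  have e1 : Real.exp (-(2*(Cc/sn n^2))) = (Real.exp (Real.pi*yn n/12))⁻¹ := by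
    rw [sn_yn n hn, ← Real.exp_neg]; congr 1; unfold Cc; field_simp; norm_num
  rw [e1, sn_yn n hn]
  have hc : ((Real.cosh (Real.pi * xn n / 12) : ℝ) : ℂ) ≠ 0 := by exact_mod_cast (Real.cosh_pos _).ne'
  have he : ((Real.exp (Real.pi*yn n/12) : ℝ) : ℂ) ≠ 0 := by exact_mod_cast (Real.exp_pos _).ne'
  have hep : (ep n : ℂ) ≠ 0 := by
    have h0 := ep_abs n
    have : ep n ≠ 0 := by intro h; rw [h] at h0; norm_num at h0
    exact_mod_cast this
  generalize Real.cosh (Real.pi * xn n / 12) = c at *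
  generalize Real.exp (Real.pi*yn n/12) = e at *
  generalize ep n = p at *
  push_cast
  field_simp

end M2

theorem Acoef_one_third_asymptotic :
    Filter.Tendsto
      (fun n : ℕ =>
        Acoef 1 3 n * ((3 * Real.sqrt (8 * (n : ℝ) - 1) : ℝ) : ℂ) /
          (((if n % 3 = 0 then (-4) * Real.sqrt 6 else 2 * Real.sqrt 6 : ℝ) : ℂ) *
            ((Real.cosh (Real.pi * Real.sqrt (8 * (n : ℝ) - 1) / 12) : ℝ) : ℂ)))
      Filter.atTop (nhds 1) := by
  exact M2.final
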